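/- Let n ≥ 1, δ > (n-1)/2, p ∈ (0,∞) with 2n/(n+1+2δ) ≤ p, and let ω ∈ A_{p(n+1+2δ)/(2n)}(ℝ^n). Then there exists a constant C > 0 such that for every Schwartz function f on ℝ^n and every ε > 0, ‖B^δ_{1/ε}(f)‖_{WL^p_ω} ≤ C ‖M(f,Φ)‖_{L^p_ω}; that is, the Bochner–Riesz means of order δ is bounded from the weighted Hardy space H^p_ω(ℝ^n) to the weighted weak Lebesgue space WL^p_ω(ℝ^n), uniformly in ε. -/

import Mathlib

noncomputable section

open MeasureTheory Real Set
open scoped ENNReal NNReal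

abbrev En (n : ℕ) : Type := EuclideanSpace ℝ (Fin n)

/-- The Bochner–Riesz kernel of order `δ`: the Fourier transform of `ξ ↦ ((1-|ξ|²)⁺)^δ`. -/
def brKernel (n : ℕ) (δ : ℝ) (x : En n) : ℂ :=
  ∫ ξ : En n, (((max (1 - ‖ξ‖ ^ 2) 0) ^ δ : ℝ) : ℂ) *
    Complex.exp (-(2 * Real.pi) * Complex.I * ((∑ i, x i * ξ i : ℝ) : ℂ))

/-- The dilated kernel `φ_ε(x) = ε^{-n} φ(x/ε)`. -/
def brKernelDil (n : ℕ) (δ ε : ℝ) (x : En n) : ℂ :=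
  (ε ^ n)⁻¹ • brKernel n δ (ε⁻¹ • x)

/-- The Bochner–Riesz means `B^δ_{1/ε} f = f * φ_ε`. -/
def brMeans (n : ℕ) (δ ε : ℝ) (f : En n → ℂ) (x : En n) : ℂ :=
  ∫ y, f y * brKernelDil n δ ε (x - y)

/-- The maximal Bochner–Riesz means `B^δ_* f`. -/
def brMax (n : ℕ) (δ : ℝ) (f : En n → ℂ) (x : En n) : ℝ≥0∞ :=
  ⨆ (ε : ℝ) (_ : 0 < ε), (‖brMeans n δ ε f x‖₊ : ℝ≥0∞)

/-- The radial maximal function `M(f,Φ)(x) = sup_{t>0} |(Φ_t * f)(x)|`. -/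
def radMax (n : ℕ) (Φ : En n → ℂ) (f : En n → ℂ) (x : En n) : ℝ≥0∞ :=
  ⨆ (t : ℝ) (_ : 0 < t), (‖∫ y, (t ^ n)⁻¹ • Φ (t⁻¹ • (x - y)) * f y‖₊ : ℝ≥0∞)

/-- Average of `ω` over the ball `B(x,r)`. -/
def ballAvg (n : ℕ) (ω : En n → ℝ≥0∞) (x : En n) (r : ℝ) : ℝ≥0∞ :=
  (volume (Metric.ball x r))⁻¹ * ∫⁻ y in Metric.ball x r, ω y

/-- The Muckenhoupt class `A_1(ℝ^n)`. -/
def IsA1 (n : ℕ) (ω : En n → ℝ≥0∞) : Prop :=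
  ∃ C : ℝ≥0∞, C < ⊤ ∧ ∀ (x : En n) (r : ℝ), 0 < r →
    ballAvg n ω x r * essSup (fun y => (ω y)⁻¹) (volume.restrict (Metric.ball x r)) ≤ C

/-- The Muckenhoupt class `A_p(ℝ^n)` for `p ∈ (1,∞)`. -/
def IsApGT1 (n : ℕ) (p : ℝ) (ω : En n → ℝ≥0∞) : Prop :=
  ∃ C : ℝ≥0∞, C < ⊤ ∧ ∀ (x : En n) (r : ℝ), 0 < r →
    ballAvg n ω x r * (ballAvg n (fun y => ω y ^ (1/(1-p))) x r) ^ (p - 1) ≤ C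

/-- The Muckenhoupt class `A_p(ℝ^n)` for `p ∈ [1,∞)`. -/
def IsAp (n : ℕ) (p : ℝ) (ω : En n → ℝ≥0∞) : Prop :=
  if p = 1 then IsA1 n ω else IsApGT1 n p ω

/-- The weighted Lebesgue quasinorm `‖g‖_{L^p_ω}` (of a nonnegative function). -/
def wLp (n : ℕ) (ω : En n → ℝ≥0∞) (p : ℝ) (g : En n → ℝ≥0∞) : ℝ≥0∞ :=
  (∫⁻ x, g x ^ p * ω x) ^ (1/p)

/-- The weighted weak Lebesgue quasinorm `‖g‖_{WL^p_ω}`. -/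
def wWLp (n : ℕ) (ω : En n → ℝ≥0∞) (p : ℝ) (g : En n → ℝ≥0∞) : ℝ≥0∞ :=
  ⨆ (α : ℝ≥0) (_ : 0 < α),
    (α : ℝ≥0∞) * (∫⁻ x in {x | (α : ℝ≥0∞) < g x}, ω x) ^ (1/p)


namespace BR

/-- Oscillatory integral bound with a one-sided singularity of order `μ ∈ (-1,0]`. -/
lemma osc_base (G G' : ℝ → ℝ) (M μ : ℝ) (hμ1 : -1 < μ) (hμ0 : μ ≤ 0)
    (hG : ∀ s ∈ Icc (0:ℝ) 1, HasDerivAt G (G' s) s) (hG'c : ContinuousOn G' (Icc 0 1))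
    (hM : ∀ s ∈ Icc (0:ℝ) 1, |G s| ≤ M) (hM' : ∀ s ∈ Icc (0:ℝ) 1, |G' s| ≤ M) :
    ∃ C : ℝ, ∀ r : ℝ, 1 ≤ |r| →
      ‖∫ s in (0:ℝ)..1, ((G s * (1 - s) ^ μ : ℝ) : ℂ) * Complex.exp (Complex.I * r * s)‖
        ≤ C * |r| ^ (-(μ + 1)) := by
  have hM0 : 0 ≤ M := (abs_nonneg _).trans (hM 0 (by simp))
  have hGc : ContinuousOn G (Icc 0 1) := fun s hs => (hG s hs).continuousAt.continuousWithinAt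
  refine ⟨M / (μ + 1) + 4 * M, fun r hr => ?_⟩
  have hr0 : 0 < |r| := by linarith
  have hrne : r ≠ 0 := abs_pos.mp hr0
  set h : ℝ := |r|⁻¹ with hh
  have hh0 : 0 < h := by positivity
  have hh1 : h ≤ 1 := inv_le_one_of_one_le₀ hr
  have hrpow : |r| ^ (-(μ + 1)) = h ^ (μ + 1) := by
    rw [hh, Real.rpow_neg hr0.le, Real.inv_rpow hr0.le]
  rw [hrpow]
  have hexp : ∀ s : ℝ, ‖Complex.exp (Complex.I * r * s)‖ = 1 := by
    intro s
    rw [show Complex.I * r * s = ((r * s : ℝ) : ℂ) * Complex.I by push_cast; ring]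
    exact Complex.norm_exp_ofReal_mul_I _
  have hpi : ∀ a b : ℝ, IntervalIntegrable (fun s : ℝ => (1 - s) ^ μ) volume a b := by
    intro a b
    have := (intervalIntegral.intervalIntegrable_rpow' (a := 1 - a) (b := 1 - b) hμ1).comp_sub_left 1
    simpa using this
  have hItg : IntervalIntegrable (fun s : ℝ => ((G s * (1 - s) ^ μ : ℝ) : ℂ) *
      Complex.exp (Complex.I * r * s)) volume 0 1 := by
    apply IntervalIntegrable.mul_continuousOn
    · have : IntervalIntegrable (fun s : ℝ => G s * (1 - s) ^ μ) volume 0 1 := by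
        apply IntervalIntegrable.continuousOn_mul (hpi 0 1)
        rwa [uIcc_of_le zero_le_one]
      exact ⟨this.1.ofReal, this.2.ofReal⟩
    · fun_prop
  have h1h : (0:ℝ) ≤ 1 - h := by linarith
  have hint1 := hItg.mono_set (c := 0) (d := 1 - h)
    (by rw [uIcc_of_le h1h, uIcc_of_le zero_le_one]; exact Icc_subset_Icc le_rfl (by linarith))
  have hint2 := hItg.mono_set (c := 1 - h) (d := 1)
    (by rw [uIcc_of_le (by linarith), uIcc_of_le zero_le_one]; exact Icc_subset_Icc h1h le_rfl)
  rw [← intervalIntegral.integral_add_adjacent_intervals hint1 hint2]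
  -- tail
  have htail : ‖∫ s in (1-h)..1, ((G s * (1 - s) ^ μ : ℝ) : ℂ) * Complex.exp (Complex.I * r * s)‖
      ≤ M / (μ + 1) * h ^ (μ + 1) := by
    have h1 : ‖∫ s in (1-h)..1, ((G s * (1 - s) ^ μ : ℝ) : ℂ) * Complex.exp (Complex.I * r * s)‖
      ≤ ∫ s in (1-h)..1, M * (1 - s) ^ μ := by
      apply intervalIntegral.norm_integral_le_of_norm_le (by linarith)
      · refine Filter.Eventually.of_forall fun s hs => ?_
        rw [norm_mul, hexp, mul_one, Complex.norm_real, norm_mul, Real.norm_eq_abs,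
          Real.norm_eq_abs, abs_of_nonneg (Real.rpow_nonneg (by linarith [hs.2]) μ)]
        exact mul_le_mul_of_nonneg_right (hM s ⟨by linarith [hs.1], hs.2⟩)
          (Real.rpow_nonneg (by linarith [hs.2]) μ)
      · exact (hpi _ _).const_mul _
    refine h1.trans (le_of_eq ?_)
    rw [intervalIntegral.integral_const_mul]
    have : ∫ s in (1-h)..1, (1 - s) ^ μ = ∫ s in (0:ℝ)..h, s ^ μ := by
      rw [intervalIntegral.integral_comp_sub_left (fun s => s ^ μ) 1]; simp
    rw [this, integral_rpow (Or.inl hμ1), Real.zero_rpow (by linarith)]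
    ring
  -- head
  have hpos : ∀ s ∈ Icc 0 (1 - h), 0 < 1 - s := fun s hs => by linarith [hs.2]
  have hmem : ∀ s ∈ Icc 0 (1 - h), s ∈ Icc (0:ℝ) 1 := fun s hs => ⟨hs.1, by linarith [hs.2]⟩
  have hpowle : ∀ s ∈ Icc 0 (1 - h), (1 - s) ^ μ ≤ h ^ μ := fun s hs =>
    Real.rpow_le_rpow_of_nonpos hh0 (by linarith [hs.2]) hμ0
  have hdpow : ∀ s ∈ Icc 0 (1 - h), HasDerivAt (fun s : ℝ => (1 - s) ^ μ)
      (-μ * (1 - s) ^ (μ - 1)) s := by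
    intro s hs
    have := ((hasDerivAt_id s).const_sub 1).rpow_const (p := μ) (Or.inl (hpos s hs).ne')
    refine HasDerivAt.congr_deriv this ?_
    show -1 * μ * (1 - s) ^ (μ - 1) = _
    ring
  have hIr : Complex.I * r ≠ 0 := mul_ne_zero Complex.I_ne_zero (by exact_mod_cast hrne)
  have hdu : ∀ s ∈ Icc 0 (1-h), HasDerivAt (fun s : ℝ => ((G s * (1 - s) ^ μ : ℝ) : ℂ))
      ((G' s * (1 - s) ^ μ + G s * (-μ * (1 - s) ^ (μ - 1)) : ℝ) : ℂ) s := by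
    intro s hs
    exact ((hG s (hmem s hs)).mul (hdpow s hs)).ofReal_comp
  have hdv : ∀ s : ℝ, HasDerivAt (fun s : ℝ => Complex.exp (Complex.I * r * s) / (Complex.I * r))
      (Complex.exp (Complex.I * r * s)) s := by
    intro s
    have h1 : HasDerivAt (fun z : ℂ => Complex.exp (Complex.I * r * z)  / (Complex.I * r))
        (Complex.exp (Complex.I * r * s)) (s:ℂ) := by
      have := ((hasDerivAt_id (s:ℂ)).const_mul (Complex.I * r)).cexp.div_const (Complex.I * r)
      refine HasDerivAt.congr_deriv this ?_
      show Complex.exp (Complex.I * r * s) * (Complex.I * r * 1) / (Complex.I * r) = _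
      rw [mul_one, mul_div_assoc, div_self hIr, mul_one]
    exact h1.comp_ofReal
  have hpc : ∀ e : ℝ, ContinuousOn (fun s : ℝ => (1 - s) ^ e) (Icc 0 (1-h)) := by
    intro e
    apply ContinuousOn.rpow_const (by fun_prop)
    intro s hs; exact Or.inl (hpos s hs).ne'
  have hsub : Icc 0 (1-h) ⊆ Icc (0:ℝ) 1 := hmem
  have hu'c : ContinuousOn (fun s => G' s * (1 - s) ^ μ + G s * (-μ * (1 - s) ^ (μ - 1)))
      (Icc 0 (1-h)) :=
    ((hG'c.mono hsub).mul (hpc _)).add ((hGc.mono hsub).mul (continuousOn_const.mul (hpc _)))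
  have hhead : ‖∫ s in (0:ℝ)..(1-h), ((G s * (1 - s) ^ μ : ℝ) : ℂ) *
      Complex.exp (Complex.I * r * s)‖ ≤ 4 * M * h ^ (μ + 1) := by
    have hibp := intervalIntegral.integral_mul_deriv_eq_deriv_mul (a := 0) (b := 1 - h)
      (u := fun s : ℝ => ((G s * (1 - s) ^ μ : ℝ) : ℂ))
      (u' := fun s : ℝ => ((G' s * (1 - s) ^ μ + G s * (-μ * (1 - s) ^ (μ - 1)) : ℝ) : ℂ))
      (v := fun s : ℝ => Complex.exp (Complex.I * r * s) / (Complex.I * r))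
      (v' := fun s : ℝ => Complex.exp (Complex.I * r * s))
      (fun s hs => hdu s (by rwa [uIcc_of_le h1h] at hs))
      (fun s _ => hdv s)
      (by
        apply ContinuousOn.intervalIntegrable
        rw [uIcc_of_le h1h]
        exact Complex.continuous_ofReal.comp_continuousOn hu'c)
      (by apply Continuous.intervalIntegrable; fun_prop)
    rw [hibp]
    have hvn : ∀ s : ℝ, ‖Complex.exp (Complex.I * r * s) / (Complex.I * r)‖ = h := by
      intro s
      rw [norm_div, hexp, norm_mul, Complex.norm_I, one_mul, Complex.norm_real, Real.norm_eq_abs,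
        hh, one_div]
    have hhm : h ^ (μ+1) = h ^ μ * h := by rw [Real.rpow_add_one hh0.ne']
    have hhmle : h ≤ h ^ (μ+1) := by
      have := Real.rpow_le_rpow_of_exponent_ge hh0 hh1 (show μ + 1 ≤ 1 by linarith)
      simpa using this
    have hun : ∀ s ∈ Icc 0 (1-h), ‖((G s * (1 - s) ^ μ : ℝ) : ℂ)‖ ≤ M * (1-s)^μ := by
      intro s hs
      rw [Complex.norm_real, norm_mul, Real.norm_eq_abs, Real.norm_eq_abs,
          abs_of_nonneg (Real.rpow_nonneg (hpos s hs).le μ)]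
      exact mul_le_mul_of_nonneg_right (hM s (hmem s hs)) (Real.rpow_nonneg (hpos s hs).le μ)
    have hb1 : ‖((G (1-h) * (1 - (1-h)) ^ μ : ℝ) : ℂ) *
        (Complex.exp (Complex.I * r * (1-h : ℝ)) / (Complex.I * r))‖ ≤ M * h ^ (μ+1) := by
      rw [norm_mul, hvn, hhm, ← mul_assoc]
      refine mul_le_mul_of_nonneg_right ?_ hh0.le
      have := hun (1-h) ⟨h1h, le_rfl⟩
      simpa using this
    have hb2 : ‖((G 0 * (1 - 0) ^ μ : ℝ) : ℂ) *
        (Complex.exp (Complex.I * r * (0 : ℝ)) / (Complex.I * r))‖ ≤ M * h ^ (μ+1) := by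
      rw [norm_mul, hvn]
      have := hun 0 ⟨le_rfl, h1h⟩
      refine mul_le_mul (by simpa using this) hhmle hh0.le hM0
    have hb3 : ‖∫ s in (0:ℝ)..(1-h), ((G' s * (1 - s) ^ μ + G s * (-μ * (1 - s) ^ (μ - 1)) : ℝ) : ℂ)
        * (Complex.exp (Complex.I * r * s) / (Complex.I * r))‖ ≤ 2 * M * h ^ (μ+1) := by
      have h1 : ‖∫ s in (0:ℝ)..(1-h), ((G' s * (1 - s) ^ μ + G s * (-μ * (1 - s) ^ (μ - 1)) : ℝ) : ℂ)
        * (Complex.exp (Complex.I * r * s) / (Complex.I * r))‖ ≤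
          ∫ s in (0:ℝ)..(1-h), (M * h ^ μ + M * (-μ * (1 - s) ^ (μ - 1))) * h := by
        apply intervalIntegral.norm_integral_le_of_norm_le h1h
        · refine Filter.Eventually.of_forall fun s hs => ?_
          have hs' : s ∈ Icc 0 (1-h) := ⟨hs.1.le, hs.2⟩
          rw [norm_mul, hvn, Complex.norm_real, Real.norm_eq_abs]
          refine mul_le_mul_of_nonneg_right ?_ hh0.le
          refine (abs_add_le _ _).trans ?_
          rw [abs_mul, abs_mul, abs_of_nonneg (Real.rpow_nonneg (hpos s hs').le μ)]
          have hnn : 0 ≤ -μ * (1 - s) ^ (μ - 1) :=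
            mul_nonneg (by linarith) (Real.rpow_nonneg (hpos s hs').le _)
          rw [abs_of_nonneg hnn]
          refine add_le_add ?_ ?_
          · exact mul_le_mul (hM' s (hmem s hs')) (hpowle s hs')
              (Real.rpow_nonneg (hpos s hs').le μ) hM0
          · exact mul_le_mul_of_nonneg_right (hM s (hmem s hs')) hnn
        · apply ContinuousOn.intervalIntegrable
          rw [uIcc_of_le h1h]
          exact (continuousOn_const.add (continuousOn_const.mul
            (continuousOn_const.mul (hpc _)))).mul continuousOn_const
      refine h1.trans ?_
      have hci : IntervalIntegrable (fun s : ℝ => -μ * (1 - s) ^ (μ - 1)) volume 0 (1-h) := by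
        apply ContinuousOn.intervalIntegrable
        rw [uIcc_of_le h1h]
        exact continuousOn_const.mul (hpc _)
      have hftc : ∫ s in (0:ℝ)..(1-h), -μ * (1 - s) ^ (μ - 1) = h ^ μ - 1 := by
        rw [intervalIntegral.integral_eq_sub_of_hasDerivAt
          (fun s hs => hdpow s (by rwa [uIcc_of_le h1h] at hs)) hci]
        simp
      rw [intervalIntegral.integral_mul_const, intervalIntegral.integral_add
        (by simp) (hci.const_mul _), intervalIntegral.integral_const_mul M (fun s => -μ * (1 - s) ^ (μ - 1)),
        hftc, intervalIntegral.integral_const, hhm, ← mul_assoc]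
      refine mul_le_mul_of_nonneg_right ?_ hh0.le
      have hhp : 0 ≤ h ^ μ := Real.rpow_nonneg hh0.le _
      simp only [sub_zero, smul_eq_mul]
      have e1 : (1 - h) * (M * h ^ μ) ≤ 1 * (M * h ^ μ) :=
        mul_le_mul_of_nonneg_right (by linarith) (by positivity)
      linarith
    refine (norm_sub_le _ _).trans ?_
    refine (add_le_add ((norm_sub_le _ _).trans (add_le_add hb1 hb2)) hb3).trans ?_
    linarith
  calc _ ≤ _ := norm_add_le _ _
    _ ≤ _ := add_le_add hhead htail
    _ = _ := by ring

end BR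


namespace BR

lemma intervalIntegrable_half (μ : ℝ) (hμ : -1 < μ) :
    IntervalIntegrable (fun s : ℝ => (1 - s ^ 2) ^ μ) volume 0 1 := by
  have hpi : IntervalIntegrable (fun s : ℝ => (1 - s) ^ μ) volume 0 1 := by
    have := (intervalIntegral.intervalIntegrable_rpow' (a := 1 - 0) (b := 1 - 1) hμ).comp_sub_left 1
    simpa using this
  have h2 : IntervalIntegrable (fun s : ℝ => (1 + s) ^ μ * (1 - s) ^ μ) volume 0 1 := by
    apply IntervalIntegrable.continuousOn_mul hpi
    apply ContinuousOn.rpow_const (by fun_prop)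
    intro s hs
    rw [uIcc_of_le zero_le_one] at hs
    exact Or.inl (by linarith [hs.1])
  refine h2.congr ?_
  intro s hs
  rw [uIoc_of_le zero_le_one] at hs
  show (1 + s) ^ μ * (1 - s) ^ μ = (1 - s ^ 2) ^ μ
  rw [← Real.mul_rpow (by linarith [hs.1]) (by linarith [hs.2])]
  ring_nf

lemma intervalIntegrable_full (μ : ℝ) (hμ : -1 < μ) :
    IntervalIntegrable (fun s : ℝ => (1 - s ^ 2) ^ μ) volume (-1) 1 := by
  have h1 := intervalIntegrable_half μ hμ
  have h2 : IntervalIntegrable (fun s : ℝ => (1 - s ^ 2) ^ μ) volume (-1) 0 := by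
    have := h1.comp_sub_left 0
    simp only [zero_sub, neg_sq, sub_zero] at this
    simpa using this.symm
  exact h2.trans h1

lemma osc_half (P : Polynomial ℝ) (μ : ℝ) (hμ1 : -1 < μ) (hμ0 : μ ≤ 0) :
    ∃ C : ℝ, ∀ r : ℝ, 1 ≤ |r| →
      ‖∫ s in (0:ℝ)..1, ((P.eval s * (1 - s ^ 2) ^ μ : ℝ) : ℂ) * Complex.exp (Complex.I * r * s)‖
        ≤ C * |r| ^ (-(μ + 1)) := by
  set G : ℝ → ℝ := fun s => P.eval s * (1 + s) ^ μ
  set G' : ℝ → ℝ := fun s => P.derivative.eval s * (1 + s) ^ μ + P.eval s * (μ * (1 + s) ^ (μ - 1))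
  have hpos : ∀ s ∈ Icc (0:ℝ) 1, (1 + s) ≠ 0 := fun s hs => by linarith [hs.1]
  have hpc : ∀ e : ℝ, ContinuousOn (fun s : ℝ => (1 + s) ^ e) (Icc 0 1) := by
    intro e
    apply ContinuousOn.rpow_const (by fun_prop)
    intro s hs; exact Or.inl (hpos s hs)
  have hGc : ContinuousOn G (Icc 0 1) := P.continuous.continuousOn.mul (hpc _)
  have hG'c : ContinuousOn G' (Icc 0 1) :=
    (P.derivative.continuous.continuousOn.mul (hpc _)).add
      (P.continuous.continuousOn.mul (continuousOn_const.mul (hpc _)))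
  obtain ⟨M1, hM1⟩ := isCompact_Icc.exists_bound_of_continuousOn hGc
  obtain ⟨M2, hM2⟩ := isCompact_Icc.exists_bound_of_continuousOn hG'c
  obtain ⟨C, hC⟩ := osc_base G G' (max M1 M2) μ hμ1 hμ0
    (by
      intro s hs
      have h1 := ((hasDerivAt_id s).const_add 1).rpow_const (p := μ) (Or.inl (hpos s hs))
      have h2 : HasDerivAt (fun s : ℝ => (1 + s) ^ μ) (μ * (1 + s) ^ (μ - 1)) s := by
        refine HasDerivAt.congr_deriv h1 ?_
        show 1 * μ * (1 + s) ^ (μ - 1) = _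
        ring
      exact (P.hasDerivAt s).mul h2) hG'c
    (fun s hs => (hM1 s hs).trans (le_max_left _ _))
    (fun s hs => (hM2 s hs).trans (le_max_right _ _))
  refine ⟨C, fun r hr => ?_⟩
  refine le_trans (le_of_eq ?_) (hC r hr)
  congr 1
  apply intervalIntegral.integral_congr
  intro s hs
  rw [uIcc_of_le zero_le_one] at hs
  show _ = ((P.eval s * (1 + s) ^ μ * (1 - s) ^ μ : ℝ) : ℂ) * _
  rw [mul_assoc, ← Real.mul_rpow (by linarith [hs.1]) (by linarith [hs.2])]
  ring_nf

lemma osc_integrand_integrable (P : Polynomial ℝ) (μ : ℝ) (hμ1 : -1 < μ) (r : ℝ) :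
    IntervalIntegrable (fun s : ℝ => ((P.eval s * (1 - s ^ 2) ^ μ : ℝ) : ℂ) *
      Complex.exp (Complex.I * r * s)) volume (-1) 1 := by
  apply IntervalIntegrable.mul_continuousOn
  · have := (intervalIntegrable_full μ hμ1).continuousOn_mul (f := fun s => (1 - s ^ 2) ^ μ)
      (g := fun s => P.eval s) P.continuous.continuousOn
    exact ⟨this.1.ofReal, this.2.ofReal⟩
  · fun_prop

lemma osc_low (P : Polynomial ℝ) (μ : ℝ) (hμ1 : -1 < μ) (hμ0 : μ ≤ 0) :
    ∃ C : ℝ, ∀ r : ℝ, 1 ≤ |r| →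
      ‖∫ s in (-1:ℝ)..1, ((P.eval s * (1 - s ^ 2) ^ μ : ℝ) : ℂ) * Complex.exp (Complex.I * r * s)‖
        ≤ C * |r| ^ (-(μ + 1)) := by
  obtain ⟨C1, h1⟩ := osc_half P μ hμ1 hμ0
  obtain ⟨C2, h2⟩ := osc_half (P.comp (-Polynomial.X)) μ hμ1 hμ0
  refine ⟨C1 + C2, fun r hr => ?_⟩
  have hItg := osc_integrand_integrable P μ hμ1 r
  have hi1 := hItg.mono_set (c := -1) (d := 0)
    (by rw [uIcc_of_le (by norm_num), uIcc_of_le (by norm_num)]; exact Icc_subset_Icc le_rfl (by norm_num))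
  have hi2 := hItg.mono_set (c := 0) (d := 1)
    (by rw [uIcc_of_le (by norm_num), uIcc_of_le (by norm_num)]; exact Icc_subset_Icc (by norm_num) le_rfl)
  rw [← intervalIntegral.integral_add_adjacent_intervals hi1 hi2]
  have hneg : ∫ s in (-1:ℝ)..0, ((P.eval s * (1 - s ^ 2) ^ μ : ℝ) : ℂ) *
      Complex.exp (Complex.I * r * s) = ∫ s in (0:ℝ)..1,
        (((P.comp (-Polynomial.X)).eval s * (1 - s ^ 2) ^ μ : ℝ) : ℂ) *
          Complex.exp (Complex.I * (-r : ℝ) * s) := by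
    have := intervalIntegral.integral_comp_neg (a := 0) (b := 1) (fun s : ℝ =>
      ((P.eval s * (1 - s ^ 2) ^ μ : ℝ) : ℂ) * Complex.exp (Complex.I * r * s))
    rw [neg_zero] at this
    rw [← this]
    congr 1
    ext s
    simp [Polynomial.eval_comp]
  rw [hneg]
  refine (norm_add_le _ _).trans ?_
  have e1 := h2 (-r) (by rwa [abs_neg])
  rw [abs_neg] at e1
  have e2 := h1 r hr
  linarith

lemma osc_all (m : ℕ) : ∀ (P : Polynomial ℝ) (μ : ℝ), -1 < μ → μ ≤ m →
    ∃ C : ℝ, ∀ r : ℝ, 1 ≤ |r| →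
      ‖∫ s in (-1:ℝ)..1, ((P.eval s * (1 - s ^ 2) ^ μ : ℝ) : ℂ) * Complex.exp (Complex.I * r * s)‖
        ≤ C * |r| ^ (-(μ + 1)) := by
  induction m with
  | zero => intro P μ h1 h2; exact osc_low P μ h1 (by simpa using h2)
  | succ m ih =>
    intro P μ hμ1 hμm
    rcases le_or_gt μ 0 with hμ0 | hμ0
    · exact osc_low P μ hμ1 hμ0
    set Q : Polynomial ℝ := P.derivative * (1 - Polynomial.X ^ 2) -
      Polynomial.C (2 * μ) * Polynomial.X * P with hQ
    obtain ⟨C, hC⟩ := ih Q (μ - 1) (by linarith) (by push_cast at hμm; linarith)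
    refine ⟨C, fun r hr => ?_⟩
    have hr0 : 0 < |r| := by linarith
    have hrne : r ≠ 0 := abs_pos.mp hr0
    have hIr : Complex.I * r ≠ 0 := mul_ne_zero Complex.I_ne_zero (by exact_mod_cast hrne)
    have hdv : ∀ s : ℝ, HasDerivAt (fun s : ℝ => Complex.exp (Complex.I * r * s) / (Complex.I * r))
        (Complex.exp (Complex.I * r * s)) s := by
      intro s
      have h1 : HasDerivAt (fun z : ℂ => Complex.exp (Complex.I * r * z)  / (Complex.I * r))
          (Complex.exp (Complex.I * r * s)) (s:ℂ) := by
        have := ((hasDerivAt_id (s:ℂ)).const_mul (Complex.I * r)).cexp.div_const (Complex.I * r)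
        refine HasDerivAt.congr_deriv this ?_
        show Complex.exp (Complex.I * r * s) * (Complex.I * r * 1) / (Complex.I * r) = _
        rw [mul_one, mul_div_assoc, div_self hIr, mul_one]
      exact h1.comp_ofReal
    have hdu : ∀ s ∈ Ioo (-1:ℝ) 1, HasDerivAt (fun s : ℝ => ((P.eval s * (1 - s ^ 2) ^ μ : ℝ) : ℂ))
        ((Q.eval s * (1 - s ^ 2) ^ (μ - 1) : ℝ) : ℂ) s := by
      intro s hs
      have hp : 0 < 1 - s ^ 2 := by nlinarith [hs.1, hs.2]
      have h1 : HasDerivAt (fun s : ℝ => 1 - s ^ 2) (-(2 * s)) s := by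
        simpa using (hasDerivAt_pow 2 s).const_sub 1
      have h2 := h1.rpow_const (p := μ) (Or.inl hp.ne')
      refine HasDerivAt.ofReal_comp (HasDerivAt.congr_deriv ((P.hasDerivAt s).mul h2) ?_)
      have : (1 - s ^ 2) ^ μ = (1 - s ^ 2) ^ (μ - 1) * (1 - s ^ 2) := by
        rw [← Real.rpow_add_one hp.ne']; ring_nf
      rw [this]
      simp [hQ]
      ring
    have hibp := intervalIntegral.integral_mul_deriv_eq_deriv_mul_of_hasDeriv_right (a := -1) (b := 1)
      (u := fun s : ℝ => ((P.eval s * (1 - s ^ 2) ^ μ : ℝ) : ℂ))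
      (u' := fun s : ℝ => ((Q.eval s * (1 - s ^ 2) ^ (μ - 1) : ℝ) : ℂ))
      (v := fun s : ℝ => Complex.exp (Complex.I * r * s) / (Complex.I * r))
      (v' := fun s : ℝ => Complex.exp (Complex.I * r * s))
      (by
        refine Continuous.continuousOn ?_
        refine Complex.continuous_ofReal.comp (P.continuous.mul ?_)
        exact Continuous.rpow_const (by fun_prop) (fun s => Or.inr hμ0.le))
      (by
        refine Continuous.continuousOn ?_
        fun_prop)
      (fun s hs => (hdu s (by simpa using hs)).hasDerivWithinAt)
      (fun s _ => (hdv s).hasDerivWithinAt)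
      (by
        have := osc_integrand_integrable Q (μ - 1) (by linarith) 0
        simpa using this)
      (by apply Continuous.intervalIntegrable; fun_prop)
    rw [hibp]
    have hz : ((0:ℝ)) ^ μ = 0 := Real.zero_rpow hμ0.ne'
    have hdiv : ∫ s in (-1:ℝ)..1, ((Q.eval s * (1 - s ^ 2) ^ (μ - 1) : ℝ) : ℂ) *
        (Complex.exp (Complex.I * r * s) / (Complex.I * r)) =
        (∫ s in (-1:ℝ)..1, ((Q.eval s * (1 - s ^ 2) ^ (μ - 1) : ℝ) : ℂ) *
        Complex.exp (Complex.I * r * s)) / (Complex.I * r) := by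
      rw [← intervalIntegral.integral_div]
      congr 1; ext s; ring
    rw [hdiv]
    simp only [one_pow, sub_self, hz, mul_zero, Complex.ofReal_zero, zero_mul, even_two, Even.neg_pow,
      zero_sub, norm_neg, norm_div, norm_mul, Complex.norm_I, one_mul, Complex.norm_real,
      Real.norm_eq_abs]
    rw [div_le_iff₀ hr0]
    refine (hC r hr).trans (le_of_eq ?_)
    rw [mul_assoc, ← Real.rpow_add_one hr0.ne']
    ring_nf

/-- One-dimensional decay. -/
lemma osc_final (μ : ℝ) (hμ : -1 < μ) :
    ∃ C : ℝ, ∀ r : ℝ, 1 ≤ |r| →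
      ‖∫ s in (-1:ℝ)..1, (((1 - s ^ 2) ^ μ : ℝ) : ℂ) * Complex.exp (Complex.I * r * s)‖
        ≤ C * |r| ^ (-(μ + 1)) := by
  obtain ⟨C, hC⟩ := osc_all ⌈μ⌉₊ 1 μ hμ (Nat.le_ceil _)
  refine ⟨C, fun r hr => ?_⟩
  simpa using hC r hr

end BR


namespace BR

lemma brKernel_inner (n : ℕ) (δ : ℝ) (x : En n) : brKernel n δ x =
    ∫ ξ : En n, (((max (1 - ‖ξ‖ ^ 2) 0) ^ δ : ℝ) : ℂ) *
    Complex.exp (-(2 * Real.pi) * Complex.I * ((inner ℝ x ξ : ℝ) : ℂ)) := by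
  unfold brKernel
  congr 1; ext ξ
  rw [PiLp.inner_apply]
  simp [mul_comm]

lemma brKernel_isometry (n : ℕ) (δ : ℝ) (A : En n ≃ₗᵢ[ℝ] En n) (x : En n) :
    brKernel n δ (A x) = brKernel n δ x := by
  rw [brKernel_inner, brKernel_inner,
    ← (A.measurePreserving).integral_comp A.toHomeomorph.measurableEmbedding]
  congr 1; ext ξ
  simp

lemma brKernel_radial (m : ℕ) (δ : ℝ) (x : En (m+1)) :
    brKernel (m+1) δ x = brKernel (m+1) δ (EuclideanSpace.single 0 ‖x‖) := by
  have h : ‖x‖ = ‖(EuclideanSpace.single 0 ‖x‖ : En (m+1))‖ := by simp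
  have := Submodule.reflection_sub h
  rw [← this, brKernel_isometry]

lemma brKernel_prod (m : ℕ) (δ r : ℝ) :
    brKernel (m+1) δ (EuclideanSpace.single 0 r) =
    ∫ z : ℝ × (Fin m → ℝ), (((max (1 - z.1 ^ 2 - ∑ i, z.2 i ^ 2) 0) ^ δ : ℝ) : ℂ) *
      Complex.exp (-(2 * Real.pi) * Complex.I * ((r * z.1 : ℝ) : ℂ)) := by
  have h1 := (volume_preserving_piFinSuccAbove (fun _ : Fin (m+1) => ℝ) 0)
  have h2 := (EuclideanSpace.volume_preserving_symm_measurableEquiv_toLp (Fin (m+1)))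
  have h3 := h1.comp h2
  rw [← h3.integral_comp ((MeasurableEquiv.measurableEmbedding _).comp
    (MeasurableEquiv.measurableEmbedding _))]
  unfold brKernel
  congr 1; ext ξ
  have e1 : ‖ξ‖ ^ 2 = ξ 0 ^ 2 + ∑ i : Fin m, ξ i.succ ^ 2 := by
    rw [EuclideanSpace.norm_sq_eq, Fin.sum_univ_succ]
    simp
  have e2 : ∑ i, (EuclideanSpace.single 0 r : En (m+1)) i * ξ i = r * ξ 0 := by
    rw [Fin.sum_univ_succ]
    simp
  rw [e1, e2, ← sub_sub]
  rfl

lemma inner_scaling (m : ℕ) (δ : ℝ) (hδ : 0 < δ) (s : ℝ) :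
    ∫ v : Fin m → ℝ, (max (1 - s ^ 2 - ∑ i, v i ^ 2) 0) ^ δ =
      (max (1 - s ^ 2) 0) ^ (δ + m / 2) * ∫ v : Fin m → ℝ, (max (1 - ∑ i, v i ^ 2) 0) ^ δ := by
  rcases le_or_gt (1 - s ^ 2) 0 with h | h
  · rw [max_eq_right h, Real.zero_rpow (by positivity), zero_mul]
    have : ∀ v : Fin m → ℝ, (max (1 - s ^ 2 - ∑ i, v i ^ 2) 0) ^ δ = 0 := by
      intro v
      rw [max_eq_right, Real.zero_rpow hδ.ne']
      have : 0 ≤ ∑ i, v i ^ 2 := Finset.sum_nonneg fun i _ => sq_nonneg _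
      linarith
    simp [this]
  · set t := Real.sqrt (1 - s ^ 2) with ht
    have ht0 : 0 < t := Real.sqrt_pos.mpr h
    have ht2 : t ^ 2 = 1 - s ^ 2 := Real.sq_sqrt h.le
    have := Measure.integral_comp_smul (volume : Measure (Fin m → ℝ))
      (fun v : Fin m → ℝ => (max (1 - s ^ 2 - ∑ i, v i ^ 2) 0) ^ δ) t
    have h2 : ∀ v : Fin m → ℝ, (max (1 - s ^ 2 - ∑ i, (t • v) i ^ 2) 0) ^ δ =
        (t ^ 2) ^ δ * (max (1 - ∑ i, v i ^ 2) 0) ^ δ := by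
      intro v
      rw [← Real.mul_rpow (by positivity) (le_max_right _ _), mul_max_of_nonneg _ _ (by positivity),
        mul_zero, mul_sub, Finset.mul_sum, ht2]
      simp [mul_pow, ht2]
    simp only [h2] at this
    rw [integral_const_mul] at this
    simp only [Module.finrank_fin_fun, smul_eq_mul] at this
    rw [abs_of_nonneg (by positivity)] at this
    have h3 : ∫ v : Fin m → ℝ, (max (1 - s ^ 2 - ∑ i, v i ^ 2) 0) ^ δ =
      t ^ m * ((t ^ 2) ^ δ * ∫ v : Fin m → ℝ, (max (1 - ∑ i, v i ^ 2) 0) ^ δ) := by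
      rw [this]; field_simp
    rw [h3, max_eq_left h.le, Real.rpow_add h, ← ht2]
    have : (t ^ 2) ^ ((m:ℝ) / 2) = t ^ m := by
      rw [← Real.rpow_natCast t 2, ← Real.rpow_mul ht0.le]
      rw [show ((2:ℕ):ℝ) * ((m:ℝ) / 2) = m by push_cast; ring, Real.rpow_natCast]
    rw [this]; ring

lemma prod_integrable (m : ℕ) (δ r : ℝ) (hδ : 0 < δ) :
    Integrable (fun z : ℝ × (Fin m → ℝ) => (((max (1 - z.1 ^ 2 - ∑ i, z.2 i ^ 2) 0) ^ δ : ℝ) : ℂ) *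
      Complex.exp (-(2 * Real.pi) * Complex.I * ((r * z.1 : ℝ) : ℂ))) := by
  apply Continuous.integrable_of_hasCompactSupport
  · refine Continuous.mul (Complex.continuous_ofReal.comp
      (Continuous.rpow_const (by fun_prop) (fun s => Or.inr hδ.le))) (by fun_prop)
  · refine HasCompactSupport.intro (isCompact_closedBall (0 : ℝ × (Fin m → ℝ)) 1) ?_
    intro z hz
    rw [max_eq_right, Real.zero_rpow hδ.ne']
    · simp
    · by_contra hcon
      push Not at hcon
      apply hz
      have h1 : ∀ i, 0 ≤ z.2 i ^ 2 := fun i => sq_nonneg _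
      have h0 := sq_nonneg z.1
      rw [mem_closedBall_zero_iff, Prod.norm_def]
      apply max_le
      · rw [Real.norm_eq_abs]
        refine abs_le_of_sq_le_sq ?_ zero_le_one
        rw [one_pow]
        have := Finset.sum_nonneg (s := Finset.univ) fun i _ => h1 i
        linarith
      · rw [pi_norm_le_iff_of_nonneg zero_le_one]
        intro i
        rw [Real.norm_eq_abs]
        refine abs_le_of_sq_le_sq ?_ zero_le_one
        rw [one_pow]
        have := Finset.single_le_sum (s := Finset.univ) (fun i _ => h1 i) (Finset.mem_univ i)
        linarith

lemma brKernel_oneDim (m : ℕ) (δ r : ℝ) (hδ : 0 < δ) :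
    brKernel (m+1) δ (EuclideanSpace.single 0 r) =
    ((∫ v : Fin m → ℝ, (max (1 - ∑ i, v i ^ 2) 0) ^ δ : ℝ) : ℂ) *
    ∫ s in (-1:ℝ)..1, (((1 - s ^ 2) ^ (δ + m / 2) : ℝ) : ℂ) *
      Complex.exp (Complex.I * (-(2 * Real.pi * r) : ℝ) * s) := by
  rw [brKernel_prod]
  have hi := prod_integrable m δ r hδ
  rw [Measure.volume_eq_prod] at hi ⊢
  rw [integral_prod _ hi]
  have hin : ∀ s : ℝ, ∫ v : Fin m → ℝ, (((max (1 - s ^ 2 - ∑ i, v i ^ 2) 0) ^ δ : ℝ) : ℂ) =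
      (((max (1 - s ^ 2) 0) ^ (δ + m / 2) * ∫ v : Fin m → ℝ, (max (1 - ∑ i, v i ^ 2) 0) ^ δ : ℝ) : ℂ) := by
    intro s
    rw [← inner_scaling m δ hδ s]
    exact integral_ofReal
  simp only [integral_mul_const, hin]
  rw [intervalIntegral.integral_of_le (by norm_num), ← integral_const_mul,
    ← integral_indicator measurableSet_Ioc]
  congr 1; ext s
  rw [indicator]
  split_ifs with h
  · rw [max_eq_left (by nlinarith [h.1, h.2])]
    push_cast
    rw [show -(2 * (π:ℂ)) * Complex.I * (r * s) = Complex.I * -(2 * π * r) * s by ring]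
    ring
  · rw [max_eq_right, Real.zero_rpow (by positivity)]
    · simp
    · by_contra hc
      push Not at hc
      apply h
      have : |s| < 1 := by
        rw [← sq_lt_one_iff_abs_lt_one]; linarith
      rw [abs_lt] at this
      exact ⟨this.1, this.2.le⟩

/-- Decay of the Bochner–Riesz kernel. -/
theorem kernel_decay (n : ℕ) (hn : 1 ≤ n) (δ : ℝ) (hδ : 0 < δ) :
    ∃ C : ℝ, 0 ≤ C ∧ ∀ x : En n, ‖brKernel n δ x‖ ≤ C * (1 + ‖x‖) ^ (-(((n:ℝ) + 1) / 2 + δ)) := by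
  obtain ⟨m, rfl⟩ : ∃ m, n = m + 1 := ⟨n - 1, by omega⟩
  set N : ℝ := (((m + 1 : ℕ):ℝ) + 1) / 2 + δ with hN
  have hN0 : 0 < N := by positivity
  obtain ⟨C1, hC1⟩ := osc_final (δ + m / 2) (by have : (0:ℝ) ≤ (m:ℝ)/2 := by positivity
                                                linarith)
  set c : ℝ := ‖((∫ v : Fin m → ℝ, (max (1 - ∑ i, v i ^ 2) 0) ^ δ : ℝ) : ℂ)‖
  have hc0 : 0 ≤ c := norm_nonneg _
  set C2 : ℝ := ∫ ξ : En (m+1), (max (1 - ‖ξ‖ ^ 2) 0) ^ δ with hC2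
  have hb : ∀ x : En (m+1), ‖brKernel (m+1) δ x‖ ≤ C2 := by
    intro x
    refine (norm_integral_le_integral_norm _).trans (le_of_eq ?_)
    congr 1; ext ξ
    rw [norm_mul, show -(2 * (π:ℂ)) * Complex.I * ((∑ i, x i * ξ i : ℝ) : ℂ) =
      ((-(2 * π) * ∑ i, x i * ξ i : ℝ) : ℂ) * Complex.I by push_cast; ring,
      Complex.norm_exp_ofReal_mul_I, mul_one, Complex.norm_real, Real.norm_eq_abs, abs_of_nonneg]
    exact Real.rpow_nonneg (le_max_right _ _) _
  have hC20 : 0 ≤ C2 := (norm_nonneg _).trans (hb 0)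
  refine ⟨C2 * 2 ^ N + c * |C1| * 2 ^ N, by positivity, fun x => ?_⟩
  have hx0 := norm_nonneg x
  rcases le_or_gt ‖x‖ 1 with hx | hx
  · have h1 : (1:ℝ) ≤ 2 ^ N * (1 + ‖x‖) ^ (-N) := by
      rw [Real.rpow_neg (by positivity), ← div_eq_mul_inv, le_div_iff₀ (by positivity), one_mul]
      exact Real.rpow_le_rpow (by positivity) (by linarith) hN0.le
    calc _ ≤ C2 * 1 := by simpa using hb x
      _ ≤ C2 * (2 ^ N * (1 + ‖x‖) ^ (-N)) := by gcongr
      _ ≤ _ := by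
        rw [add_mul, ← mul_assoc]
        have : 0 ≤ c * |C1| * 2 ^ N * (1 + ‖x‖) ^ (-N) := by positivity
        linarith
  · rw [brKernel_radial, brKernel_oneDim _ _ _ hδ, norm_mul]
    have habs : |-(2 * π * ‖x‖)| = 2 * π * ‖x‖ := by
      rw [abs_neg, abs_of_nonneg (by positivity)]
    have hpi := Real.pi_gt_three
    have h1 := hC1 (-(2 * π * ‖x‖)) (by rw [habs]; nlinarith)
    rw [habs] at h1
    have hNN : δ + m / 2 + 1 = N := by rw [hN]; push_cast; ring
    rw [hNN] at h1
    have h2 : (2 * π * ‖x‖) ^ (-N) ≤ 2 ^ N * (1 + ‖x‖) ^ (-N) := by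
      have e1 : (2 * π * ‖x‖) ^ (-N) ≤ ((1 + ‖x‖) / 2) ^ (-N) :=
        Real.rpow_le_rpow_of_nonpos (by positivity) (by nlinarith) (by linarith)
      refine e1.trans (le_of_eq ?_)
      rw [Real.div_rpow (by positivity) (by positivity), Real.rpow_neg (by norm_num : (0:ℝ) ≤ 2),
        div_inv_eq_mul, mul_comm]
    calc _ ≤ c * (C1 * (2 * π * ‖x‖) ^ (-N)) := by gcongr
      _ ≤ c * (|C1| * (2 * π * ‖x‖) ^ (-N)) := by gcongr; exact le_abs_self _
      _ ≤ c * (|C1| * (2 ^ N * (1 + ‖x‖) ^ (-N))) := by gcongr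
      _ ≤ _ := by
        rw [add_mul]
        have : 0 ≤ C2 * 2 ^ N * (1 + ‖x‖) ^ (-N) := by positivity
        linarith

end BR


namespace BR
open scoped FourierTransform SchwartzMap

/-- Convolution of Schwartz functions. -/
def cv {n : ℕ} (f g : 𝓢(En n, ℂ)) : 𝓢(En n, ℂ) :=
  SchwartzMap.convolution (ContinuousLinearMap.mul ℂ ℂ) f g

variable {n : ℕ}

lemma cv_apply (f g : 𝓢(En n, ℂ)) (x : En n) : cv f g x = ∫ t, f t * g (x - t) := by
  rw [cv, SchwartzMap.convolution_apply, convolution_def]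
  rfl

lemma fourier_cv (f g : 𝓢(En n, ℂ)) (ξ : En n) :
    (𝓕 (cv f g) : 𝓢(En n, ℂ)) ξ = (𝓕 f : 𝓢(En n, ℂ)) ξ * (𝓕 g : 𝓢(En n, ℂ)) ξ := by
  rw [cv, SchwartzMap.fourier_convolution]
  rfl

lemma ext_fourier {f g : 𝓢(En n, ℂ)} (h : ∀ ξ, (𝓕 f : 𝓢(En n, ℂ)) ξ = (𝓕 g : 𝓢(En n, ℂ)) ξ) : f = g := by
  have : (𝓕 f : 𝓢(En n, ℂ)) = 𝓕 g := SchwartzMap.ext h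
  have h2 := congrArg (fun u : 𝓢(En n, ℂ) => (𝓕⁻ u : 𝓢(En n, ℂ))) this
  simpa using h2

lemma cv_comm (f g : 𝓢(En n, ℂ)) : cv f g = cv g f :=
  ext_fourier fun ξ => by rw [fourier_cv, fourier_cv, mul_comm]

lemma cv_assoc (f g h : 𝓢(En n, ℂ)) : cv (cv f g) h = cv f (cv g h) :=
  ext_fourier fun ξ => by simp only [fourier_cv, mul_assoc]

lemma cv_apply' (f g : 𝓢(En n, ℂ)) (x : En n) : cv f g x = ∫ t, f (x - t) * g t := by
  rw [cv_comm, cv_apply]; simp only [mul_comm]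

/-- `L¹`-normalised dilation. -/
def dl (c : ℝ) (f : 𝓢(En n, ℂ)) : 𝓢(En n, ℂ) :=
  if hc : c = 0 then 0 else
    ((c ^ n : ℝ) : ℂ) • SchwartzMap.compCLMOfContinuousLinearEquiv ℂ
      (ContinuousLinearEquiv.smulLeft (Units.mk0 c hc) : En n ≃L[ℝ] En n) f

lemma dl_apply {c : ℝ} (hc : 0 < c) (f : 𝓢(En n, ℂ)) (x : En n) :
    dl c f x = ((c ^ n : ℝ) : ℂ) * f (c • x) := by
  rw [dl, dif_neg hc.ne']
  rfl

/-- dilation without normalisation -/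
def dl0 (c : ℝ) (f : 𝓢(En n, ℂ)) : 𝓢(En n, ℂ) :=
  if hc : c = 0 then 0 else
    SchwartzMap.compCLMOfContinuousLinearEquiv ℂ
      (ContinuousLinearEquiv.smulLeft (Units.mk0 c hc) : En n ≃L[ℝ] En n) f

lemma dl0_apply {c : ℝ} (hc : 0 < c) (f : 𝓢(En n, ℂ)) (x : En n) :
    dl0 c f x = f (c • x) := by
  rw [dl0, dif_neg hc.ne']
  rfl

lemma fourier_dl {c : ℝ} (hc : 0 < c) (f : 𝓢(En n, ℂ)) (ξ : En n) :
    (𝓕 (dl c f) : 𝓢(En n, ℂ)) ξ = (𝓕 f : 𝓢(En n, ℂ)) (c⁻¹ • ξ) := by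
  rw [SchwartzMap.fourier_coe, SchwartzMap.fourier_coe, Real.fourier_eq', Real.fourier_eq']
  have := Measure.integral_comp_smul_of_nonneg (volume : Measure (En n))
    (fun v => Complex.exp (((-2 * π * inner ℝ v (c⁻¹ • ξ) : ℝ) : ℂ) * Complex.I) • f v) c (hR := hc.le)
  rw [finrank_euclideanSpace_fin] at this
  have h2 : ∫ v, Complex.exp (((-2 * π * inner ℝ v (c⁻¹ • ξ) : ℝ) : ℂ) * Complex.I) • f v
     = (c ^ n) • ∫ x, (Complex.exp (((-2 * π * inner ℝ (c • x) (c⁻¹ • ξ) : ℝ) : ℂ) * Complex.I) • f (c • x)) := by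
    rw [this, smul_smul, mul_inv_cancel₀ (by positivity), one_smul]
  rw [h2, ← integral_smul]
  congr 1; ext v
  rw [dl_apply hc, inner_smul_left, inner_smul_right]
  simp only [smul_eq_mul, Complex.real_smul]
  have : c * (c⁻¹ * inner ℝ v ξ) = inner ℝ v ξ := by field_simp
  simp only [conj_trivial, this]
  ring

lemma exists_decay (f : 𝓢(En n, ℂ)) (A : ℕ) : ∃ C : ℝ, 0 ≤ C ∧ ∀ x, ‖f x‖ ≤ C * ((1 + ‖x‖) ^ A)⁻¹ := by
  obtain ⟨M, hM⟩ : ∃ M, ∀ x : En n, (1 + ‖x‖) ^ A * ‖f x‖ ≤ M := by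
    refine ⟨2 ^ A * ((Finset.Iic (A, 0)).sup fun m => SchwartzMap.seminorm ℝ m.1 m.2) f, fun x => ?_⟩
    have h := SchwartzMap.one_add_le_sup_seminorm_apply (𝕜 := ℝ) (m := (A, 0)) le_rfl le_rfl f x
    rw [norm_iteratedFDeriv_zero] at h
    exact h
  refine ⟨M, le_trans (by positivity) (hM 0), fun x => ?_⟩
  rw [← div_eq_mul_inv, le_div_iff₀ (by positivity), mul_comm]
  exact hM x

end BR


namespace BR
open scoped FourierTransform SchwartzMap Topology ContDiff
open Filter

variable {n : ℕ}

/-- Quotient of a compactly supported smooth function by a smooth function which does not vanish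
on the support. -/
lemma exists_quot (G h : En n → ℂ) (hG : ContDiff ℝ ∞ G) (hGc : HasCompactSupport G)
    (hh : ContDiff ℝ ∞ h) (hne : ∀ ξ ∈ tsupport G, h ξ ≠ 0) :
    ∃ Λ : 𝓢(En n, ℂ), ∀ ξ, (𝓕 Λ : 𝓢(En n, ℂ)) ξ = G ξ / h ξ := by
  have hsm : ContDiff ℝ ∞ (fun ξ => G ξ / h ξ) := by
    rw [contDiff_iff_contDiffAt]
    intro ξ
    by_cases hξ : ξ ∈ tsupport G
    · exact (hG.contDiffAt).mul ((hh.contDiffAt).inv (hne ξ hξ)) |>.congr_of_eventuallyEq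
        (Eventually.of_forall fun x => div_eq_mul_inv _ _)
    · have : (fun ξ => G ξ / h ξ) =ᶠ[𝓝 ξ] fun _ => 0 := by
        have := notMem_tsupport_iff_eventuallyEq.mp hξ
        filter_upwards [this] with x hx
        simp [hx]
      exact contDiffAt_const.congr_of_eventuallyEq this
  have hc : HasCompactSupport (fun ξ => G ξ / h ξ) := by
    refine hGc.mono' ?_
    refine (subset_closure.trans' ?_)
    intro x hx hx'
    apply hx
    simp [hx']
  refine ⟨𝓕⁻ (hc.toSchwartzMap hsm), fun ξ => ?_⟩
  simp

lemma peetre (z t : En n) {c : ℝ} (hc : 1 ≤ c) (A : ℕ) :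
    ((1 + ‖t‖) ^ A)⁻¹ ≤ ((1 + ‖z‖) ^ A)⁻¹ * (1 + ‖c • (z - t)‖) ^ A := by
  rw [inv_mul_eq_div, le_div_iff₀ (by positivity), inv_mul_le_iff₀ (by positivity), ← mul_pow]
  apply pow_le_pow_left₀ (by positivity)
  have h1 : ‖z‖ ≤ ‖t‖ + ‖z - t‖ := by
    have := norm_add_le t (z - t)
    simpa using this
  have h2 : ‖z - t‖ ≤ ‖c • (z - t)‖ := by
    rw [norm_smul, Real.norm_eq_abs, abs_of_nonneg (by linarith)]
    nlinarith [norm_nonneg (z - t)]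
  nlinarith [norm_nonneg t, norm_nonneg (c • (z-t))]

lemma integrable_weight (Λ : 𝓢(En n, ℂ)) (A : ℕ) :
    Integrable (fun u => (1 + ‖u‖) ^ A * ‖Λ u‖) := by
  have : ∀ u, (1 + ‖u‖) ^ A * ‖Λ u‖ = ∑ k ∈ Finset.range (A+1), (A.choose k : ℝ) * (‖u‖ ^ k * ‖Λ u‖) := by
    intro u
    rw [add_comm, add_pow, Finset.sum_mul]
    refine Finset.sum_congr rfl fun k _ => ?_
    ring
  simp only [this]
  exact integrable_finsetSum _ fun k _ => (SchwartzMap.integrable_pow_mul volume Λ k).const_mul _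

lemma conv_uniform (Ψ Λ : 𝓢(En n, ℂ)) (A : ℕ) :
    ∃ C : ℝ, 0 ≤ C ∧ ∀ c : ℝ, 1 ≤ c → ∀ z, ‖cv Ψ (dl c Λ) z‖ ≤ C * ((1 + ‖z‖) ^ A)⁻¹ := by
  obtain ⟨C1, hC1, h1⟩ := exists_decay Ψ A
  set I := ∫ u, (1 + ‖u‖) ^ A * ‖Λ u‖ with hI
  have hI0 : 0 ≤ I := integral_nonneg fun u => by positivity
  refine ⟨C1 * I, by positivity, fun c hc z => ?_⟩
  have hc0 : 0 < c := by linarith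
  have e1 : ∫ t, c ^ n * ((1 + ‖c • (z - t)‖) ^ A * ‖Λ (c • (z - t))‖) = I := by
    rw [integral_sub_left_eq_self (fun t => c ^ n * ((1 + ‖c • t‖) ^ A * ‖Λ (c • t)‖)) volume z,
      integral_const_mul]
    rw [Measure.integral_comp_smul_of_nonneg volume (fun t => (1 + ‖t‖) ^ A * ‖Λ t‖) c (hR := hc0.le)]
    rw [finrank_euclideanSpace_fin, smul_eq_mul, ← mul_assoc, mul_inv_cancel₀ (by positivity), one_mul]
  have hItg : Integrable (fun t => c ^ n * ((1 + ‖c • (z - t)‖) ^ A * ‖Λ (c • (z - t))‖)) := by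
    have h2 := (integrable_weight Λ A).comp_smul hc0.ne'
    exact (h2.comp_sub_left z).const_mul _
  rw [cv_apply]
  calc _ ≤ ∫ t, C1 * ((1 + ‖z‖) ^ A)⁻¹ * (c ^ n * ((1 + ‖c • (z - t)‖) ^ A * ‖Λ (c • (z - t))‖)) := by
        apply norm_integral_le_of_norm_le (hItg.const_mul _)
        refine Eventually.of_forall fun t => ?_
        rw [norm_mul, dl_apply hc0, norm_mul, Complex.norm_real, Real.norm_eq_abs,
          abs_of_nonneg (by positivity)]
        have := (h1 t).trans (mul_le_mul_of_nonneg_left (peetre z t hc A) hC1)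
        calc _ ≤ (C1 * (((1 + ‖z‖) ^ A)⁻¹ * (1 + ‖c • (z - t)‖) ^ A)) * (c ^ n * ‖Λ (c • (z - t))‖) := by
              gcongr
          _ = _ := by ring
    _ = C1 * ((1 + ‖z‖) ^ A)⁻¹ * I := by rw [integral_const_mul, e1]
    _ = _ := by ring

lemma tendsto_cutoff (g : 𝓢(En n, ℂ)) (G : ℕ → 𝓢(En n, ℂ)) (χ : ℕ → En n → ℝ)
    (h0 : ∀ m ξ, |χ m ξ| ≤ 1) (h1 : ∀ ξ, ∀ᶠ m in atTop, χ m ξ = 1)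
    (hG : ∀ m ξ, (𝓕 (G m) : 𝓢(En n, ℂ)) ξ = (χ m ξ : ℂ) * (𝓕 g : 𝓢(En n, ℂ)) ξ) (x : En n) :
    Tendsto (fun m => G m x) atTop (𝓝 (g x)) := by
  have key : ∀ u : 𝓢(En n, ℂ), u x = ∫ v, Complex.exp (((2 * π * inner ℝ v x : ℝ) : ℂ) * Complex.I) • (𝓕 u : 𝓢(En n, ℂ)) v := by
    intro u
    have : u = 𝓕⁻ (𝓕 u : 𝓢(En n, ℂ)) := by simp
    conv_lhs => rw [this]
    rw [SchwartzMap.fourierInv_coe, Real.fourierInv_eq']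
  simp only [key (G _)]
  rw [key g]
  refine tendsto_integral_of_dominated_convergence (fun v => ‖(𝓕 g : 𝓢(En n, ℂ)) v‖) ?_ ?_ ?_ ?_
  · intro m
    apply Continuous.aestronglyMeasurable
    refine Continuous.smul (f := fun v : En n => Complex.exp (((2 * π * inner ℝ v x : ℝ) : ℂ) * Complex.I)) (by fun_prop) (𝓕 (G m) : 𝓢(En n, ℂ)).continuous
  · exact (𝓕 g : 𝓢(En n, ℂ)).integrable.norm
  · intro m
    refine Eventually.of_forall fun v => ?_
    rw [norm_smul, Complex.norm_exp_ofReal_mul_I, one_mul, hG, norm_mul, Complex.norm_real]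
    exact mul_le_of_le_one_left (norm_nonneg _) (h0 _ _)
  · refine Eventually.of_forall fun v => ?_
    apply tendsto_const_nhds.congr'
    filter_upwards [h1 v] with m hm
    rw [hG, hm]; simp

end BR


namespace BR
open scoped FourierTransform SchwartzMap Topology ContDiff
open Filter

variable {n : ℕ}

lemma cv_smul_left (a : ℂ) (f g : 𝓢(En n, ℂ)) : cv (a • f) g = a • cv f g := by
  simp [cv]

theorem lemmaA_aux (Φ : 𝓢(En n, ℂ)) (hΦ : (∫ x, Φ x) ≠ 0) (ψ : 𝓢(En n, ℂ)) (A : ℕ) (hA : 1 ≤ A) :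
    ∃ C : ℝ, 0 ≤ C ∧ ∃ K : ℕ → 𝓢(En n, ℂ),
      (∀ k z, ‖K k z‖ ≤ C * ((1/2 : ℝ) ^ (k * A)) * ((1 + ‖z‖) ^ A)⁻¹) ∧
      ∀ (f : 𝓢(En n, ℂ)) (x : En n),
        Tendsto (fun m => ∑ k ∈ Finset.range m, cv (K k) (cv (dl (2 ^ k) Φ) f) x) atTop
          (𝓝 (cv ψ f x)) := by
  set F : 𝓢(En n, ℂ) := 𝓕 Φ with hF
  have hF0 : F 0 ≠ 0 := by
    rw [hF, SchwartzMap.fourier_coe, Real.fourier_eq']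
    simpa using hΦ
  obtain ⟨r, hr, hr2⟩ : ∃ r > 0, ∀ ξ : En n, ‖ξ‖ < r → F ξ ≠ 0 := by
    have := F.continuous.continuousAt.eventually_ne hF0
    rw [Metric.eventually_nhds_iff] at this
    obtain ⟨r, hr, h⟩ := this
    exact ⟨r, hr, fun ξ hξ => h (by simpa using hξ)⟩
  set ρ := r / 3 with hρ
  have hρ0 : 0 < ρ := by positivity
  let χ : ContDiffBump (0 : En n) := ⟨ρ, 2 * ρ, hρ0, by linarith⟩
  have hχ1 : ∀ ξ : En n, ‖ξ‖ ≤ ρ → χ ξ = 1 := fun ξ h => χ.one_of_mem_closedBall (by simpa using h)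
  have hχt : tsupport χ = Metric.closedBall 0 (2 * ρ) := χ.tsupport_eq
  have hχabs : ∀ ξ, |χ ξ| ≤ 1 := fun ξ => by
    rw [abs_of_nonneg χ.nonneg]; exact χ.le_one
  have hχz : ∀ ξ : En n, χ ξ ≠ 0 → ‖ξ‖ ≤ 2 * ρ := by
    intro ξ h
    have : ξ ∈ tsupport χ := subset_tsupport _ h
    rw [hχt] at this; simpa using this
  have hχs : ContDiff ℝ ∞ χ := χ.contDiff
  -- first multiplier
  let G0 : En n → ℂ := fun ξ => (χ ξ : ℂ)
  have hG0t : tsupport G0 ⊆ Metric.closedBall 0 (2 * ρ) := by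
    apply closure_minimal _ Metric.isClosed_closedBall
    intro ξ h
    simp only [G0, Function.mem_support, ne_eq, Complex.ofReal_eq_zero] at h
    simpa using hχz ξ h
  obtain ⟨Λ0, hΛ0⟩ := exists_quot G0 F (Complex.ofRealCLM.contDiff.comp hχs)
    ((isCompact_closedBall _ _).of_isClosed_subset (isClosed_tsupport _) hG0t) (F.smooth ⊤) (by
      intro ξ h
      apply hr2
      have := hG0t h
      rw [mem_closedBall_zero_iff] at this
      rw [hρ] at this; linarith)
  -- second
  let G1 : En n → ℂ := fun ξ => ((χ ξ - χ ((2:ℝ) • ξ) : ℝ) : ℂ)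
  have hG1t : tsupport G1 ⊆ Metric.closedBall 0 (2 * ρ) ∩ {ξ | ρ / 2 ≤ ‖ξ‖} := by
    apply closure_minimal _ (Metric.isClosed_closedBall.inter (isClosed_le continuous_const continuous_norm))
    intro ξ h
    simp only [G1, Function.mem_support, ne_eq, Complex.ofReal_eq_zero] at h
    have n2 : ‖(2:ℝ) • ξ‖ = 2 * ‖ξ‖ := by simp [norm_smul]
    constructor
    · rw [mem_closedBall_zero_iff]
      by_contra hc
      push Not at hc
      apply h
      have a1 : χ ξ = 0 := by
        by_contra h'; exact absurd (hχz ξ h') (by linarith)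
      have a2 : χ ((2:ℝ) • ξ) = 0 := by
        by_contra h'; exact absurd (hχz _ h') (by rw [n2]; linarith)
      rw [a1, a2, sub_zero]
    · by_contra hc
      simp only [mem_ofPred_eq, not_le] at hc
      apply h
      rw [hχ1 ξ (by linarith), hχ1 _ (by rw [n2]; linarith), sub_self]
  have hnsq : ContDiff ℝ ∞ (fun ξ : En n => ((‖ξ‖ ^ 2 : ℝ) : ℂ) ^ A) :=
    (Complex.ofRealCLM.contDiff.comp (contDiff_norm_sq ℝ)).pow A
  obtain ⟨Λ, hΛ⟩ := exists_quot G1 (fun ξ => F ξ * ((‖ξ‖ ^ 2 : ℝ) : ℂ) ^ A)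
    (Complex.ofRealCLM.contDiff.comp (hχs.sub (hχs.comp (contDiff_const_smul 2))))
    ((isCompact_closedBall _ _).of_isClosed_subset (isClosed_tsupport _) (hG1t.trans inter_subset_left))
    ((F.smooth ⊤).mul hnsq) (by
      intro ξ h
      obtain ⟨h1, h2⟩ := hG1t h
      rw [mem_closedBall_zero_iff] at h1
      simp only [mem_ofPred_eq] at h2
      refine mul_ne_zero (hr2 _ (by rw [hρ] at h1; linarith)) (pow_ne_zero _ ?_)
      have : ‖ξ‖ ≠ 0 := by linarith
      exact_mod_cast pow_ne_zero 2 this)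
  have htg : Function.HasTemperateGrowth (fun ξ : En n => ((‖ξ‖ ^ 2 : ℝ) : ℂ) ^ A) :=
    (Function.Complex.hasTemperateGrowth_ofReal.comp (Function.hasTemperateGrowth_norm_sq (En n))).pow A
  let Ψ : 𝓢(En n, ℂ) := 𝓕⁻ (SchwartzMap.smulLeftCLM ℂ (fun ξ : En n => ((‖ξ‖ ^ 2 : ℝ) : ℂ) ^ A) (𝓕 ψ : 𝓢(En n, ℂ)))
  have hΨ : ∀ ξ, (𝓕 Ψ : 𝓢(En n, ℂ)) ξ = ((‖ξ‖ ^ 2 : ℝ) : ℂ) ^ A * (𝓕 ψ : 𝓢(En n, ℂ)) ξ := by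
    intro ξ
    simp only [Ψ, FourierTransform.fourier_fourierInv_eq]
    rw [SchwartzMap.smulLeftCLM_apply_apply htg]
    rfl
  obtain ⟨C0, hC0, hb0⟩ := exists_decay (cv ψ Λ0) A
  obtain ⟨C1, hC1, hb1⟩ := conv_uniform Ψ Λ A
  let K : ℕ → 𝓢(En n, ℂ) := fun k => if k = 0 then cv ψ Λ0 else
    ((((1/2:ℝ) ^ k) ^ 2) ^ A : ℂ) • cv Ψ (dl (2 ^ k) Λ)
  refine ⟨C0 + C1, by positivity, K, ?_, ?_⟩
  · intro k z
    rcases Nat.eq_zero_or_pos k with rfl | hk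
    · simp only [K, if_true, zero_mul, pow_zero, mul_one]
      refine (hb0 z).trans ?_
      gcongr; linarith
    · simp only [K, hk.ne', if_false]
      rw [_root_.smul_apply, norm_smul]
      have e1 : ‖((((1/2:ℝ) ^ k) ^ 2) ^ A : ℂ)‖ ≤ (1/2) ^ (k * A) := by
        rw [norm_pow, norm_pow, norm_pow, Complex.norm_real, ← pow_mul, ← pow_mul]
        rw [Real.norm_eq_abs, abs_of_nonneg (by norm_num)]
        apply pow_le_pow_of_le_one (by norm_num) (by norm_num)
        nlinarith [Nat.zero_le (k * A)]
      calc _ ≤ (1/2) ^ (k * A) * (C1 * ((1 + ‖z‖) ^ A)⁻¹) :=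
            mul_le_mul e1 (hb1 _ (one_le_pow₀ (by norm_num)) z) (norm_nonneg _) (by positivity)
        _ ≤ (1/2) ^ (k * A) * ((C0 + C1) * ((1 + ‖z‖) ^ A)⁻¹) := by gcongr; linarith
        _ = _ := by ring
  · intro f x
    have hterm : ∀ k ξ, (𝓕 (cv (K k) (cv (dl (2 ^ k) Φ) f)) : 𝓢(En n, ℂ)) ξ =
        ((if k = 0 then χ ξ else χ (((2:ℝ) ^ k)⁻¹ • ξ) - χ ((2:ℝ) • ((2:ℝ) ^ k)⁻¹ • ξ) : ℝ) : ℂ) *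
          (𝓕 (cv ψ f) : 𝓢(En n, ℂ)) ξ := by
      intro k ξ
      rcases Nat.eq_zero_or_pos k with rfl | hk
      · simp only [K, if_true, fourier_cv, fourier_dl (show (0:ℝ) < 2 ^ 0 by norm_num), hΛ0]
        simp only [pow_zero, inv_one, one_smul, ← hF]
        by_cases h : F ξ = 0
        · have : χ ξ = 0 := by
            by_contra h'
            exact hr2 ξ (by have := hχz ξ h'; rw [hρ] at this; linarith) h
          simp [G0, this]
        · simp only [G0]
          field_simp
      · simp only [K, hk.ne', if_false, fourier_cv, cv_smul_left, FourierTransform.fourier_smul,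
          _root_.smul_apply, smul_eq_mul]
        have h2k : (0:ℝ) < 2 ^ k := by positivity
        simp only [fourier_cv, fourier_dl h2k, hΛ, hΨ, ← hF]
        set η := ((2:ℝ) ^ k)⁻¹ • ξ with hη
        have hξ : ‖ξ‖ = 2 ^ k * ‖η‖ := by
          rw [hη, norm_smul, norm_inv, Real.norm_eq_abs, abs_of_pos h2k]; field_simp
        by_cases h : F η * ((‖η‖ ^ 2 : ℝ) : ℂ) ^ A = 0
        · have : G1 η = 0 := by
            by_contra h'
            obtain ⟨h1, h2⟩ := hG1t (subset_tsupport _ h')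
            rw [mem_closedBall_zero_iff] at h1
            simp only [mem_ofPred_eq] at h2
            refine mul_ne_zero (hr2 _ (by rw [hρ] at h1; linarith)) (pow_ne_zero _ ?_) h
            have : ‖η‖ ≠ 0 := by linarith
            exact_mod_cast pow_ne_zero 2 this
          rw [this]
          simp only [G1] at this
          rw [this]; simp
        · simp only [G1] at *
          have h1 := left_ne_zero_of_mul h
          have h3 := right_ne_zero_of_mul h
          have e2 : ((‖ξ‖ ^ 2 : ℝ) : ℂ) ^ A = ((2:ℂ) ^ k) ^ (2 * A) * ((‖η‖ ^ 2 : ℝ) : ℂ) ^ A := by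
            rw [hξ]; push_cast; ring
          have e3 : ((((1/2:ℝ) ^ k : ℝ):ℂ) ^ 2) ^ A * ((2:ℂ) ^ k) ^ (2 * A) = 1 := by
            push_cast
            rw [← pow_mul, ← mul_pow, ← mul_pow]; norm_num
          rw [e2]
          push_cast at e3 h3 ⊢
          field_simp
          linear_combination (((χ η:ℂ) - χ ((2:ℝ) • η)) * (𝓕 ψ : 𝓢(En n, ℂ)) ξ * (𝓕 f : 𝓢(En n, ℂ)) ξ) * e3
    have htel : ∀ m ξ, ∑ k ∈ Finset.range (m+1),
        (if k = 0 then χ ξ else χ (((2:ℝ) ^ k)⁻¹ • ξ) - χ ((2:ℝ) • ((2:ℝ) ^ k)⁻¹ • ξ)) =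
          χ (((2:ℝ) ^ m)⁻¹ • ξ) := by
      intro m ξ
      induction m with
      | zero => simp
      | succ m ih =>
        rw [Finset.sum_range_succ, ih]
        simp only [Nat.succ_ne_zero, if_false, smul_smul]
        have : (2:ℝ) * (2 ^ (m+1))⁻¹ = (2 ^ m)⁻¹ := by
          rw [pow_succ]; field_simp
        rw [this]; ring
    rw [← tendsto_add_atTop_iff_nat 1]
    have := tendsto_cutoff (cv ψ f) (fun m => ∑ k ∈ Finset.range (m+1), cv (K k) (cv (dl (2 ^ k) Φ) f))
      (fun m ξ => χ (((2:ℝ) ^ m)⁻¹ • ξ)) (fun m ξ => hχabs _) ?_ ?_ x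
    · refine this.congr fun m => ?_
      rw [_root_.sum_apply]
    · intro ξ
      have ht : Tendsto (fun m : ℕ => ‖((2:ℝ) ^ m)⁻¹ • ξ‖) atTop (𝓝 0) := by
        have h := (tendsto_pow_atTop_nhds_zero_of_lt_one (r := (1/2:ℝ)) (by norm_num) (by norm_num)).mul_const ‖ξ‖
        rw [zero_mul] at h
        refine h.congr fun m => ?_
        rw [norm_smul, norm_inv, norm_pow]; simp
      filter_upwards [ht.eventually_le_const hρ0] with m hm
      exact hχ1 _ hm
    · intro m ξ
      rw [← htel m ξ, FourierTransform.fourier_sum, _root_.sum_apply, Complex.ofReal_sum, Finset.sum_mul]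
      exact Finset.sum_congr rfl fun k _ => hterm k ξ

end BR


namespace BR
open scoped FourierTransform SchwartzMap Topology ContDiff
open Filter

variable {n : ℕ}

/-- `1 + |z|` as an extended nonnegative real. -/
def J (z : En n) : ℝ≥0∞ := ENNReal.ofReal (1 + ‖z‖)

lemma one_le_J (z : En n) : 1 ≤ J z := by
  rw [J, ENNReal.one_le_ofReal]; linarith [norm_nonneg z]

lemma J_ne_zero (z : En n) : J z ≠ 0 := (zero_lt_one.trans_le (one_le_J z)).ne'
lemma J_ne_top (z : En n) : J z ≠ ⊤ := ENNReal.ofReal_ne_top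

lemma J_continuous : Continuous (J : En n → ℝ≥0∞) :=
  ENNReal.continuous_ofReal.comp (by fun_prop)

@[fun_prop]
lemma J_measurable : Measurable (J : En n → ℝ≥0∞) := J_continuous.measurable

lemma J_neg (z : En n) : J (-z) = J z := by simp [J]

lemma J_sub_comm (x y : En n) : J (x - y) = J (y - x) := by rw [← J_neg]; simp

lemma J_add_le (x y : En n) : J (x + y) ≤ J x * J y := by
  rw [J, J, J, ← ENNReal.ofReal_mul (by positivity)]
  apply ENNReal.ofReal_le_ofReal
  nlinarith [norm_add_le x y, norm_nonneg x, norm_nonneg y]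

lemma J_tri (x y z : En n) : J (x - z) ≤ J (x - y) * J (y - z) := by
  have := J_add_le (x - y) (y - z)
  simpa using this

lemma Jpow_ne_top (z : En n) (s : ℝ) : J z ^ s ≠ ⊤ :=
  ENNReal.rpow_ne_top_of_ne_zero (J_ne_zero z) (J_ne_top z)

lemma Jpow_ne_zero (z : En n) (s : ℝ) : J z ^ s ≠ 0 := by
  intro h
  rw [ENNReal.rpow_eq_zero_iff] at h
  rcases h with h | h
  · exact J_ne_zero z h.1
  · exact J_ne_top z h.1

lemma Jpow_continuous (s : ℝ) : Continuous (fun z : En n => J z ^ s) := by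
  have : (fun z : En n => J z ^ s) = fun z => ENNReal.ofReal ((1 + ‖z‖) ^ s) := by
    ext z; rw [J, ENNReal.ofReal_rpow_of_pos (by positivity)]
  rw [this]
  refine ENNReal.continuous_ofReal.comp (Continuous.rpow_const (by fun_prop) fun z => Or.inl ?_)
  positivity

lemma ofReal_Jpow (z : En n) (s : ℝ) : ENNReal.ofReal ((1 + ‖z‖) ^ s) = J z ^ s := by
  rw [J, ENNReal.ofReal_rpow_of_pos (by positivity)]

lemma Jneg_le_one (z : En n) {s : ℝ} (hs : 0 ≤ s) : J z ^ (-s) ≤ 1 := by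
  rw [ENNReal.rpow_neg, ENNReal.inv_le_one]
  simpa using ENNReal.rpow_le_rpow (one_le_J z) hs

/-- Peetre-type inequality for negative powers. -/
lemma Jneg_tri (x y z : En n) {s : ℝ} (hs : 0 ≤ s) :
    J (x - y) ^ (-s) * J (y - z) ^ (-s) ≤ J (x - z) ^ (-s) := by
  rw [← ENNReal.mul_rpow_of_ne_top (J_ne_top _) (J_ne_top _), ENNReal.rpow_neg, ENNReal.rpow_neg]
  exact ENNReal.inv_le_inv.mpr (ENNReal.rpow_le_rpow (J_tri x y z) hs)

lemma Jneg_shift (x y z : En n) {s : ℝ} (hs : 0 ≤ s) :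
    J (x - z) ^ (-s) ≤ J (x - y) ^ s * J (y - z) ^ (-s) := by
  have h := Jneg_tri y x z hs
  rw [J_sub_comm y x] at h
  calc J (x - z) ^ (-s) = J (x - y) ^ s * (J (x - y) ^ (-s) * J (x - z) ^ (-s)) := by
        rw [← mul_assoc, ← ENNReal.rpow_add _ _ (J_ne_zero _) (J_ne_top _)]; simp
    _ ≤ _ := by gcongr

theorem lemmaA (Φ : 𝓢(En n, ℂ)) (hΦ : (∫ x, Φ x) ≠ 0) (ψ : 𝓢(En n, ℂ)) (A : ℕ) (hA : 1 ≤ A) :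
    ∃ C : ℝ≥0∞, C ≠ ⊤ ∧ ∀ (f : 𝓢(En n, ℂ)) (x : En n),
      ‖cv ψ f x‖ₑ ≤ C * ∑' k : ℕ, (2⁻¹ : ℝ≥0∞) ^ (k * A) *
        ∫⁻ z, ‖cv (dl (2 ^ k) Φ) f z‖ₑ * J (x - z) ^ (-(A:ℝ)) := by
  obtain ⟨C, hC, K, hK, hlim⟩ := lemmaA_aux Φ hΦ ψ A hA
  refine ⟨ENNReal.ofReal C, ENNReal.ofReal_ne_top, fun f x => ?_⟩
  have hKe : ∀ k z, ‖K k z‖ₑ ≤ ENNReal.ofReal C * (2⁻¹ : ℝ≥0∞) ^ (k * A) * J z ^ (-(A:ℝ)) := by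
    intro k z
    rw [← ofReal_norm]
    refine (ENNReal.ofReal_le_ofReal (hK k z)).trans (le_of_eq ?_)
    rw [ENNReal.ofReal_mul (by positivity), ENNReal.ofReal_mul hC, ENNReal.ofReal_pow (by norm_num),
      ← ofReal_Jpow, Real.rpow_neg (by positivity), Real.rpow_natCast]
    congr 3
    rw [one_div, ENNReal.ofReal_inv_of_pos (by norm_num)]; simp
  refine le_of_tendsto' (hlim f x).enorm fun m => ?_
  calc _ ≤ ∑ k ∈ Finset.range m, ‖cv (K k) (cv (dl (2 ^ k) Φ) f) x‖ₑ := enorm_sum_le _ _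
    _ ≤ ∑ k ∈ Finset.range m, ENNReal.ofReal C * ((2⁻¹ : ℝ≥0∞) ^ (k * A) *
        ∫⁻ z, ‖cv (dl (2 ^ k) Φ) f z‖ₑ * J (x - z) ^ (-(A:ℝ))) := by
        refine Finset.sum_le_sum fun k _ => ?_
        rw [cv_apply']
        refine (enorm_integral_le_lintegral_enorm _).trans ?_
        rw [← mul_assoc, ← lintegral_const_mul' _ _ (by finiteness)]
        refine lintegral_mono fun z => ?_
        rw [enorm_mul]
        calc _ ≤ (ENNReal.ofReal C * (2⁻¹ : ℝ≥0∞) ^ (k * A) * J (x - z) ^ (-(A:ℝ))) * _ := by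
              gcongr; exact hKe k _
          _ = _ := by ring
    _ ≤ ∑' k : ℕ, ENNReal.ofReal C * ((2⁻¹ : ℝ≥0∞) ^ (k * A) *
        ∫⁻ z, ‖cv (dl (2 ^ k) Φ) f z‖ₑ * J (x - z) ^ (-(A:ℝ))) := ENNReal.sum_le_tsum _
    _ = _ := ENNReal.tsum_mul_left

lemma brMeans_one (δ : ℝ) (f : En n → ℂ) (x : En n) :
    brMeans n δ 1 f x = ∫ y, f (x - y) * brKernel n δ y := by
  unfold brMeans brKernelDil
  rw [← integral_sub_left_eq_self (fun y => f (x - y) * brKernel n δ y) volume x]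
  simp

lemma br_mult_integrable (δ : ℝ) (hδ : 0 < δ) :
    Integrable (fun ξ : En n => (((max (1 - ‖ξ‖ ^ 2) 0) ^ δ : ℝ) : ℂ)) := by
  apply Continuous.integrable_of_hasCompactSupport
  · exact Complex.continuous_ofReal.comp
      (Continuous.rpow_const (by fun_prop) (fun s => Or.inr hδ.le))
  · refine HasCompactSupport.intro (isCompact_closedBall (0 : En n) 1) ?_
    intro z hz
    rw [max_eq_right, Real.zero_rpow hδ.ne']
    · simp
    · rw [mem_closedBall_zero_iff] at hz
      push Not at hz
      nlinarith

lemma brMeans_fourier (δ : ℝ) (hδ : 0 < δ) (f : 𝓢(En n, ℂ)) (x : En n) :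
    brMeans n δ 1 f x = ∫ ξ, (Complex.exp (((-2 * π * inner ℝ x ξ : ℝ) : ℂ) * Complex.I) *
      (𝓕 f : 𝓢(En n, ℂ)) (-ξ)) * (((max (1 - ‖ξ‖ ^ 2) 0) ^ δ : ℝ) : ℂ) := by
  have hk : ∀ y, brKernel n δ y = 𝓕 (fun ξ : En n => (((max (1 - ‖ξ‖ ^ 2) 0) ^ δ : ℝ) : ℂ)) y := by
    intro y
    rw [brKernel_inner, Real.fourier_eq']
    congr 1; ext ξ
    rw [smul_eq_mul, mul_comm, real_inner_comm]
    congr 2; push_cast; ring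
  have hf : ∀ ξ, 𝓕 (fun y => f (x - y)) ξ = Complex.exp (((-2 * π * inner ℝ x ξ : ℝ) : ℂ) * Complex.I) *
      (𝓕 f : 𝓢(En n, ℂ)) (-ξ) := by
    intro ξ
    rw [SchwartzMap.fourier_coe, Real.fourier_eq', Real.fourier_eq',
      ← integral_sub_left_eq_self _ volume x, ← integral_const_mul]
    congr 1; ext u
    rw [smul_eq_mul, smul_eq_mul, ← mul_assoc, ← Complex.exp_add]
    simp only [sub_sub_cancel, inner_sub_left, inner_neg_right]
    congr 2; push_cast; ring
  rw [brMeans_one]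
  simp only [hk, ← hf]
  have := VectorFourier.integral_fourierIntegral_smul_eq_flip (L := innerₗ (En n)) (μ := volume) (ν := volume)
    (f := fun y => f (x - y)) (g := (fun ξ : En n => (((max (1 - ‖ξ‖ ^ 2) 0) ^ δ : ℝ) : ℂ)))
    continuous_fourierChar continuous_inner (f.integrable.comp_sub_left x) (br_mult_integrable δ hδ)
  rw [flip_innerₗ] at this
  exact this.symm

theorem lemmaC (hn : 1 ≤ n) (δ : ℝ) (hδ : 0 < δ) :
    ∃ ψ : 𝓢(En n, ℂ), ∃ C : ℝ≥0∞, C ≠ ⊤ ∧ ∀ (f : 𝓢(En n, ℂ)) (x : En n),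
      ‖brMeans n δ 1 f x‖ₑ ≤ C * ∫⁻ y, J (x - y) ^ (-(((n:ℝ) + 1) / 2 + δ)) * ‖cv ψ f y‖ₑ := by
  let χ : ContDiffBump (0 : En n) := ⟨1, 2, one_pos, by norm_num⟩
  have hχ1 : ∀ ξ : En n, ‖ξ‖ ≤ 1 → χ ξ = 1 := fun ξ h => χ.one_of_mem_closedBall (by simpa using h)
  have hχs : ContDiff ℝ ∞ χ := χ.contDiff
  obtain ⟨ψ, hψ⟩ := exists_quot (fun ξ : En n => ((χ ξ : ℝ) : ℂ)) (fun _ => 1)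
    (Complex.ofRealCLM.contDiff.comp hχs) (χ.hasCompactSupport.comp_left (g := fun r : ℝ => (r:ℂ)) (by simp)) contDiff_const
    (fun _ _ => one_ne_zero)
  obtain ⟨C, hC, hdec⟩ := kernel_decay n hn δ hδ
  refine ⟨ψ, ENNReal.ofReal C, ENNReal.ofReal_ne_top, fun f x => ?_⟩
  have e : brMeans n δ 1 f x = brMeans n δ 1 (cv ψ f) x := by
    rw [brMeans_fourier δ hδ, brMeans_fourier δ hδ]
    congr 1; ext ξ
    rw [fourier_cv, hψ]
    rcases le_or_gt ‖ξ‖ 1 with h | h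
    · rw [hχ1 _ (by rwa [norm_neg])]; simp
    · rw [max_eq_right (by nlinarith), Real.zero_rpow hδ.ne']; simp
  rw [e, brMeans]
  refine (enorm_integral_le_lintegral_enorm _).trans ?_
  rw [← lintegral_const_mul' _ _ (by finiteness)]
  refine lintegral_mono fun y => ?_
  have h1 : ‖brKernelDil n δ 1 (x - y)‖ₑ ≤ ENNReal.ofReal C * J (x - y) ^ (-(((n:ℝ) + 1) / 2 + δ)) := by
    unfold brKernelDil
    rw [← ofReal_norm, ← ofReal_Jpow, ← ENNReal.ofReal_mul hC]
    apply ENNReal.ofReal_le_ofReal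
    simpa using hdec (x - y)
  rw [enorm_mul]
  calc _ ≤ ‖cv ψ f y‖ₑ * (ENNReal.ofReal C * J (x - y) ^ (-(((n:ℝ) + 1) / 2 + δ))) := by gcongr
    _ = _ := by ring

end BR


namespace BR
open scoped FourierTransform SchwartzMap Topology ContDiff
open Filter

variable {n : ℕ}

lemma cv_dl {c d : ℝ} (hc : 0 < c) (hd : 0 < d) (Φ f : 𝓢(En n, ℂ)) (y : En n) :
    cv (dl (c * d) Φ) f y = cv (dl d Φ) (dl0 c⁻¹ f) (c • y) := by
  rw [cv_apply', cv_apply']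
  have h := Measure.integral_comp_smul_of_nonneg (volume : Measure (En n))
    (fun t => dl d Φ (c • y - t) * dl0 c⁻¹ f t) c (hR := hc.le)
  rw [finrank_euclideanSpace_fin] at h
  have h2 : ∫ t, dl d Φ (c • y - t) * dl0 c⁻¹ f t = (c ^ n) • ∫ t, dl d Φ (c • y - c • t) * dl0 c⁻¹ f (c • t) := by
    rw [h, smul_smul, mul_inv_cancel₀ (by positivity), one_smul]
  rw [h2, ← integral_smul]
  congr 1; ext t
  rw [dl_apply (by positivity), dl_apply hd, dl0_apply (by positivity), smul_smul, inv_mul_cancel₀ hc.ne', one_smul,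
    ← smul_sub, smul_smul, Complex.real_smul, mul_comm c d]
  push_cast; ring

lemma lintegral_smul_sub (c : ℝ) (hc : 0 < c) (g : En n → ℝ≥0∞) :
    ∫⁻ z, g z = ENNReal.ofReal (c ^ n) * ∫⁻ w, g (c • w) := by
  have h := Measure.map_addHaar_smul (volume : Measure (En n)) hc.ne'
  have h2 : ∫⁻ w, g (c • w) = ∫⁻ z, g z ∂(Measure.map (c • ·) (volume : Measure (En n))) := by
    exact ((Homeomorph.smulOfNeZero c hc.ne').measurableEmbedding.lintegral_map g).symm
  rw [h2, h, lintegral_smul_measure, finrank_euclideanSpace_fin, smul_eq_mul, ← mul_assoc,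
    ← ENNReal.ofReal_mul (by positivity), abs_of_nonneg (by positivity), mul_inv_cancel₀ (by positivity)]
  simp

lemma u_le_radMax {c : ℝ} (hc : 0 < c) (Φ f : 𝓢(En n, ℂ)) (y : En n) :
    ‖cv (dl c Φ) f y‖ₑ ≤ radMax n Φ f y := by
  unfold radMax
  refine le_iSup₂_of_le (c⁻¹) (by positivity) (le_of_eq ?_)
  rw [cv_apply']
  simp only [dl_apply hc, inv_inv, inv_pow, Complex.real_smul, smul_mul_assoc]
  rw [← enorm_eq_nnnorm]

lemma J_smul_le {c : ℝ} (hc : 1 ≤ c) (z : En n) : J z ≤ J (c • z) := by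
  apply ENNReal.ofReal_le_ofReal
  rw [norm_smul, Real.norm_eq_abs, abs_of_nonneg (by linarith)]
  nlinarith [norm_nonneg z]

theorem lemmaB (Φ : 𝓢(En n, ℂ)) (hΦ : (∫ x, Φ x) ≠ 0) (ψ : 𝓢(En n, ℂ)) (θ : ℝ) (hθ : 0 < θ)
    (hθ1 : θ ≤ 1) (A : ℕ) (hA : (n:ℝ) + 1 ≤ A * θ) :
    ∃ C : ℝ≥0∞, C ≠ ⊤ ∧ ∀ (f : 𝓢(En n, ℂ)) (x : En n),
      ‖cv ψ f x‖ₑ ≤ C * (∫⁻ z, radMax n Φ f z ^ θ * J (x - z) ^ (-(A * θ))) ^ (1/θ) := by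
  have hA1 : 1 ≤ A := by
    by_contra h
    have : A = 0 := by omega
    subst this
    simp at hA; linarith [(Nat.cast_nonneg n : (0:ℝ) ≤ n)]
  obtain ⟨C1, hC1, hψ⟩ := lemmaA Φ hΦ ψ A hA1
  obtain ⟨C2, hC2, hΦΦ⟩ := lemmaA Φ hΦ Φ A hA1
  refine ⟨C1 * (2 * (2 * C2) ^ ((1 - θ)/θ)), ?_, fun f x => ?_⟩
  · have : 0 ≤ (1 - θ)/θ := div_nonneg (by linarith) hθ.le
    finiteness
  set u : ℕ → En n → ℝ≥0∞ := fun k y => ‖cv (dl (2 ^ k) Φ) f y‖ₑ with hu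
  set m := radMax n Φ f with hm
  have hum : ∀ k y, u k y ≤ m y := fun k y => u_le_radMax (by positivity) Φ f y
  set a : ℕ → ℝ≥0∞ := fun k => (2⁻¹ : ℝ≥0∞) ^ (k * A) with ha
  have h2top : (2⁻¹ : ℝ≥0∞) ≠ ⊤ := by simp
  have hatop : ∀ k, a k ≠ ⊤ := fun k => ENNReal.pow_ne_top h2top
  have hale : ∀ k, a k ≤ 1 := fun k => pow_le_one' (by simp) _
  set S := ∑' k, (a k * 2 ^ (k * n)) * ∫⁻ z, u k z * J (x - z) ^ (-(A:ℝ)) with hS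
  set M := ⨆ (j : ℕ) (y : En n), a j * u j y * J (x - y) ^ (-(A:ℝ)) with hM
  set H := ∫⁻ z, m z ^ θ * J (x - z) ^ (-(A * θ)) with hH
  -- step 1
  have s1 : ‖cv ψ f x‖ₑ ≤ C1 * S := by
    refine (hψ f x).trans ?_
    refine mul_le_mul_right (ENNReal.tsum_le_tsum fun k => mul_le_mul_left ?_ _) _
    exact le_mul_of_one_le_right' (one_le_pow₀ (by norm_num : (1:ℝ≥0∞) ≤ 2))
  -- step 2
  have hrec : ∀ j y, u j y ≤ C2 * ∑' k, a k * (2 ^ (j * n) * ∫⁻ w, u (j + k) w * J (y - w) ^ (-(A:ℝ))) := by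
    intro j y
    have hc : (0:ℝ) < 2 ^ j := by positivity
    have e1 : ∀ k w, u (j + k) w = ‖cv (dl (2 ^ k) Φ) (dl0 (2 ^ j)⁻¹ f) ((2:ℝ) ^ j • w)‖ₑ := by
      intro k w
      simp only [hu]
      rw [pow_add, cv_dl hc (by positivity)]
    have e0 := e1 0 y
    rw [add_zero, pow_zero] at e0
    have hd1 : dl 1 Φ = Φ := by ext z; rw [dl_apply one_pos]; simp
    rw [hd1] at e0
    rw [e0]
    refine (hΦΦ _ _).trans ?_
    gcongr with k
    rw [lintegral_smul_sub (2 ^ j) hc]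
    have : ENNReal.ofReal ((2 ^ j) ^ n) = 2 ^ (j * n) := by
      rw [← pow_mul, ENNReal.ofReal_pow (by norm_num)]; simp
    rw [this]
    refine mul_le_mul_right (lintegral_mono fun w => ?_) _
    rw [e1]
    refine mul_le_mul_right ?_ _
    · rw [← smul_sub, ENNReal.rpow_neg, ENNReal.rpow_neg, ENNReal.inv_le_inv]
      exact ENNReal.rpow_le_rpow (J_smul_le (one_le_pow₀ (by norm_num)) _) (by positivity)
  have s2 : M ≤ C2 * S := by
    refine iSup₂_le fun j y => ?_
    calc a j * u j y * J (x - y) ^ (-(A:ℝ)) ≤ a j * (C2 * ∑' k, a k * (2 ^ (j * n) * ∫⁻ w, u (j + k) w * J (y - w) ^ (-(A:ℝ)))) * J (x - y) ^ (-(A:ℝ)) := by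
          gcongr; exact hrec j y
      _ = C2 * ∑' k, a j * a k * 2 ^ (j * n) * ∫⁻ w, J (x - y) ^ (-(A:ℝ)) * (u (j + k) w * J (y - w) ^ (-(A:ℝ))) := by
          rw [mul_left_comm, mul_assoc C2, ← ENNReal.tsum_mul_left, ← ENNReal.tsum_mul_right]
          congr 2; ext k
          rw [lintegral_const_mul' _ _ (Jpow_ne_top _ _)]
          ring
      _ ≤ C2 * ∑' k, (a (j + k) * 2 ^ ((j + k) * n)) * ∫⁻ w, u (j + k) w * J (x - w) ^ (-(A:ℝ)) := by
          refine mul_le_mul_right (ENNReal.tsum_le_tsum fun k => mul_le_mul' (mul_le_mul' ?_ ?_)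
            (lintegral_mono fun w => ?_)) _
          · simp only [ha]; rw [← pow_add, add_mul]
          · exact pow_le_pow_right₀ (by norm_num) (by gcongr; omega)
          · calc _ = u (j + k) w * (J (x - y) ^ (-(A:ℝ)) * J (y - w) ^ (-(A:ℝ))) := by ring
              _ ≤ _ := by gcongr; exact Jneg_tri x y w (by positivity)
      _ ≤ C2 * S := by
          gcongr
          exact ENNReal.tsum_comp_le_tsum_of_injective (f := fun k => j + k) (add_right_injective j)
            (fun k => (a k * 2 ^ (k * n)) * ∫⁻ z, u k z * J (x - z) ^ (-(A:ℝ)))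
  -- step 3
  have s3 : S ≤ M ^ (1 - θ) * (2 * H) := by
    by_cases hMtop : M ^ (1 - θ) = ⊤
    · rcases eq_or_ne H 0 with h0 | h0
      · exfalso
        have hMfin : M ≠ ⊤ := by
          obtain ⟨B, hB, hb⟩ := conv_uniform f Φ 0
          have : M ≤ ENNReal.ofReal B := by
            refine iSup₂_le fun j y => ?_
            calc _ ≤ 1 * u j y * 1 := by
                  gcongr
                  · exact hale j
                  · exact Jneg_le_one _ (by positivity)
              _ ≤ _ := by
                  rw [one_mul, mul_one]
                  simp only [hu]
                  rw [cv_comm, ← ofReal_norm]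
                  apply ENNReal.ofReal_le_ofReal
                  simpa using hb (2 ^ j) (one_le_pow₀ (by norm_num)) y
          exact ne_top_of_le_ne_top ENNReal.ofReal_ne_top this
        exact ENNReal.rpow_ne_top_of_nonneg (by linarith) hMfin hMtop
      · rw [hMtop, ENNReal.top_mul (by simp [h0])]; exact le_top
    have hterm : ∀ k, (a k * 2 ^ (k * n)) * ∫⁻ z, u k z * J (x - z) ^ (-(A:ℝ)) ≤ M ^ (1 - θ) * (2⁻¹ ^ k * H) := by
      intro k
      have hb1 : a k * 2 ^ (k * n) ≠ ⊤ := ENNReal.mul_ne_top (hatop k) (by finiteness)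
      have hb2 : (2⁻¹ : ℝ≥0∞) ^ k ≠ ⊤ := ENNReal.pow_ne_top h2top
      rw [hH, ← lintegral_const_mul' _ _ hb1, ← lintegral_const_mul' _ _ hb2,
        ← lintegral_const_mul' _ _ hMtop]
      refine lintegral_mono fun z => ?_
      set v := a k * u k z * J (x - z) ^ (-(A:ℝ)) with hv
      have hvM : v ≤ M := le_iSup₂_of_le k z le_rfl
      have hsplit : v = v ^ (1 - θ) * v ^ θ := by
        rw [← ENNReal.rpow_add_of_nonneg _ _ (by linarith) hθ.le]; simp
      have hvθ : v ^ θ = a k ^ θ * u k z ^ θ * J (x - z) ^ (-(A * θ)) := by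
        rw [hv, ENNReal.mul_rpow_of_nonneg _ _ hθ.le, ENNReal.mul_rpow_of_nonneg _ _ hθ.le,
          ← ENNReal.rpow_mul, neg_mul]
      have haθ : a k ^ θ * 2 ^ (k * n) ≤ 2⁻¹ ^ k := by
        have : a k ^ θ = (2⁻¹ : ℝ≥0∞) ^ ((k:ℝ) * (A * θ)) := by
          simp only [ha]
          rw [← ENNReal.rpow_natCast, ← ENNReal.rpow_mul]; congr 1; push_cast; ring
        rw [this]
        calc _ ≤ (2⁻¹ : ℝ≥0∞) ^ ((k:ℝ) * (n + 1)) * 2 ^ (k * n) := by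
              gcongr ?_ * _
              apply ENNReal.rpow_le_rpow_of_exponent_ge (by simp)
              gcongr
          _ = (2⁻¹ : ℝ≥0∞) ^ (k * n + k) * 2 ^ (k * n) := by
              rw [← ENNReal.rpow_natCast _ (k * n + k)]; push_cast; congr 2; ring
          _ = 2⁻¹ ^ k := by
              rw [pow_add, mul_comm, ← mul_assoc, ← mul_pow, ENNReal.mul_inv_cancel (by norm_num) (by norm_num)]
              simp
      calc (a k * 2 ^ (k * n)) * (u k z * J (x - z) ^ (-(A:ℝ))) = v * 2 ^ (k * n) := by rw [hv]; ring
        _ = v ^ (1 - θ) * (a k ^ θ * u k z ^ θ * J (x - z) ^ (-(A * θ))) * 2 ^ (k * n) := by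
            rw [← hvθ, ← hsplit]
        _ = v ^ (1 - θ) * ((a k ^ θ * 2 ^ (k * n)) * (u k z ^ θ * J (x - z) ^ (-(A * θ)))) := by ring
        _ ≤ M ^ (1 - θ) * (2⁻¹ ^ k * (m z ^ θ * J (x - z) ^ (-(A * θ)))) := by
            have : (0:ℝ) ≤ 1 - θ := by linarith
            gcongr
            exact hum k z
    calc S ≤ ∑' k, M ^ (1 - θ) * (2⁻¹ ^ k * H) := ENNReal.tsum_le_tsum hterm
      _ = _ := by
        rw [ENNReal.tsum_mul_left, ENNReal.tsum_mul_right, ENNReal.tsum_geometric]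
        congr 2
        rw [ENNReal.one_sub_inv_two, inv_inv]
  have hMfin : M ≠ ⊤ := by
    obtain ⟨B, hB, hb⟩ := conv_uniform f Φ 0
    have : M ≤ ENNReal.ofReal B := by
      refine iSup₂_le fun j y => ?_
      calc _ ≤ 1 * u j y * 1 := by
            gcongr
            · exact hale j
            · exact Jneg_le_one _ (by positivity)
        _ ≤ _ := by
            rw [one_mul, mul_one]
            simp only [hu]
            rw [cv_comm, ← ofReal_norm]
            apply ENNReal.ofReal_le_ofReal
            simpa using hb (2 ^ j) (one_le_pow₀ (by norm_num)) y
    exact ne_top_of_le_ne_top ENNReal.ofReal_ne_top this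
  have s4 : M ^ θ ≤ 2 * C2 * H := by
    rcases eq_or_ne M 0 with h0 | h0
    · rw [h0, ENNReal.zero_rpow_of_pos hθ]; exact zero_le
    have h1 : M ≤ M ^ (1 - θ) * (2 * C2 * H) := by
      calc M ≤ C2 * (M ^ (1 - θ) * (2 * H)) := s2.trans (by gcongr)
        _ = _ := by ring
    have h2 : M = M ^ (1 - θ) * M ^ θ := by
      rw [← ENNReal.rpow_add_of_nonneg _ _ (by linarith) hθ.le]; simp
    have h3 : M ^ (1 - θ) * M ^ θ ≤ M ^ (1 - θ) * (2 * C2 * H) := h2 ▸ h1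
    refine (ENNReal.mul_le_mul_iff_right ?_ ?_).mp h3
    · exact (ENNReal.rpow_pos (pos_iff_ne_zero.mpr h0) hMfin).ne'
    · exact ENNReal.rpow_ne_top_of_nonneg (by linarith) hMfin
  have hθ' : 0 ≤ (1 - θ)/θ := div_nonneg (by linarith) hθ.le
  have s5 : M ^ (1 - θ) ≤ (2 * C2 * H) ^ ((1 - θ)/θ) := by
    have := ENNReal.rpow_le_rpow s4 hθ'
    rwa [← ENNReal.rpow_mul, mul_div_cancel₀ _ hθ.ne'] at this
  calc ‖cv ψ f x‖ₑ ≤ C1 * ((2 * C2 * H) ^ ((1 - θ)/θ) * (2 * H)) :=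
        s1.trans (by gcongr; exact s3.trans (by gcongr))
    _ = C1 * (2 * (2 * C2) ^ ((1 - θ)/θ)) * (H ^ ((1 - θ)/θ) * H) := by
        rw [ENNReal.mul_rpow_of_nonneg _ _ hθ']; ring
    _ = _ := by
        congr 1
        conv_lhs => rw [← ENNReal.rpow_one H, ← ENNReal.rpow_mul, ← ENNReal.rpow_add_of_nonneg _ _ (by simpa using hθ') zero_le_one]
        congr 1
        field_simp; ring

end BR


namespace BR
open scoped FourierTransform SchwartzMap Topology
open Filter

variable {n : ℕ}

/-- Mass of a ball. -/
def bm (ω : En n → ℝ≥0∞) (x : En n) (r : ℝ) : ℝ≥0∞ := ∫⁻ y in Metric.ball x r, ω y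

/-- A pair of dual Muckenhoupt weights. -/
structure Wt (n : ℕ) (s : ℝ) (K : ℝ≥0∞) (ω σ : En n → ℝ≥0∞) : Prop where
  mω : Measurable ω
  mσ : Measurable σ
  fin : ∀ x r, bm ω x r ≠ ⊤
  finσ : ∀ x r, bm σ x r ≠ ⊤
  dual : ∀ᵐ x, ω x * σ x ^ (s - 1) = 1
  ap : ∀ x r, 0 < r → bm ω x r * (bm σ x r) ^ (s - 1) ≤ K * ENNReal.ofReal r ^ ((n:ℝ) * s)

/-- Growth of order `q`. -/
def Gr (n : ℕ) (q : ℝ) (K : ℝ≥0∞) (ω : En n → ℝ≥0∞) : Prop :=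
  ∀ x y r R, 0 < r → 0 < R → Metric.ball x r ⊆ Metric.ball y R →
    bm ω y R * ENNReal.ofReal r ^ ((n:ℝ) * q) ≤ K * ENNReal.ofReal R ^ ((n:ℝ) * q) * bm ω x r

lemma bm_mono (ω : En n → ℝ≥0∞) {x y : En n} {r R : ℝ} (h : Metric.ball x r ⊆ Metric.ball y R) :
    bm ω x r ≤ bm ω y R := lintegral_mono_set h

lemma Wt.ne {s : ℝ} (hs : 1 < s) {K : ℝ≥0∞} {ω σ : En n → ℝ≥0∞} (h : Wt n s K ω σ) :
    ∀ᵐ x, ω x ≠ 0 ∧ ω x ≠ ⊤ ∧ σ x ≠ 0 ∧ σ x ≠ ⊤ := by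
  have hs1 : 0 < s - 1 := by linarith
  filter_upwards [h.dual] with x hx
  refine ⟨?_, ?_, ?_, ?_⟩ <;> intro h0
  · rw [h0, zero_mul] at hx; exact zero_ne_one hx
  · rw [h0] at hx
    by_cases h1 : σ x ^ (s-1) = 0
    · rw [h1, mul_zero] at hx; exact zero_ne_one hx
    · rw [ENNReal.top_mul h1] at hx; exact ENNReal.top_ne_one hx
  · rw [h0, ENNReal.zero_rpow_of_pos hs1, mul_zero] at hx; exact zero_ne_one hx
  · rw [h0, ENNReal.top_rpow_of_pos hs1] at hx
    by_cases h1 : ω x = 0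
    · rw [h1, zero_mul] at hx; exact zero_ne_one hx
    · rw [ENNReal.mul_top h1] at hx; exact ENNReal.top_ne_one hx

lemma Wt.holder {s : ℝ} (hs : 1 < s) {K : ℝ≥0∞} {ω σ : En n → ℝ≥0∞} (h : Wt n s K ω σ)
    (μ : Measure (En n)) (hμ : μ ≪ volume) (g : En n → ℝ≥0∞) (hg : Measurable g) :
    (∫⁻ x, g x ∂μ) ^ s ≤ (∫⁻ x, g x ^ s * ω x ∂μ) * (∫⁻ x, σ x ∂μ) ^ (s - 1) := by
  have hs0 : 0 < s := by linarith
  have hs1 : 0 < s - 1 := by linarith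
  have hc := Real.HolderConjugate.conjExponent hs
  have H := ENNReal.lintegral_mul_le_Lp_mul_Lq μ hc (f := fun x => g x * ω x ^ (1/s))
    (g := fun x => σ x ^ ((s-1)/s)) (by have := h.mω; fun_prop) (by have := h.mσ; fun_prop)
  have e1 : ∫⁻ x, g x ∂μ = ∫⁻ x, ((fun x => g x * ω x ^ (1/s)) * (fun x => σ x ^ ((s-1)/s))) x ∂μ := by
    apply lintegral_congr_ae
    filter_upwards [hμ h.dual] with x hx
    simp only [Pi.mul_apply]
    rw [mul_assoc]
    have : ω x ^ (1/s) * σ x ^ ((s-1)/s) = (ω x * σ x ^ (s-1)) ^ (1/s) := by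
      rw [ENNReal.mul_rpow_of_nonneg _ _ (by positivity), ← ENNReal.rpow_mul]
      congr 2; ring
    rw [this]
    have hx' : ω x * σ x ^ (s-1) = 1 := hx
    rw [hx', ENNReal.one_rpow, mul_one]
  have e2 : ∀ x, (g x * ω x ^ (1/s)) ^ s = g x ^ s * ω x := by
    intro x
    rw [ENNReal.mul_rpow_of_nonneg _ _ hs0.le, ← ENNReal.rpow_mul, one_div, inv_mul_cancel₀ hs0.ne', ENNReal.rpow_one]
  have e3 : ∀ x, (σ x ^ ((s-1)/s)) ^ (s.conjExponent) = σ x := by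
    intro x
    rw [← ENNReal.rpow_mul, Real.conjExponent]
    rw [div_mul_div_cancel₀ hs0.ne', div_self hs1.ne', ENNReal.rpow_one]
  simp only [e2, e3] at H
  rw [← e1] at H
  calc (∫⁻ x, g x ∂μ) ^ s ≤ _ := ENNReal.rpow_le_rpow H hs0.le
    _ = _ := by
      rw [ENNReal.mul_rpow_of_nonneg _ _ hs0.le, ← ENNReal.rpow_mul, ← ENNReal.rpow_mul, one_div, inv_mul_cancel₀ hs0.ne',
        ENNReal.rpow_one, Real.conjExponent]
      congr 2; field_simp

lemma Wt.symm {s : ℝ} (hs : 1 < s) {K : ℝ≥0∞} {ω σ : En n → ℝ≥0∞} (h : Wt n s K ω σ) :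
    Wt n (s/(s-1)) (K ^ (1/(s-1))) σ ω := by
  have hs1 : 0 < s - 1 := by linarith
  have e : s/(s-1) - 1 = 1/(s-1) := by field_simp; ring
  have e2 : (s - 1) * (1/(s-1)) = 1 := by field_simp
  refine ⟨h.mσ, h.mω, h.finσ, h.fin, ?_, ?_⟩
  · filter_upwards [h.dual] with x hx
    have := congrArg (fun t => t ^ (1/(s-1))) hx
    simp only [ENNReal.one_rpow] at this
    rw [ENNReal.mul_rpow_of_nonneg _ _ (by positivity), ← ENNReal.rpow_mul, e2, ENNReal.rpow_one, mul_comm] at this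
    rw [e]; exact this
  · intro x r hr
    have := ENNReal.rpow_le_rpow (h.ap x r hr) (z := 1/(s-1)) (by positivity)
    rw [ENNReal.mul_rpow_of_nonneg _ _ (by positivity), ← ENNReal.rpow_mul, e2, ENNReal.rpow_one, mul_comm,
      ENNReal.mul_rpow_of_nonneg _ _ (by positivity), ← ENNReal.rpow_mul] at this
    rw [e]; convert this using 3; ring

lemma vol_ball (x : En n) {r : ℝ} (hr : 0 < r) :
    volume (Metric.ball x r) = ENNReal.ofReal r ^ (n:ℝ) * volume (Metric.ball (0 : En n) 1) := by
  rw [Measure.addHaar_ball_of_pos volume x hr, finrank_euclideanSpace_fin, ENNReal.ofReal_pow hr.le, ENNReal.rpow_natCast]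

lemma vb_ne_zero : volume (Metric.ball (0 : En n) 1) ≠ 0 := (Metric.measure_ball_pos _ _ one_pos).ne'
lemma vb_ne_top : volume (Metric.ball (0 : En n) 1) ≠ ⊤ := measure_ball_lt_top.ne

lemma Wt.grow {s : ℝ} (hs : 1 < s) {K : ℝ≥0∞} {ω σ : En n → ℝ≥0∞} (h : Wt n s K ω σ) :
    Gr n s (K * (volume (Metric.ball (0 : En n) 1)) ^ (-s)) ω := by
  intro x y r R hr hR hsub
  set v := volume (Metric.ball (0 : En n) 1) with hv
  have H := h.holder hs (volume.restrict (Metric.ball y R)) Measure.restrict_le_self.absolutelyContinuous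
    ((Metric.ball x r).indicator 1) (measurable_one.indicator measurableSet_ball)
  have hs0 : 0 < s := by linarith
  rw [lintegral_indicator_one measurableSet_ball, Measure.restrict_apply measurableSet_ball,
    inter_eq_left.mpr hsub, vol_ball x hr] at H
  have e : ∫⁻ z in Metric.ball y R, ((Metric.ball x r).indicator (1 : En n → ℝ≥0∞) z) ^ s * ω z = bm ω x r := by
    have : ∀ z, ((Metric.ball x r).indicator (1 : En n → ℝ≥0∞) z) ^ s * ω z = (Metric.ball x r).indicator ω z := by
      intro z
      by_cases hz : z ∈ Metric.ball x r
      · simp [hz]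
      · simp [hz, hs0]
    simp only [this]
    rw [lintegral_indicator measurableSet_ball, Measure.restrict_restrict measurableSet_ball, inter_eq_left.mpr hsub]
    rfl
  rw [e, ENNReal.mul_rpow_of_nonneg _ _ hs0.le, ← ENNReal.rpow_mul] at H
  have H2 := mul_le_mul_right H (bm ω y R)
  have H3 : bm ω y R * (bm ω x r * (∫⁻ z in Metric.ball y R, σ z) ^ (s-1)) ≤
      bm ω x r * (K * ENNReal.ofReal R ^ ((n:ℝ) * s)) := by
    rw [mul_left_comm]
    exact mul_le_mul_right (h.ap y R hR) _
  have H4 := mul_le_mul_left (H2.trans H3) (v ^ (-s))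
  have hvv : v ^ s * v ^ (-s) = 1 := by
    rw [← ENNReal.rpow_add _ _ vb_ne_zero vb_ne_top]; simp
  calc bm ω y R * ENNReal.ofReal r ^ ((n:ℝ) * s) = bm ω y R * (ENNReal.ofReal r ^ ((n:ℝ) * s) * v ^ s) * v ^ (-s) := by
        rw [mul_assoc, mul_assoc, hvv, mul_one]
    _ ≤ _ := H4
    _ = _ := by ring

lemma Wt.pos {s : ℝ} (hs : 1 < s) {K : ℝ≥0∞} {ω σ : En n → ℝ≥0∞} (h : Wt n s K ω σ) (x : En n) {r : ℝ} (hr : 0 < r) :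
    bm ω x r ≠ 0 := by
  intro h0
  rw [bm, setLIntegral_eq_zero_iff measurableSet_ball h.mω] at h0
  have : ∀ᵐ z, z ∉ Metric.ball x r := by
    filter_upwards [h0, h.ne hs] with z hz h1 h2 using h1.1 (hz h2)
  have h3 : volume (Metric.ball x r) = 0 := by
    rw [← compl_compl (Metric.ball x r)]; exact this
  exact (Metric.measure_ball_pos volume x hr).ne' h3

/-- dilations -/
lemma bm_dil (ω : En n → ℝ≥0∞) {ε : ℝ} (hε : 0 < ε) (x : En n) (r : ℝ) :
    bm ω (ε • x) (ε * r) = ENNReal.ofReal ε ^ (n:ℝ) * bm (fun y => ω (ε • y)) x r := by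
  unfold bm
  rw [← lintegral_indicator measurableSet_ball, ← lintegral_indicator measurableSet_ball, lintegral_smul_sub ε hε,
    ENNReal.ofReal_pow hε.le, ENNReal.rpow_natCast]
  congr 2; ext z
  have : ε • z ∈ Metric.ball (ε • x) (ε * r) ↔ z ∈ Metric.ball x r := by
    rw [Metric.mem_ball, Metric.mem_ball, dist_smul₀, Real.norm_eq_abs, abs_of_pos hε]
    exact mul_lt_mul_iff_right₀ hε
  by_cases hz : z ∈ Metric.ball x r
  · rw [indicator_of_mem hz, indicator_of_mem (this.2 hz)]
  · rw [indicator_of_notMem hz, indicator_of_notMem (fun h => hz (this.1 h))]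

lemma bm_dil' (ω : En n → ℝ≥0∞) {ε : ℝ} (hε : 0 < ε) (x : En n) (r : ℝ) :
    bm (fun y => ω (ε • y)) x r = ENNReal.ofReal ε ^ (-(n:ℝ)) * bm ω (ε • x) (ε * r) := by
  rw [bm_dil ω hε, ← mul_assoc, ← ENNReal.rpow_add _ _ (by simpa using hε) ENNReal.ofReal_ne_top]
  simp

lemma ae_dil {P : En n → Prop} (h : ∀ᵐ x, P x) {ε : ℝ} (hε : 0 < ε) : ∀ᵐ x : En n, P (ε • x) := by
  have hq : Measure.QuasiMeasurePreserving (fun x : En n => ε • x) volume volume := by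
    refine ⟨measurable_const_smul ε, ?_⟩
    rw [Measure.map_addHaar_smul (volume : Measure (En n)) hε.ne']
    exact Measure.smul_absolutelyContinuous
  exact hq.ae h

lemma Wt.dil {s : ℝ} (hs : 1 < s) {K : ℝ≥0∞} {ω σ : En n → ℝ≥0∞} (h : Wt n s K ω σ) {ε : ℝ} (hε : 0 < ε) :
    Wt n s K (fun y => ω (ε • y)) (fun y => σ (ε • y)) := by
  have he0 : ENNReal.ofReal ε ≠ 0 := by simpa using hε
  have het : ENNReal.ofReal ε ≠ ⊤ := ENNReal.ofReal_ne_top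
  refine ⟨h.mω.comp (measurable_const_smul ε), h.mσ.comp (measurable_const_smul ε), ?_, ?_, ae_dil h.dual hε, ?_⟩
  · intro x r
    rw [bm_dil' ω hε]
    exact ENNReal.mul_ne_top (ENNReal.rpow_ne_top_of_ne_zero he0 het) (h.fin _ _)
  · intro x r
    rw [bm_dil' σ hε]
    exact ENNReal.mul_ne_top (ENNReal.rpow_ne_top_of_ne_zero he0 het) (h.finσ _ _)
  · intro x r hr
    rw [bm_dil' ω hε, bm_dil' σ hε, ENNReal.mul_rpow_of_nonneg _ _ (by linarith), ← ENNReal.rpow_mul]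
    have h1 := h.ap (ε • x) (ε * r) (by positivity)
    rw [ENNReal.ofReal_mul hε.le, ENNReal.mul_rpow_of_nonneg _ _ (by positivity)] at h1
    have h2 := mul_le_mul_right h1 (ENNReal.ofReal ε ^ (-((n:ℝ) * s)))
    have e : ENNReal.ofReal ε ^ (-((n:ℝ) * s)) = ENNReal.ofReal ε ^ (-(n:ℝ)) * ENNReal.ofReal ε ^ (-(n:ℝ) * (s-1)) := by
      rw [← ENNReal.rpow_add _ _ he0 het]; congr 1; ring
    have e2 : ENNReal.ofReal ε ^ (-((n:ℝ) * s)) * ENNReal.ofReal ε ^ ((n:ℝ) * s) = 1 := by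
      rw [← ENNReal.rpow_add _ _ he0 het]; simp
    calc _ = ENNReal.ofReal ε ^ (-((n:ℝ) * s)) * (bm ω (ε • x) (ε * r) * bm σ (ε • x) (ε * r) ^ (s - 1)) := by
          rw [e]; ring
      _ ≤ _ := h2
      _ = (ENNReal.ofReal ε ^ (-((n:ℝ) * s)) * ENNReal.ofReal ε ^ ((n:ℝ) * s)) * (K * ENNReal.ofReal r ^ ((n:ℝ) * s)) := by ring
      _ = _ := by rw [e2, one_mul]

lemma Gr.dil {q : ℝ} (hq : 1 ≤ q) {K : ℝ≥0∞} {ω : En n → ℝ≥0∞} (h : Gr n q K ω) {ε : ℝ} (hε : 0 < ε) :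
    Gr n q K (fun y => ω (ε • y)) := by
  have he0 : ENNReal.ofReal ε ≠ 0 := by simpa using hε
  have het : ENNReal.ofReal ε ≠ ⊤ := ENNReal.ofReal_ne_top
  intro x y r R hr hR hsub
  have hsub' : Metric.ball (ε • x) (ε * r) ⊆ Metric.ball (ε • y) (ε * R) := by
    intro z hz
    have h1 : ε⁻¹ • z ∈ Metric.ball x r := by
      rw [Metric.mem_ball] at hz ⊢
      have : z = ε • (ε⁻¹ • z) := by rw [smul_smul, mul_inv_cancel₀ hε.ne', one_smul]
      rw [this, dist_smul₀, Real.norm_eq_abs, abs_of_pos hε] at hz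
      exact lt_of_mul_lt_mul_left hz hε.le
    have h2 := hsub h1
    rw [Metric.mem_ball] at h2 ⊢
    have : z = ε • (ε⁻¹ • z) := by rw [smul_smul, mul_inv_cancel₀ hε.ne', one_smul]
    rw [this, dist_smul₀, Real.norm_eq_abs, abs_of_pos hε]
    exact mul_lt_mul_of_pos_left h2 hε
  have h1 := h (ε • x) (ε • y) (ε * r) (ε * R) (by positivity) (by positivity) hsub'
  rw [ENNReal.ofReal_mul hε.le, ENNReal.ofReal_mul hε.le, ENNReal.mul_rpow_of_nonneg _ _ (by positivity),
    ENNReal.mul_rpow_of_nonneg _ _ (by positivity)] at h1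
  have h2 := mul_le_mul_right h1 (ENNReal.ofReal ε ^ (-((n:ℝ) * q)) * ENNReal.ofReal ε ^ (-(n:ℝ)))
  have e2 : ENNReal.ofReal ε ^ (-((n:ℝ) * q)) * ENNReal.ofReal ε ^ ((n:ℝ) * q) = 1 := by
    rw [← ENNReal.rpow_add _ _ he0 het]; simp
  rw [bm_dil' ω hε, bm_dil' ω hε]
  calc _ = (ENNReal.ofReal ε ^ (-((n:ℝ) * q)) * ENNReal.ofReal ε ^ ((n:ℝ) * q)) * (ENNReal.ofReal ε ^ (-(n:ℝ)) * bm ω (ε • y) (ε * R) * ENNReal.ofReal r ^ ((n:ℝ) * q)) := by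
        rw [e2, one_mul]
    _ = ENNReal.ofReal ε ^ (-((n:ℝ) * q)) * ENNReal.ofReal ε ^ (-(n:ℝ)) * (bm ω (ε • y) (ε * R) * (ENNReal.ofReal ε ^ ((n:ℝ) * q) * ENNReal.ofReal r ^ ((n:ℝ) * q))) := by ring
    _ ≤ _ := h2
    _ = (ENNReal.ofReal ε ^ (-((n:ℝ) * q)) * ENNReal.ofReal ε ^ ((n:ℝ) * q)) * (K * ENNReal.ofReal R ^ ((n:ℝ) * q) * (ENNReal.ofReal ε ^ (-(n:ℝ)) * bm ω (ε • x) (ε * r))) := by ring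
    _ = _ := by rw [e2, one_mul]

end BR


namespace BR
open scoped FourierTransform SchwartzMap Topology
open Filter

variable {n : ℕ}

lemma shell (L : ℝ) (hL : 0 ≤ L) (y z : En n) :
    J (y - z) ^ (-L) ≤ 2 ^ L * ∑' j : ℕ, (2:ℝ≥0∞) ^ (-(j * L)) * (Metric.ball y (2 ^ j)).indicator 1 z := by
  obtain ⟨j, hj1, hj2⟩ := exists_nat_pow_near (x := 1 + ‖y - z‖) (y := 2) (by linarith [norm_nonneg (y - z)]) (by norm_num)
  have hz : z ∈ Metric.ball y (2 ^ (j+1)) := by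
    rw [Metric.mem_ball, dist_comm, dist_eq_norm]; linarith
  calc J (y - z) ^ (-L) ≤ (2:ℝ≥0∞) ^ (-(j * L)) := by
        have : (2:ℝ≥0∞) ^ (j:ℝ) ≤ J (y - z) := by
          have e2 : ENNReal.ofReal ((2:ℝ) ^ j) = 2 ^ (j:ℝ) := by
            rw [ENNReal.ofReal_pow (by norm_num), ENNReal.rpow_natCast]; simp
          rw [← e2, J]
          exact ENNReal.ofReal_le_ofReal hj1
        rw [ENNReal.rpow_neg, ENNReal.rpow_neg, ENNReal.inv_le_inv, ENNReal.rpow_mul]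
        exact ENNReal.rpow_le_rpow this hL
    _ = 2 ^ L * ((2:ℝ≥0∞) ^ (-(((j+1 : ℕ):ℝ) * L)) * (Metric.ball y (2 ^ (j+1))).indicator 1 z) := by
        rw [indicator_of_mem hz, Pi.one_apply, mul_one, ← ENNReal.rpow_add _ _ (by norm_num) (by norm_num)]
        congr 1; push_cast; ring
    _ ≤ _ := mul_le_mul_right (ENNReal.le_tsum (f := fun j : ℕ => (2:ℝ≥0∞) ^ (-(j * L)) * (Metric.ball y (2 ^ j)).indicator 1 z) (j+1)) _

lemma geom_ne_top {r : ℝ} (hr : 0 < r) : ∑' j : ℕ, (2:ℝ≥0∞) ^ (-(j * r)) ≠ ⊤ := by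
  have : ∀ j : ℕ, (2:ℝ≥0∞) ^ (-(j * r)) = ((2:ℝ≥0∞) ^ (-r)) ^ j := by
    intro j
    rw [← ENNReal.rpow_natCast, ← ENNReal.rpow_mul]; congr 1; ring
  simp only [this, ENNReal.tsum_geometric]
  rw [Ne, ENNReal.inv_eq_top, tsub_eq_zero_iff_le, not_le]
  exact ENNReal.rpow_lt_one_of_one_lt_of_neg (by norm_num) (by linarith)

lemma J_int_ne_top {L : ℝ} (hL : (n:ℝ) < L) : ∫⁻ z : En n, J z ^ (-L) ≠ ⊤ := by
  have := finite_integral_one_add_norm (E := En n) (μ := volume) (r := L) (by simpa using hL)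
  simp only [ofReal_Jpow] at this
  exact this.ne

lemma J_int_shift (L : ℝ) (z : En n) : ∫⁻ y : En n, J (y - z) ^ (-L) = ∫⁻ z : En n, J z ^ (-L) :=
  lintegral_sub_right_eq_self (fun y => J y ^ (-L)) z

lemma shell_int (L : ℝ) (hL : 0 ≤ L) (y : En n) (g : En n → ℝ≥0∞) (hg : Measurable g) :
    ∫⁻ z, g z * J (y - z) ^ (-L) ≤ 2 ^ L * ∑' j : ℕ, (2:ℝ≥0∞) ^ (-(j * L)) * bm g y (2 ^ j) := by
  calc ∫⁻ z, g z * J (y - z) ^ (-L)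
      ≤ ∫⁻ z, 2 ^ L * ∑' j : ℕ, (2:ℝ≥0∞) ^ (-(j * L)) * (Metric.ball y (2 ^ j)).indicator g z := by
        refine lintegral_mono fun z => ?_
        calc g z * J (y - z) ^ (-L) ≤ g z * (2 ^ L * ∑' j : ℕ, (2:ℝ≥0∞) ^ (-(j * L)) * (Metric.ball y (2 ^ j)).indicator 1 z) :=
              mul_le_mul_right (shell L hL y z) _
          _ = _ := by
            rw [mul_left_comm, ← ENNReal.tsum_mul_left]
            congr 2; ext j
            by_cases hz : z ∈ Metric.ball y (2 ^ j)
            · rw [indicator_of_mem hz, indicator_of_mem hz, Pi.one_apply]; ring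
            · rw [indicator_of_notMem hz, indicator_of_notMem hz]; ring
    _ = _ := by
        have hm : ∀ j : ℕ, Measurable ((Metric.ball y (2 ^ j)).indicator g) := fun j => hg.indicator measurableSet_ball
        rw [lintegral_const_mul _ (by fun_prop), lintegral_tsum (by fun_prop)]
        congr 2; ext j
        rw [lintegral_const_mul _ (by fun_prop), lintegral_indicator measurableSet_ball]; rfl

lemma Jsub_meas (L : ℝ) : Measurable (fun q : En n × En n => J (q.1 - q.2) ^ L) :=
  (Jpow_continuous L).measurable.comp (measurable_fst.sub measurable_snd)

lemma bm_meas {ω : En n → ℝ≥0∞} (hω : Measurable ω) (r : ℝ) : Measurable (fun y => bm ω y r) := by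
  have : ∀ y, bm ω y r = ∫⁻ z, {q : En n × En n | dist q.2 q.1 < r}.indicator (fun q => ω q.2) (y, z) := by
    intro y
    rw [bm, ← lintegral_indicator measurableSet_ball]
    rfl
  simp only [this]
  apply Measurable.lintegral_prod_right'
    (f := {q : En n × En n | dist q.2 q.1 < r}.indicator (fun q => ω q.2))
  exact (hω.comp measurable_snd).indicator (measurableSet_lt (by fun_prop) (by fun_prop))

/-- Tonelli for ball averages. -/
lemma bm_swap {ω F : En n → ℝ≥0∞} (hω : Measurable ω) (hF : Measurable F) (r : ℝ) :
    ∫⁻ y, F y * bm ω y r = ∫⁻ x, ω x * bm F x r := by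
  have h1 : ∀ (g h : En n → ℝ≥0∞) (hg : Measurable g) (y : En n), h y * bm g y r =
      ∫⁻ z, {q : En n × En n | dist q.2 q.1 < r}.indicator (fun q => h q.1 * g q.2) (y, z) := by
    intro g h hg y
    rw [bm, ← lintegral_const_mul _ hg, ← lintegral_indicator measurableSet_ball]
    rfl
  simp only [h1 ω F hω, h1 F ω hF]
  rw [lintegral_lintegral_swap]
  · refine lintegral_congr fun x => lintegral_congr fun y => ?_
    simp only [indicator, mem_ofPred_eq, dist_comm, mul_comm]
  · apply Measurable.aemeasurable
    exact ((hF.comp measurable_fst).mul (hω.comp measurable_snd)).indicator (measurableSet_lt (by fun_prop) (by fun_prop))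

lemma slow_le {ω F : En n → ℝ≥0∞} (hω : Measurable ω) (hF : Measurable F) {c : ℝ≥0∞} (hc : c ≠ ⊤)
    (h : ∀ y y', dist y y' < 1 → F y ≤ c * F y') :
    ∫⁻ x, F x * ω x ≤ c * (volume (Metric.ball (0 : En n) 1))⁻¹ * ∫⁻ y, F y * bm ω y 1 := by
  rw [bm_swap hω hF, ← lintegral_const_mul' _ _ (ENNReal.mul_ne_top hc (ENNReal.inv_ne_top.2 vb_ne_zero))]
  refine lintegral_mono fun x => ?_
  have h1 : volume (Metric.ball (0 : En n) 1) * F x ≤ c * bm F x 1 := by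
    rw [bm, ← lintegral_const_mul _ hF]
    calc volume (Metric.ball (0 : En n) 1) * F x = ∫⁻ y in Metric.ball x 1, F x := by
          rw [setLIntegral_const, mul_comm, vol_ball x one_pos]; simp
      _ ≤ _ := setLIntegral_mono' measurableSet_ball fun y hy => h x y (by rw [dist_comm]; exact hy)
  calc F x * ω x = (volume (Metric.ball (0 : En n) 1))⁻¹ * (volume (Metric.ball (0 : En n) 1) * F x) * ω x := by
        rw [← mul_assoc _ _ (F x), ENNReal.inv_mul_cancel vb_ne_zero vb_ne_top, one_mul]
    _ ≤ (volume (Metric.ball (0 : En n) 1))⁻¹ * (c * bm F x 1) * ω x := by gcongr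
    _ = _ := by ring

lemma slow_ge {ω F : En n → ℝ≥0∞} (hω : Measurable ω) (hF : Measurable F) {c : ℝ≥0∞} (hc : c ≠ ⊤)
    (h : ∀ y y', dist y y' < 1 → F y ≤ c * F y') :
    ∫⁻ y, F y * bm ω y 1 ≤ c * (volume (Metric.ball (0 : En n) 1)) * ∫⁻ x, F x * ω x := by
  rw [bm_swap hω hF, ← lintegral_const_mul' _ _ (ENNReal.mul_ne_top hc vb_ne_top)]
  refine lintegral_mono fun x => ?_
  have h1 : bm F x 1 ≤ c * F x * volume (Metric.ball (0 : En n) 1) := by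
    rw [bm]
    calc _ ≤ ∫⁻ y in Metric.ball x 1, c * F x :=
          setLIntegral_mono' measurableSet_ball fun y hy => h y x hy
      _ = _ := by rw [setLIntegral_const, vol_ball x one_pos]; simp
  calc _ ≤ ω x * (c * F x * volume (Metric.ball (0 : En n) 1)) := mul_le_mul_right h1 _
    _ = _ := by ring

/-- the smoothing operator -/
def Sm (L : ℝ) (g : En n → ℝ≥0∞) (y : En n) : ℝ≥0∞ := ∫⁻ z, g z * J (y - z) ^ (-L)

lemma Sm_meas (L : ℝ) {g : En n → ℝ≥0∞} (hg : Measurable g) : Measurable (Sm L g) := by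
  apply Measurable.lintegral_prod_right' (f := fun q : En n × En n => g q.2 * J (q.1 - q.2) ^ (-L))
  exact (hg.comp measurable_snd).mul (Jsub_meas _)

lemma Sm_slow {L : ℝ} (hL : 0 ≤ L) {g : En n → ℝ≥0∞} (y y' : En n) (h : dist y y' < 1) :
    Sm L g y ≤ 2 ^ L * Sm L g y' := by
  unfold Sm
  rw [← lintegral_const_mul' _ _ (by finiteness)]
  refine lintegral_mono fun z => ?_
  have h1 := Jneg_shift y y' z hL
  have h2 : J (y - y') ^ L ≤ 2 ^ L := by
    apply ENNReal.rpow_le_rpow _ hL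
    have e2 : ENNReal.ofReal (2:ℝ) = 2 := by simp
    refine le_trans (ENNReal.ofReal_le_ofReal ?_) e2.le
    rw [dist_eq_norm] at h; linarith
  calc g z * J (y - z) ^ (-L) ≤ g z * (2 ^ L * J (y' - z) ^ (-L)) := by gcongr; exact h1.trans (by gcongr)
    _ = _ := by ring

lemma partII {s : ℝ} (hs : 1 < s) {K : ℝ≥0∞} (hK : K ≠ ⊤) {L : ℝ} (hLn : (n:ℝ) < L) (hLs : (n:ℝ) * s / (s - 1) < L) :
    ∃ C : ℝ≥0∞, C ≠ ⊤ ∧ ∀ ω σ : En n → ℝ≥0∞, Wt n s K ω σ → ∀ g : En n → ℝ≥0∞, Measurable g →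
      ∫⁻ y, Sm L g y ^ s * ω y ≤ C * ∫⁻ y, g y ^ s * ω y := by
  have hs1 : 0 < s - 1 := by linarith
  have hs0 : 0 < s := by linarith
  have hL0 : 0 < L := lt_of_le_of_lt (Nat.cast_nonneg n) hLn
  set G := ∑' j : ℕ, (2:ℝ≥0∞) ^ (-(j * (L - (n:ℝ) * s / (s - 1)))) with hG
  have hGt : G ≠ ⊤ := geom_ne_top (by linarith)
  set C1 := 2 ^ L * K ^ (1/(s-1)) * G with hC1
  have hC1t : C1 ≠ ⊤ := by
    refine ENNReal.mul_ne_top (ENNReal.mul_ne_top (by finiteness) ?_) hGt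
    exact ENNReal.rpow_ne_top_of_nonneg (by positivity) hK
  set cL := ∫⁻ z : En n, J z ^ (-L) with hcL
  have hcLt : cL ≠ ⊤ := J_int_ne_top hLn
  refine ⟨(2 ^ L) ^ s * (volume (Metric.ball (0 : En n) 1))⁻¹ * (C1 ^ (s-1) * cL), ?_, ?_⟩
  · have := ENNReal.inv_ne_top.2 (vb_ne_zero (n := n))
    have h2 : C1 ^ (s-1) ≠ ⊤ := ENNReal.rpow_ne_top_of_nonneg hs1.le hC1t
    have h3 : ((2:ℝ≥0∞) ^ L) ^ s ≠ ⊤ := by finiteness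
    finiteness
  intro ω σ h g hg
  have hSm := Sm_meas L hg
  have hpt : ∀ y, bm ω y 1 * (∫⁻ z, σ z * J (y - z) ^ (-L)) ^ (s - 1) ≤ C1 ^ (s-1) := by
    intro y
    have h1 : bm ω y 1 ^ (1/(s-1)) * (∫⁻ z, σ z * J (y - z) ^ (-L)) ≤ C1 := by
      calc _ ≤ bm ω y 1 ^ (1/(s-1)) * (2 ^ L * ∑' j : ℕ, (2:ℝ≥0∞) ^ (-(j * L)) * bm σ y (2 ^ j)) :=
            mul_le_mul_right (shell_int L hL0.le y σ h.mσ) _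
        _ = 2 ^ L * ∑' j : ℕ, (2:ℝ≥0∞) ^ (-(j * L)) * (bm σ y (2 ^ j) * bm ω y 1 ^ (1/(s-1))) := by
            rw [mul_left_comm, ← ENNReal.tsum_mul_left]
            congr 2; ext j; ring
        _ ≤ 2 ^ L * ∑' j : ℕ, K ^ (1/(s-1)) * (2:ℝ≥0∞) ^ (-(j * (L - (n:ℝ) * s / (s - 1)))) := by
            refine mul_le_mul_right (ENNReal.tsum_le_tsum fun j => ?_) _
            have h2 := (h.symm hs).ap y (2 ^ j) (by positivity)
            have e : s/(s-1) - 1 = 1/(s-1) := by field_simp; ring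
            rw [e] at h2
            have h3 : bm ω y 1 ≤ bm ω y (2 ^ j) := bm_mono _ (Metric.ball_subset_ball (one_le_pow₀ (by norm_num)))
            have e2 : ENNReal.ofReal ((2:ℝ) ^ j) = 2 ^ (j:ℝ) := by
              rw [ENNReal.ofReal_pow (by norm_num), ENNReal.rpow_natCast]; simp
            calc _ ≤ (2:ℝ≥0∞) ^ (-(j * L)) * (K ^ (1/(s-1)) * ENNReal.ofReal ((2:ℝ)^j) ^ ((n:ℝ) * (s/(s-1)))) := by
                  refine mul_le_mul_right (le_trans ?_ h2) _
                  gcongr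
              _ = K ^ (1/(s-1)) * ((2:ℝ≥0∞) ^ (-(j * L)) * ENNReal.ofReal ((2:ℝ)^j) ^ ((n:ℝ) * (s/(s-1)))) := by ring
              _ = _ := by
                rw [e2, ← ENNReal.rpow_mul, ← ENNReal.rpow_add _ _ (by norm_num) (by norm_num)]
                congr 2; ring
        _ = C1 := by rw [ENNReal.tsum_mul_left, hC1]; ring
    have h2 := ENNReal.rpow_le_rpow h1 hs1.le
    rwa [ENNReal.mul_rpow_of_nonneg _ _ hs1.le, ← ENNReal.rpow_mul, one_div, inv_mul_cancel₀ hs1.ne', ENNReal.rpow_one] at h2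
  have hH : ∀ y, Sm L g y ^ s ≤ (∫⁻ z, (g z ^ s * ω z) * J (y - z) ^ (-L)) * (∫⁻ z, σ z * J (y - z) ^ (-L)) ^ (s - 1) := by
    intro y
    have hJm : Measurable (fun z => J (y - z) ^ (-L)) :=
      (Jpow_continuous (-L)).measurable.comp (measurable_const.sub measurable_id)
    have := h.holder hs (volume.withDensity (fun z => J (y - z) ^ (-L))) (withDensity_absolutelyContinuous _ _) g hg
    have hmω := h.mω
    have hmσ := h.mσ
    rw [lintegral_withDensity_eq_lintegral_mul _ hJm hg, lintegral_withDensity_eq_lintegral_mul _ hJm (by fun_prop),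
      lintegral_withDensity_eq_lintegral_mul _ hJm hmσ] at this
    simp only [Pi.mul_apply] at this
    unfold Sm
    refine le_trans (le_of_eq ?_) (this.trans (le_of_eq ?_))
    · congr 1; exact lintegral_congr fun z => mul_comm _ _
    · congr 1
      · exact lintegral_congr fun z => mul_comm _ _
      · congr 1; exact lintegral_congr fun z => mul_comm _ _
  have hmω := h.mω
  calc ∫⁻ y, Sm L g y ^ s * ω y
      ≤ (2 ^ L) ^ s * (volume (Metric.ball (0 : En n) 1))⁻¹ * ∫⁻ y, Sm L g y ^ s * bm ω y 1 := by
        apply slow_le h.mω (by fun_prop) (by finiteness)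
        intro y y' hy
        rw [← ENNReal.mul_rpow_of_nonneg _ _ hs0.le]
        exact ENNReal.rpow_le_rpow (Sm_slow hL0.le y y' hy) hs0.le
    _ ≤ (2 ^ L) ^ s * (volume (Metric.ball (0 : En n) 1))⁻¹ * ∫⁻ y, C1 ^ (s-1) * ∫⁻ z, (g z ^ s * ω z) * J (y - z) ^ (-L) := by
        refine mul_le_mul_right (lintegral_mono fun y => ?_) _
        calc _ ≤ (∫⁻ z, (g z ^ s * ω z) * J (y - z) ^ (-L)) * (∫⁻ z, σ z * J (y - z) ^ (-L)) ^ (s - 1) * bm ω y 1 := mul_le_mul_left (hH y) _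
          _ = (bm ω y 1 * (∫⁻ z, σ z * J (y - z) ^ (-L)) ^ (s - 1)) * (∫⁻ z, (g z ^ s * ω z) * J (y - z) ^ (-L)) := by ring
          _ ≤ _ := mul_le_mul_left (hpt y) _
    _ = _ := by
        rw [lintegral_const_mul' _ _ (ENNReal.rpow_ne_top_of_nonneg hs1.le hC1t), lintegral_lintegral_swap]
        · have : ∀ z, ∫⁻ y, (g z ^ s * ω z) * J (y - z) ^ (-L) = (g z ^ s * ω z) * cL := by
            intro z
            have hJm : Measurable (fun y => J (y - z) ^ (-L)) :=
              (Jpow_continuous (-L)).measurable.comp (measurable_id.sub measurable_const)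
            rw [lintegral_const_mul _ hJm, J_int_shift]
          simp only [this]
          rw [lintegral_mul_const _ (by fun_prop)]
          ring
        · apply Measurable.aemeasurable
          have h5 : Measurable (fun z => g z ^ s * ω z) := by fun_prop
          exact (h5.comp measurable_snd).mul (Jsub_meas _)

end BR


namespace BR
open scoped FourierTransform SchwartzMap Topology
open Filter

variable {n : ℕ}

/-- indicator of a strict inequality -/
def ii (t u : ℝ≥0∞) : ℝ≥0∞ := (Ioi t).indicator 1 u

lemma ii_meas (t : ℝ≥0∞) : Measurable (ii t) := measurable_one.indicator measurableSet_Ioi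
lemma ii_of_lt {t u : ℝ≥0∞} (h : t < u) : ii t u = 1 := by simp [ii, h]
lemma ii_of_le {t u : ℝ≥0∞} (h : u ≤ t) : ii t u = 0 := by simp [ii, h]

lemma level {N p : ℝ} (hN : 0 < N) (hp : 0 < p) (hNp : N * p = n) {K : ℝ≥0∞}
    {ω : En n → ℝ≥0∞} (hG : Gr n 1 K ω) (hpos : ∀ y, bm ω y 1 ≠ 0) (y : En n) (b t : ℝ≥0∞) (ht0 : t ≠ 0) (ht : t ≠ ⊤) :
    ∫⁻ x, ω x * ii t (b * J (x - y) ^ (-N)) ≤ (K + 1) * (b ^ p * t ^ (-p)) * bm ω y 1 := by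
  have htp : t ^ (-p) ≠ 0 := by
    rw [ENNReal.rpow_neg, Ne, ENNReal.inv_eq_zero]; exact ENNReal.rpow_ne_top_of_nonneg hp.le ht
  by_cases hb : b = ⊤
  · rw [hb, ENNReal.top_rpow_of_pos hp, ENNReal.top_mul htp, ENNReal.mul_top (by simp), ENNReal.top_mul (hpos y)]
    exact le_top
  set ρ := ((b / t) ^ (1/N)).toReal with hρ
  have hbt : b / t ≠ ⊤ := ENNReal.div_ne_top hb ht0
  have hρ' : ENNReal.ofReal ρ = (b / t) ^ (1/N) :=
    ENNReal.ofReal_toReal (ENNReal.rpow_ne_top_of_nonneg (by positivity) hbt)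
  have key : ∀ x, t < b * J (x - y) ^ (-N) → J (x - y) ≤ ENNReal.ofReal ρ := by
    intro x hx
    rw [ENNReal.rpow_neg, ← div_eq_mul_inv] at hx
    have h1 : t * J (x - y) ^ N ≤ b := by
      rw [← ENNReal.le_div_iff_mul_le (Or.inl (Jpow_ne_zero _ _)) (Or.inl (Jpow_ne_top _ _))]; exact hx.le
    have h2 : J (x - y) ^ N ≤ b / t := by
      rw [ENNReal.le_div_iff_mul_le (Or.inl ht0) (Or.inl ht), mul_comm]; exact h1
    have h3 := ENNReal.rpow_le_rpow h2 (z := 1/N) (by positivity)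
    rw [← ENNReal.rpow_mul, mul_one_div_cancel hN.ne', ENNReal.rpow_one] at h3
    rw [hρ']; exact h3
  by_cases hne : ∃ x, t < b * J (x - y) ^ (-N)
  · obtain ⟨x0, hx0⟩ := hne
    have hρ1 : 1 ≤ ρ := by
      have := (one_le_J _).trans (key x0 hx0)
      rwa [ENNReal.one_le_ofReal] at this
    have h1 := hG y y 1 ρ one_pos (by linarith) (Metric.ball_subset_ball hρ1)
    rw [ENNReal.ofReal_one, ENNReal.one_rpow, mul_one, mul_one, hρ', ← ENNReal.rpow_mul] at h1
    have e : 1/N * n = p := by rw [← hNp]; field_simp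
    rw [e, ENNReal.div_rpow_of_nonneg _ _ hp.le, div_eq_mul_inv, ← ENNReal.rpow_neg] at h1
    calc _ ≤ bm ω y ρ := by
          rw [bm, ← lintegral_indicator measurableSet_ball]
          refine lintegral_mono fun x => ?_
          by_cases hx : t < b * J (x - y) ^ (-N)
          · have h2 := key x hx
            rw [J, ENNReal.ofReal_le_ofReal_iff (by linarith)] at h2
            rw [indicator_of_mem (by rw [Metric.mem_ball, dist_eq_norm]; linarith), ii_of_lt hx, mul_one]
          · rw [ii_of_le (not_lt.1 hx), mul_zero]; exact zero_le
      _ ≤ _ := h1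
      _ ≤ _ := by gcongr; exact le_self_add
  · push Not at hne
    simp [ii_of_le (hne _)]

lemma levelQ {N p : ℝ} (hN : 0 < N) (hp : 0 < p) (hNp : N * p = n) {K : ℝ≥0∞} (hK : K ≠ ⊤)
    {ω : En n → ℝ≥0∞} (hω : Measurable ω) (hG : Gr n 1 K ω) (hpos : ∀ y, bm ω y 1 ≠ 0)
    {a : En n → ℝ≥0∞} (ha : Measurable a) (t : ℝ≥0∞) (ht0 : t ≠ 0) (ht : t ≠ ⊤) :
    ∫⁻ x, ω x * ∫⁻ y, ii t (a y * J (x - y) ^ (-N)) ≤ (K + 1) * t ^ (-p) * ∫⁻ y, a y ^ p * bm ω y 1 := by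
  have hm : Measurable (fun q : En n × En n => ii t (a q.2 * J (q.1 - q.2) ^ (-N))) :=
    (ii_meas t).comp ((ha.comp measurable_snd).mul (Jsub_meas _))
  have h1 : ∀ x, ω x * ∫⁻ y, ii t (a y * J (x - y) ^ (-N)) = ∫⁻ y, ω x * ii t (a y * J (x - y) ^ (-N)) := by
    intro x
    rw [lintegral_const_mul]
    exact hm.comp measurable_prodMk_left
  simp only [h1]
  rw [lintegral_lintegral_swap ((hω.comp measurable_fst).mul hm).aemeasurable]
  rw [← lintegral_const_mul']
  · refine lintegral_mono fun y => (level hN hp hNp hG hpos y (a y) t ht0 ht).trans (le_of_eq ?_)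
    ring
  · exact ENNReal.mul_ne_top (by finiteness) (ENNReal.rpow_ne_top_of_ne_zero ht0 ht)

lemma dyad (F : ℝ≥0∞) (hF : F ≤ 1) : F ≤ ∑' i : ℕ, (2:ℝ≥0∞) ^ (-(i:ℝ)) * ii (2 ^ (-((i:ℝ)+1))) F := by
  by_cases h0 : F = 0
  · rw [h0]; exact zero_le
  have hFt : F ≠ ⊤ := (hF.trans_lt ENNReal.one_lt_top).ne
  have hr0 : 0 < F.toReal := ENNReal.toReal_pos h0 hFt
  have hr1 : F.toReal ≤ 1 := by
    have := ENNReal.toReal_mono ENNReal.one_ne_top hF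
    simpa using this
  obtain ⟨i, h1, h2⟩ := exists_nat_pow_near (x := F.toReal⁻¹) (y := 2) ((one_le_inv₀ hr0).2 hr1) (by norm_num)
  have e : ∀ k : ℕ, (2:ℝ≥0∞) ^ (-(k:ℝ)) = ENNReal.ofReal ((2:ℝ) ^ k)⁻¹ := by
    intro k
    rw [ENNReal.rpow_neg, ENNReal.rpow_natCast, ENNReal.ofReal_inv_of_pos (by positivity), ENNReal.ofReal_pow (by norm_num)]
    simp
  have hFe : F = ENNReal.ofReal F.toReal := (ENNReal.ofReal_toReal hFt).symm
  have h3 : F ≤ (2:ℝ≥0∞) ^ (-(i:ℝ)) := by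
    rw [e i]
    refine hFe.le.trans (ENNReal.ofReal_le_ofReal ?_)
    rw [le_inv_comm₀ hr0 (by positivity)]; exact h1
  have h4 : (2:ℝ≥0∞) ^ (-((i:ℝ)+1)) < F := by
    have := e (i+1)
    push_cast at this
    rw [this]
    refine lt_of_lt_of_eq ((ENNReal.ofReal_lt_ofReal_iff hr0).2 ?_) hFe.symm
    rw [inv_lt_comm₀ (by positivity) hr0]; exact h2
  calc F ≤ (2:ℝ≥0∞) ^ (-(i:ℝ)) * ii (2 ^ (-((i:ℝ)+1))) F := by rw [ii_of_lt h4, mul_one]; exact h3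
    _ ≤ _ := ENNReal.le_tsum (f := fun i : ℕ => (2:ℝ≥0∞) ^ (-(i:ℝ)) * ii (2 ^ (-((i:ℝ)+1))) F) i

lemma weak_one {N p : ℝ} (hN : 0 < N) (hp : 0 < p) (hp1 : p < 1) (hNp : N * p = n) {K : ℝ≥0∞} (hK : K ≠ ⊤)
    {c : ℝ≥0∞} (hc : c ≠ ⊤) (hc0 : c ≠ 0) :
    ∃ C : ℝ≥0∞, C ≠ ⊤ ∧ ∀ ω : En n → ℝ≥0∞, Measurable ω → Gr n 1 K ω → (∀ y, bm ω y 1 ≠ 0) →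
      ∀ a : En n → ℝ≥0∞, Measurable a → (∀ y y', dist y y' < 1 → a y ≤ c * a y') →
      ∫⁻ x in {x | 1 < Sm N a x}, ω x ≤ C * ∫⁻ y, a y ^ p * ω y := by
  set v := volume (Metric.ball (0 : En n) 1) with hv
  set c' := c * 2 ^ N with hc'
  have hc't : c' ≠ ⊤ := ENNReal.mul_ne_top hc (by finiteness)
  have hc'0 : c' ≠ 0 := mul_ne_zero hc0 (by simp)
  set G := ∑' i : ℕ, (2:ℝ≥0∞) ^ (-(i * (1 - p))) with hG
  have hGt : G ≠ ⊤ := geom_ne_top (by linarith)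
  have hvi : v⁻¹ ≠ ⊤ := ENNReal.inv_ne_top.2 vb_ne_zero
  have hvt : v ≠ ⊤ := vb_ne_top
  refine ⟨(v⁻¹ * ((K+1) * c'⁻¹ ^ (-p)) + (K+1) * 2 ^ p * G) * (c ^ p * v), ?_, ?_⟩
  · have h1 : c'⁻¹ ^ (-p) ≠ ⊤ := ENNReal.rpow_ne_top_of_ne_zero (ENNReal.inv_ne_zero.2 hc't) (ENNReal.inv_ne_top.2 hc'0)
    have h2 : c ^ p ≠ ⊤ := ENNReal.rpow_ne_top_of_nonneg hp.le hc
    have h3 : (2:ℝ≥0∞) ^ p ≠ ⊤ := by finiteness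
    finiteness
  intro ω hω hGr hpos a ha hslow
  have hm : ∀ t, Measurable (fun q : En n × En n => ii t (a q.2 * J (q.1 - q.2) ^ (-N))) := fun t =>
    (ii_meas t).comp ((ha.comp measurable_snd).mul (Jsub_meas _))
  have hmx : ∀ t x, Measurable (fun y => ii t (a y * J (x - y) ^ (-N))) := fun t x =>
    (hm t).comp measurable_prodMk_left
  have hmI : ∀ t, Measurable (fun x => ∫⁻ y, ii t (a y * J (x - y) ^ (-N))) := fun t =>
    Measurable.lintegral_prod_right' (hm t)
  have hmW : ∀ t, Measurable (fun x => ω x * ∫⁻ y, ii t (a y * J (x - y) ^ (-N))) := fun t => hω.mul (hmI t)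
  have pt : ∀ x, 1 < Sm N a x → 1 ≤ v⁻¹ * (∫⁻ y, ii c'⁻¹ (a y * J (x - y) ^ (-N))) +
      ∑' i : ℕ, (2:ℝ≥0∞) ^ (-(i:ℝ)) * ∫⁻ y, ii (2 ^ (-((i:ℝ)+1))) (a y * J (x - y) ^ (-N)) := by
    intro x hx
    by_cases hE : ∃ y, 1 < a y * J (x - y) ^ (-N)
    · obtain ⟨y, hy⟩ := hE
      have : v ≤ ∫⁻ y, ii c'⁻¹ (a y * J (x - y) ^ (-N)) := by
        calc v = ∫⁻ z, (Metric.ball y 1).indicator 1 z := by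
              rw [lintegral_indicator_one measurableSet_ball, vol_ball y one_pos]; simp [hv]
          _ ≤ _ := by
            refine lintegral_mono fun z => ?_
            by_cases hz : z ∈ Metric.ball y 1
            · rw [indicator_of_mem hz, Pi.one_apply, ii_of_lt]
              by_contra hcon
              push Not at hcon
              have h1 : a y ≤ c * a z := hslow y z (by rw [dist_comm]; exact hz)
              have h2 : J (x - y) ^ (-N) ≤ 2 ^ N * J (x - z) ^ (-N) := by
                have h3 := Jneg_shift y z x hN.le
                have h4 : J (y - z) ^ N ≤ 2 ^ N := by
                  apply ENNReal.rpow_le_rpow _ hN.le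
                  have e2 : ENNReal.ofReal (2:ℝ) = 2 := by simp
                  refine le_trans (ENNReal.ofReal_le_ofReal ?_) e2.le
                  rw [Metric.mem_ball, dist_comm, dist_eq_norm] at hz; linarith
                rw [J_sub_comm y x, J_sub_comm z x] at h3
                exact h3.trans (mul_le_mul_left h4 _)
              have h5 : a y * J (x - y) ^ (-N) ≤ 1 := by
                calc _ ≤ (c * a z) * (2 ^ N * J (x - z) ^ (-N)) := mul_le_mul' h1 h2
                  _ = c' * (a z * J (x - z) ^ (-N)) := by rw [hc']; ring
                  _ ≤ c' * c'⁻¹ := mul_le_mul_right hcon _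
                  _ ≤ 1 := ENNReal.mul_inv_le_one _
              exact absurd hy (not_lt.2 h5)
            · rw [indicator_of_notMem hz]; exact zero_le
      calc (1:ℝ≥0∞) = v⁻¹ * v := (ENNReal.inv_mul_cancel vb_ne_zero vb_ne_top).symm
        _ ≤ v⁻¹ * (∫⁻ y, ii c'⁻¹ (a y * J (x - y) ^ (-N))) := mul_le_mul_right this _
        _ ≤ _ := le_self_add
    · push Not at hE
      calc (1:ℝ≥0∞) ≤ Sm N a x := hx.le
        _ ≤ ∫⁻ y, ∑' i : ℕ, (2:ℝ≥0∞) ^ (-(i:ℝ)) * ii (2 ^ (-((i:ℝ)+1))) (a y * J (x - y) ^ (-N)) :=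
            lintegral_mono fun y => dyad _ (hE y)
        _ = ∑' i : ℕ, (2:ℝ≥0∞) ^ (-(i:ℝ)) * ∫⁻ y, ii (2 ^ (-((i:ℝ)+1))) (a y * J (x - y) ^ (-N)) := by
            rw [lintegral_tsum (fun i => ((hmx _ x).const_mul _).aemeasurable)]
            congr 1; ext i
            rw [lintegral_const_mul _ (hmx _ x)]
        _ ≤ _ := le_add_self
  set A := ∫⁻ y, a y ^ p * bm ω y 1 with hA
  have hAle : A ≤ c ^ p * v * ∫⁻ y, a y ^ p * ω y := by
    apply slow_ge hω (by fun_prop) (ENNReal.rpow_ne_top_of_nonneg hp.le hc)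
    intro y y' hy
    rw [← ENNReal.mul_rpow_of_nonneg _ _ hp.le]
    exact ENNReal.rpow_le_rpow (hslow y y' hy) hp.le
  have hQ := fun t ht0 ht => levelQ hN hp hNp hK hω hGr hpos ha t ht0 ht
  have hset : MeasurableSet {x | 1 < Sm N a x} := measurableSet_lt measurable_const (Sm_meas N ha)
  calc ∫⁻ x in {x | 1 < Sm N a x}, ω x
      ≤ ∫⁻ x in {x | 1 < Sm N a x}, ω x * (v⁻¹ * (∫⁻ y, ii c'⁻¹ (a y * J (x - y) ^ (-N))) +
      ∑' i : ℕ, (2:ℝ≥0∞) ^ (-(i:ℝ)) * ∫⁻ y, ii (2 ^ (-((i:ℝ)+1))) (a y * J (x - y) ^ (-N))) := by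
        refine setLIntegral_mono' hset fun x hx => ?_
        calc ω x = ω x * 1 := (mul_one _).symm
          _ ≤ _ := mul_le_mul_right (pt x hx) _
    _ ≤ ∫⁻ x, ω x * (v⁻¹ * (∫⁻ y, ii c'⁻¹ (a y * J (x - y) ^ (-N))) +
      ∑' i : ℕ, (2:ℝ≥0∞) ^ (-(i:ℝ)) * ∫⁻ y, ii (2 ^ (-((i:ℝ)+1))) (a y * J (x - y) ^ (-N))) := setLIntegral_le_lintegral _ _
    _ = v⁻¹ * (∫⁻ x, ω x * ∫⁻ y, ii c'⁻¹ (a y * J (x - y) ^ (-N))) +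
      ∑' i : ℕ, (2:ℝ≥0∞) ^ (-(i:ℝ)) * ∫⁻ x, ω x * ∫⁻ y, ii (2 ^ (-((i:ℝ)+1))) (a y * J (x - y) ^ (-N)) := by
        have e1 : ∀ x, ω x * (v⁻¹ * (∫⁻ y, ii c'⁻¹ (a y * J (x - y) ^ (-N))) +
          ∑' i : ℕ, (2:ℝ≥0∞) ^ (-(i:ℝ)) * ∫⁻ y, ii (2 ^ (-((i:ℝ)+1))) (a y * J (x - y) ^ (-N))) =
          v⁻¹ * (ω x * ∫⁻ y, ii c'⁻¹ (a y * J (x - y) ^ (-N))) +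
          ∑' i : ℕ, (2:ℝ≥0∞) ^ (-(i:ℝ)) * (ω x * ∫⁻ y, ii (2 ^ (-((i:ℝ)+1))) (a y * J (x - y) ^ (-N))) := by
          intro x
          rw [mul_add, ← ENNReal.tsum_mul_left]
          congr 1
          · ring
          · congr 1; ext i; ring
        simp only [e1]
        rw [lintegral_add_left ((hmW _).const_mul _), lintegral_const_mul _ (hmW _),
          lintegral_tsum (fun i => ((hmW _).const_mul _).aemeasurable)]
        congr 2; ext i
        rw [lintegral_const_mul _ (hmW _)]
    _ ≤ v⁻¹ * ((K+1) * c'⁻¹ ^ (-p) * A) + ∑' i : ℕ, (2:ℝ≥0∞) ^ (-(i:ℝ)) * ((K+1) * (2 ^ (-((i:ℝ)+1))) ^ (-p) * A) := by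
        refine add_le_add (mul_le_mul_right (hQ _ (ENNReal.inv_ne_zero.2 hc't) (ENNReal.inv_ne_top.2 hc'0)) _)
          (ENNReal.tsum_le_tsum fun i => mul_le_mul_right (hQ _ ?_ ?_) _)
        · simp
        · finiteness
    _ = (v⁻¹ * ((K+1) * c'⁻¹ ^ (-p)) + (K+1) * 2 ^ p * G) * A := by
        have e3 : ∀ i : ℕ, (2:ℝ≥0∞) ^ (-(i:ℝ)) * ((K+1) * (2 ^ (-((i:ℝ)+1))) ^ (-p) * A) =
            ((K+1) * 2 ^ p * A) * (2:ℝ≥0∞) ^ (-(i * (1 - p))) := by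
          intro i
          have : (2:ℝ≥0∞) ^ (-(i:ℝ)) * (2 ^ (-((i:ℝ)+1))) ^ (-p) = 2 ^ p * (2:ℝ≥0∞) ^ (-(i * (1 - p))) := by
            rw [← ENNReal.rpow_mul, ← ENNReal.rpow_add _ _ (by norm_num) (by norm_num), ← ENNReal.rpow_add _ _ (by norm_num) (by norm_num)]
            congr 1; ring
          calc _ = (K+1) * A * ((2:ℝ≥0∞) ^ (-(i:ℝ)) * (2 ^ (-((i:ℝ)+1))) ^ (-p)) := by ring
            _ = _ := by rw [this]; ring
        simp only [e3]
        rw [ENNReal.tsum_mul_left, ← hG]; ring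
    _ ≤ _ := by
        rw [mul_assoc (_ + _) (c ^ p * v)]
        exact mul_le_mul_right hAle _

end BR


namespace BR
open scoped FourierTransform SchwartzMap Topology
open Filter

variable {n : ℕ}

lemma ofReal_two_pow (j : ℕ) : ENNReal.ofReal ((2:ℝ) ^ j) = 2 ^ (j:ℝ) := by
  rw [ENNReal.ofReal_pow (by norm_num), ENNReal.rpow_natCast]; simp

/-- reverse doubling -/
lemma rev_doubling (hn : 1 ≤ n) {q : ℝ} {K : ℝ≥0∞} (hK : K ≠ ⊤) (hq : 0 ≤ q) :
    ∃ l : ℝ≥0∞, l < 1 ∧ ∀ σ : En n → ℝ≥0∞, Gr n q K σ → (∀ x r, bm σ x r ≠ ⊤) →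
      ∀ x r, 0 < r → bm σ x r ≤ l * bm σ x (2 * r) := by
  set D := K * 4 ^ ((n:ℝ) * q) with hD
  have hDt : D ≠ ⊤ := ENNReal.mul_ne_top hK (by finiteness)
  refine ⟨1 - D⁻¹, ENNReal.sub_lt_self (by simp) (by simp) (ENNReal.inv_ne_zero.2 hDt), ?_⟩
  intro σ hG hfin x r hr
  let e : En n := EuclideanSpace.single (⟨0, hn⟩ : Fin n) (1:ℝ)
  have he : ‖e‖ = 1 := by simp [e]
  set y := x + (3 * r / 2) • e with hy
  have hxy : dist y x = 3 * r / 2 := by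
    rw [dist_eq_norm, hy, add_sub_cancel_left, norm_smul, he, mul_one, Real.norm_eq_abs, abs_of_pos (by positivity)]
  have hsub : Metric.ball y (r/2) ⊆ Metric.ball x (2 * r) := by
    apply Metric.ball_subset_ball'; rw [hxy]; linarith
  have hdisj : Disjoint (Metric.ball x r) (Metric.ball y (r/2)) := by
    apply Metric.ball_disjoint_ball; rw [dist_comm, hxy]; linarith
  have h1 := hG y x (r/2) (2*r) (by positivity) (by positivity) hsub
  have h2 : bm σ x (2*r) ≤ D * bm σ y (r/2) := by
    have e4 : ENNReal.ofReal (2*r) ^ ((n:ℝ) * q) = 4 ^ ((n:ℝ) * q) * ENNReal.ofReal (r/2) ^ ((n:ℝ) * q) := by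
      rw [← ENNReal.mul_rpow_of_nonneg _ _ (by positivity)]
      congr 1
      have : (4:ℝ≥0∞) = ENNReal.ofReal 4 := by simp
      rw [this, ← ENNReal.ofReal_mul (by norm_num)]; congr 1; ring
    have hr0 : ENNReal.ofReal (r/2) ^ ((n:ℝ) * q) ≠ 0 := by
      have : ENNReal.ofReal (r/2) ≠ 0 := by simpa using hr
      simp [this]
    have hrt : ENNReal.ofReal (r/2) ^ ((n:ℝ) * q) ≠ ⊤ := ENNReal.rpow_ne_top_of_nonneg (by positivity) ENNReal.ofReal_ne_top
    rw [e4] at h1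
    rw [← ENNReal.mul_le_mul_iff_right hr0 hrt]
    calc _ = _ := mul_comm _ _
      _ ≤ _ := h1
      _ = _ := by rw [hD]; ring
  have h3 : bm σ x r + bm σ y (r/2) ≤ bm σ x (2*r) := by
    unfold bm
    rw [← lintegral_union measurableSet_ball hdisj]
    exact lintegral_mono_set (union_subset (Metric.ball_subset_ball (by linarith)) hsub)
  have h4 : bm σ x r + D⁻¹ * bm σ x (2*r) ≤ bm σ x (2*r) := by
    refine le_trans (add_le_add le_rfl ?_) h3
    calc D⁻¹ * bm σ x (2*r) ≤ D⁻¹ * (D * bm σ y (r/2)) := mul_le_mul_right h2 _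
      _ = (D⁻¹ * D) * bm σ y (r/2) := by ring
      _ ≤ 1 * bm σ y (r/2) := mul_le_mul_left (ENNReal.inv_mul_le_one _) _
      _ = _ := one_mul _
  by_cases hDi : D⁻¹ = ⊤
  · -- then the mass vanishes
    by_cases h0 : bm σ x (2*r) = 0
    · have : bm σ x r ≤ bm σ x (2*r) := le_trans le_self_add h3
      rw [h0] at this
      exact this.trans zero_le
    · rw [hDi, ENNReal.top_mul h0, add_top] at h4
      exact absurd (top_le_iff.1 h4) (hfin _ _)
  · rw [ENNReal.sub_mul (fun _ _ => hfin _ _), one_mul]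
    exact ENNReal.le_sub_of_add_le_right (ENNReal.mul_ne_top hDi (hfin _ _)) h4

lemma improved (hn : 1 ≤ n) {q : ℝ} (hq : 1 < q) {K : ℝ≥0∞} (hK : K ≠ ⊤) :
    ∃ C τ : ℝ≥0∞, C ≠ ⊤ ∧ τ < 1 ∧ ∀ ω σ : En n → ℝ≥0∞, Wt n q K ω σ →
      ∀ (x y : En n) (j : ℕ), y ∈ Metric.ball x (2 ^ j) →
        bm ω x (2 ^ j) ≤ C * (2:ℝ≥0∞) ^ ((j:ℝ) * ((n:ℝ) * q)) * τ ^ j * bm ω y 1 := by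
  have hq1 : 0 < q - 1 := by linarith
  have hq0 : 0 < q := by linarith
  set v := volume (Metric.ball (0 : En n) 1) with hv
  have hK2 : K ^ (1/(q-1)) * v ^ (-(q/(q-1))) ≠ ⊤ :=
    ENNReal.mul_ne_top (ENNReal.rpow_ne_top_of_nonneg (by positivity) hK) (ENNReal.rpow_ne_top_of_ne_zero vb_ne_zero vb_ne_top)
  obtain ⟨l, hl, hrev⟩ := rev_doubling (n := n) hn hK2 (q := q/(q-1)) (by positivity)
  have hvt : v ^ (-q) ≠ ⊤ := ENNReal.rpow_ne_top_of_ne_zero vb_ne_zero vb_ne_top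
  refine ⟨v ^ (-q) * K * 2 ^ ((n:ℝ) * q), l ^ (q-1), ?_, ENNReal.rpow_lt_one hl hq1, ?_⟩
  · have : (2:ℝ≥0∞) ^ ((n:ℝ) * q) ≠ ⊤ := by finiteness
    finiteness
  intro ω σ h x y j hy
  have hs := h.symm hq
  have hq' : 1 < q/(q-1) := by rw [lt_div_iff₀ hq1]; linarith
  have hr := hrev σ (hs.grow hq') h.finσ
  have hit : ∀ k : ℕ, bm σ y 1 ≤ l ^ k * bm σ y (2 ^ k) := by
    intro k
    induction k with
    | zero => simp
    | succ k ih =>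
      refine ih.trans ?_
      calc l ^ k * bm σ y (2 ^ k) ≤ l ^ k * (l * bm σ y (2 * 2 ^ k)) := mul_le_mul_right (hr y _ (by positivity)) _
        _ = _ := by rw [pow_succ, pow_succ, mul_comm (2 ^ k) (2:ℝ)]; ring
  have hhol : v ^ q ≤ bm ω y 1 * bm σ y 1 ^ (q-1) := by
    have := h.holder hq (volume.restrict (Metric.ball y 1)) Measure.restrict_le_self.absolutelyContinuous 1 measurable_one
    simp only [Pi.one_apply, ENNReal.one_rpow, one_mul, lintegral_const, Measure.restrict_apply MeasurableSet.univ,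
      univ_inter, vol_ball y one_pos, ENNReal.ofReal_one] at this
    exact this
  have hvv : v ^ (-q) * v ^ q = 1 := by
    rw [← ENNReal.rpow_add _ _ vb_ne_zero vb_ne_top]; simp
  have hap := h.ap y (2 ^ (j+1)) (by positivity)
  rw [ofReal_two_pow, ← ENNReal.rpow_mul] at hap
  have hsub : Metric.ball x (2 ^ j) ⊆ Metric.ball y (2 ^ (j+1)) := by
    apply Metric.ball_subset_ball'
    rw [Metric.mem_ball, dist_comm] at hy
    rw [pow_succ]; linarith
  calc bm ω x (2 ^ j) ≤ bm ω y (2 ^ (j+1)) := bm_mono _ hsub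
    _ = v ^ (-q) * (bm ω y (2 ^ (j+1)) * v ^ q) := by
        rw [mul_left_comm, hvv, mul_one]
    _ ≤ v ^ (-q) * (bm ω y (2 ^ (j+1)) * (bm ω y 1 * (l ^ (j+1) * bm σ y (2 ^ (j+1))) ^ (q-1))) := by
        refine mul_le_mul_right (mul_le_mul_right (hhol.trans (mul_le_mul_right ?_ _)) _) _
        exact ENNReal.rpow_le_rpow (hit _) hq1.le
    _ = v ^ (-q) * (bm ω y (2 ^ (j+1)) * bm σ y (2 ^ (j+1)) ^ (q-1)) * (l ^ (j+1)) ^ (q-1) * bm ω y 1 := by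
        rw [ENNReal.mul_rpow_of_nonneg _ _ hq1.le]; ring
    _ ≤ v ^ (-q) * (K * 2 ^ (((j+1 : ℕ):ℝ) * ((n:ℝ) * q))) * (l ^ (q-1)) ^ j * bm ω y 1 := by
        have hl2 : (l ^ (j+1)) ^ (q-1) ≤ (l ^ (q-1)) ^ j := by
          have : (l ^ (j+1)) ^ (q-1) = (l ^ (q-1)) ^ (j+1) := by
            rw [← ENNReal.rpow_natCast, ← ENNReal.rpow_natCast, ← ENNReal.rpow_mul, ← ENNReal.rpow_mul, mul_comm]
          rw [this]
          exact pow_le_pow_right_of_le_one' (ENNReal.rpow_lt_one hl hq1).le (Nat.le_succ j)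
        exact mul_le_mul_left (mul_le_mul' (mul_le_mul_right hap _) hl2) _
    _ = _ := by
        have : (2:ℝ≥0∞) ^ (((j+1 : ℕ):ℝ) * ((n:ℝ) * q)) = 2 ^ ((n:ℝ) * q) * 2 ^ ((j:ℝ) * ((n:ℝ) * q)) := by
          rw [← ENNReal.rpow_add _ _ (by norm_num) (by norm_num)]; congr 1; push_cast; ring
        rw [this]; ring

lemma sum_pow {p : ℝ} (hp : 0 < p) {ρ : ℝ≥0∞} (hρ0 : ρ ≠ 0) (hρ : ρ < 1) :
    ∃ C : ℝ≥0∞, C ≠ ⊤ ∧ ∀ b : ℕ → ℝ≥0∞, (∑' j, b j) ^ p ≤ C * ∑' j, (ρ ^ j)⁻¹ * b j ^ p := by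
  have hρt : ρ ≠ ⊤ := (hρ.trans ENNReal.one_lt_top).ne
  have h1 : ρ ^ (1/p) < 1 := ENNReal.rpow_lt_one hρ (by positivity)
  refine ⟨((1 - ρ ^ (1/p))⁻¹) ^ p, ?_, fun b => ?_⟩
  · apply ENNReal.rpow_ne_top_of_nonneg hp.le
    rw [Ne, ENNReal.inv_eq_top, tsub_eq_zero_iff_le, not_le]; exact h1
  set S := ∑' j, (ρ ^ j)⁻¹ * b j ^ p with hS
  have h2 : ∀ j, b j ≤ (ρ ^ (1/p)) ^ j * S ^ (1/p) := by
    intro j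
    have h3 : (ρ ^ j)⁻¹ * b j ^ p ≤ S := ENNReal.le_tsum (f := fun j => (ρ ^ j)⁻¹ * b j ^ p) j
    have h4 : b j ^ p ≤ ρ ^ j * S := by
      calc b j ^ p = ρ ^ j * ((ρ ^ j)⁻¹ * b j ^ p) := by
            rw [← mul_assoc, ENNReal.mul_inv_cancel (pow_ne_zero _ hρ0) (ENNReal.pow_ne_top hρt), one_mul]
        _ ≤ _ := mul_le_mul_right h3 _
    have h5 := ENNReal.rpow_le_rpow h4 (z := 1/p) (by positivity)
    rw [← ENNReal.rpow_mul, mul_one_div_cancel hp.ne', ENNReal.rpow_one, ENNReal.mul_rpow_of_nonneg _ _ (by positivity)] at h5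
    have : (ρ ^ j) ^ (1/p) = (ρ ^ (1/p)) ^ j := by
      rw [← ENNReal.rpow_natCast, ← ENNReal.rpow_natCast, ← ENNReal.rpow_mul, ← ENNReal.rpow_mul, mul_comm]
    rwa [this] at h5
  calc (∑' j, b j) ^ p ≤ (∑' j : ℕ, (ρ ^ (1/p)) ^ j * S ^ (1/p)) ^ p :=
        ENNReal.rpow_le_rpow (ENNReal.tsum_le_tsum h2) hp.le
    _ = _ := by
      rw [ENNReal.tsum_mul_right, ENNReal.tsum_geometric, ENNReal.mul_rpow_of_nonneg _ _ hp.le, ← ENNReal.rpow_mul,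
        one_div, inv_mul_cancel₀ hp.ne', ENNReal.rpow_one]

end BR


namespace BR
open scoped FourierTransform SchwartzMap Topology
open Filter

variable {n : ℕ}

lemma local_est (hn : 1 ≤ n) {p q : ℝ} (hp : 0 < p) (hpq : p < q) (hq : 1 < q) {K : ℝ≥0∞} (hK : K ≠ ⊤)
    {c : ℝ≥0∞} (hc : c ≠ ⊤) :
    ∃ C g : ℝ≥0∞, C ≠ ⊤ ∧ g < 1 ∧ ∀ ω σ : En n → ℝ≥0∞, Wt n q K ω σ →
      ∀ a : En n → ℝ≥0∞, Measurable a → (∀ y y', dist y y' < 1 → a y ≤ c * a y') →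
      ∀ (x : En n) (j : ℕ), bm a x (2 ^ j) ^ p ≤
        C * g ^ j * ((2:ℝ≥0∞) ^ ((j:ℝ) * ((n:ℝ) * q)) * bm (fun y => a y ^ p * ω y) x (2 ^ (j+1)) * (bm ω x (2 ^ j))⁻¹) := by
  have hq1 : 0 < q - 1 := by linarith
  have hq0 : 0 < q := by linarith
  have hqp : 0 < q - p := by linarith
  obtain ⟨C1, τ, hC1, hτ, himp⟩ := improved hn hq hK
  set C2 := C1 * c ^ p with hC2
  have hC2t : C2 ≠ ⊤ := ENNReal.mul_ne_top hC1 (ENNReal.rpow_ne_top_of_nonneg hp.le hc)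
  refine ⟨C2 ^ ((q-p)/q) * K ^ (p/q), τ ^ ((q-p)/q), ?_, ENNReal.rpow_lt_one hτ (by positivity), ?_⟩
  · exact ENNReal.mul_ne_top (ENNReal.rpow_ne_top_of_nonneg (by positivity) hC2t) (ENNReal.rpow_ne_top_of_nonneg (by positivity) hK)
  intro ω σ h a ha hslow x j
  have hmω := h.mω
  set I := bm (fun y => a y ^ p * ω y) x (2 ^ (j+1)) with hI
  set w := bm ω x (2 ^ j) with hw
  have hw0 : w ≠ 0 := h.pos hq x (by positivity)
  have hwt : w ≠ ⊤ := h.fin _ _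
  set P := (2:ℝ≥0∞) ^ ((j:ℝ) * ((n:ℝ) * q)) with hP
  set X := P * I * w⁻¹ with hX
  have hM : ∀ y ∈ Metric.ball x (2 ^ j), a y ^ p ≤ C2 * τ ^ j * X := by
    intro y hy
    have h1 : a y ^ p * bm ω y 1 ≤ c ^ p * I := by
      rw [bm, ← lintegral_const_mul _ hmω]
      calc ∫⁻ z in Metric.ball y 1, a y ^ p * ω z ≤ ∫⁻ z in Metric.ball y 1, c ^ p * (a z ^ p * ω z) := by
            refine setLIntegral_mono' measurableSet_ball fun z hz => ?_
            rw [← mul_assoc, ← ENNReal.mul_rpow_of_nonneg _ _ hp.le]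
            gcongr
            exact hslow y z (by rw [dist_comm]; exact hz)
        _ = c ^ p * bm (fun y => a y ^ p * ω y) y 1 := by rw [lintegral_const_mul _ (by fun_prop)]; rfl
        _ ≤ _ := by
            refine mul_le_mul_right (bm_mono _ (Metric.ball_subset_ball' ?_)) _
            rw [Metric.mem_ball] at hy
            have : (1:ℝ) ≤ 2 ^ j := one_le_pow₀ (by norm_num)
            rw [pow_succ]; linarith
    have h2 := himp ω σ h x y j hy
    calc a y ^ p = a y ^ p * w * w⁻¹ := by rw [mul_assoc, ENNReal.mul_inv_cancel hw0 hwt, mul_one]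
      _ ≤ a y ^ p * (C1 * P * τ ^ j * bm ω y 1) * w⁻¹ := mul_le_mul_left (mul_le_mul_right h2 _) _
      _ = C1 * P * τ ^ j * (a y ^ p * bm ω y 1) * w⁻¹ := by ring
      _ ≤ C1 * P * τ ^ j * (c ^ p * I) * w⁻¹ := mul_le_mul_left (mul_le_mul_right h1 _) _
      _ = _ := by rw [hC2, hX]; ring
  set M := C2 * τ ^ j * X with hMdef
  have hol := h.holder hq (volume.restrict (Metric.ball x (2 ^ j))) Measure.restrict_le_self.absolutelyContinuous a ha
  have h3 : ∫⁻ y in Metric.ball x (2 ^ j), a y ^ q * ω y ≤ M ^ ((q-p)/p) * I := by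
    calc _ ≤ ∫⁻ y in Metric.ball x (2 ^ j), M ^ ((q-p)/p) * (a y ^ p * ω y) := by
          refine setLIntegral_mono' measurableSet_ball fun y hy => ?_
          have : a y ^ q = (a y ^ p) ^ ((q-p)/p) * a y ^ p := by
            rw [← ENNReal.rpow_mul, ← ENNReal.rpow_add_of_nonneg _ _ (by positivity) hp.le]
            congr 1; field_simp; ring
          rw [this, mul_assoc]
          exact mul_le_mul_left (ENNReal.rpow_le_rpow (hM y hy) (by positivity)) _
      _ = M ^ ((q-p)/p) * bm (fun y => a y ^ p * ω y) x (2 ^ j) := by rw [lintegral_const_mul _ (by fun_prop)]; rfl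
      _ ≤ _ := mul_le_mul_right (bm_mono _ (Metric.ball_subset_ball (pow_le_pow_right₀ (by norm_num) (Nat.le_succ j)))) _
  have h4 : (∫⁻ y in Metric.ball x (2 ^ j), σ y) ^ (q-1) ≤ K * P * w⁻¹ := by
    have := h.ap x (2 ^ j) (by positivity)
    rw [ofReal_two_pow, ← ENNReal.rpow_mul] at this
    calc _ = w⁻¹ * (w * bm σ x (2 ^ j) ^ (q-1)) := by rw [← mul_assoc, ENNReal.inv_mul_cancel hw0 hwt, one_mul]; rfl
      _ ≤ w⁻¹ * (K * P) := mul_le_mul_right this _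
      _ = _ := mul_comm _ _
  have h5 : bm a x (2 ^ j) ^ q ≤ M ^ ((q-p)/p) * (K * X) := by
    calc _ ≤ _ := hol
      _ ≤ (M ^ ((q-p)/p) * I) * (K * P * w⁻¹) := mul_le_mul' h3 h4
      _ = _ := by rw [hX]; ring
  clear_value M X
  have h6 := ENNReal.rpow_le_rpow h5 (z := p/q) (by positivity)
  rw [← ENNReal.rpow_mul, ENNReal.mul_rpow_of_nonneg _ _ (by positivity), ← ENNReal.rpow_mul,
    ENNReal.mul_rpow_of_nonneg _ _ (by positivity), hMdef, ENNReal.mul_rpow_of_nonneg _ _ (by positivity),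
    ENNReal.mul_rpow_of_nonneg _ _ (by positivity)] at h6
  have e1 : q * (p/q) = p := by field_simp
  have e2 : (q-p)/p * (p/q) = (q-p)/q := by field_simp
  have e3 : (τ ^ j) ^ ((q-p)/q) = (τ ^ ((q-p)/q)) ^ j := by
    rw [← ENNReal.rpow_natCast, ← ENNReal.rpow_natCast, ← ENNReal.rpow_mul, ← ENNReal.rpow_mul, mul_comm]
  have e4 : X ^ ((q-p)/q) * X ^ (p/q) = X := by
    rw [← ENNReal.rpow_add_of_nonneg _ _ (by positivity) (by positivity)]
    have : (q-p)/q + p/q = 1 := by field_simp; ring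
    rw [this, ENNReal.rpow_one]
  rw [e1, e2, e3] at h6
  refine h6.trans (le_of_eq ?_)
  calc _ = C2 ^ ((q-p)/q) * K ^ (p/q) * (τ ^ ((q-p)/q)) ^ j * (X ^ ((q-p)/q) * X ^ (p/q)) := by ring
    _ = _ := by rw [e4]

lemma avg_ratio {q : ℝ} (hq : 1 < q) {K : ℝ≥0∞} {ω σ : En n → ℝ≥0∞} (h : Wt n q K ω σ) (y : En n) (j : ℕ) :
    bm (fun x => ω x * (bm ω x (2 ^ j))⁻¹) y (2 ^ (j+1)) ≤
      K * (volume (Metric.ball (0 : En n) 1)) ^ (-q) * 4 ^ ((n:ℝ) * q) := by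
  set K1 := K * (volume (Metric.ball (0 : En n) 1)) ^ (-q) with hK1
  have hg := h.grow hq
  have hmω := h.mω
  set B := bm ω y (2 ^ (j+2)) with hB
  have hB0 : B ≠ 0 := h.pos hq y (by positivity)
  have hBt : B ≠ ⊤ := h.fin _ _
  set D := K1 * 4 ^ ((n:ℝ) * q) with hD
  have key : ∀ x ∈ Metric.ball y (2 ^ (j+1)), (bm ω x (2 ^ j))⁻¹ ≤ D * B⁻¹ := by
    intro x hx
    have hw0 : bm ω x (2 ^ j) ≠ 0 := h.pos hq x (by positivity)
    have hwt : bm ω x (2 ^ j) ≠ ⊤ := h.fin _ _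
    have hsub : Metric.ball x (2 ^ j) ⊆ Metric.ball y (2 ^ (j+2)) := by
      apply Metric.ball_subset_ball'
      rw [Metric.mem_ball] at hx
      have : (0:ℝ) < 2 ^ j := by positivity
      rw [pow_succ] at hx
      rw [pow_add]; linarith
    have h1 := hg x y (2 ^ j) (2 ^ (j+2)) (by positivity) (by positivity) hsub
    have e4 : ENNReal.ofReal ((2:ℝ) ^ (j+2)) ^ ((n:ℝ) * q) = 4 ^ ((n:ℝ) * q) * ENNReal.ofReal ((2:ℝ) ^ j) ^ ((n:ℝ) * q) := by
      rw [← ENNReal.mul_rpow_of_nonneg _ _ (by positivity)]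
      congr 1
      have : (4:ℝ≥0∞) = ENNReal.ofReal 4 := by simp
      rw [this, ← ENNReal.ofReal_mul (by norm_num)]; congr 1; ring
    have hr0 : ENNReal.ofReal ((2:ℝ) ^ j) ^ ((n:ℝ) * q) ≠ 0 := by
      rw [ofReal_two_pow]; simp
    have hrt : ENNReal.ofReal ((2:ℝ) ^ j) ^ ((n:ℝ) * q) ≠ ⊤ := ENNReal.rpow_ne_top_of_nonneg (by positivity) ENNReal.ofReal_ne_top
    have h2 : B ≤ D * bm ω x (2 ^ j) := by
      rw [← ENNReal.mul_le_mul_iff_right hr0 hrt]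
      calc _ = _ := mul_comm _ _
        _ ≤ _ := h1
        _ = _ := by rw [e4, hD]; ring
    calc (bm ω x (2 ^ j))⁻¹ = (bm ω x (2 ^ j))⁻¹ * (B * B⁻¹) := by rw [ENNReal.mul_inv_cancel hB0 hBt, mul_one]
      _ ≤ (bm ω x (2 ^ j))⁻¹ * ((D * bm ω x (2 ^ j)) * B⁻¹) := by gcongr
      _ = (bm ω x (2 ^ j) * (bm ω x (2 ^ j))⁻¹) * (D * B⁻¹) := by ring
      _ = _ := by rw [ENNReal.mul_inv_cancel hw0 hwt, one_mul]
  calc _ ≤ ∫⁻ x in Metric.ball y (2 ^ (j+1)), ω x * (D * B⁻¹) :=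
        setLIntegral_mono' measurableSet_ball fun x hx => mul_le_mul_right (key x hx) _
    _ = bm ω y (2 ^ (j+1)) * (D * B⁻¹) := by rw [lintegral_mul_const _ hmω]; rfl
    _ ≤ B * (D * B⁻¹) := mul_le_mul_left (bm_mono _ (Metric.ball_subset_ball (pow_le_pow_right₀ (by norm_num) (by omega)))) _
    _ = (B * B⁻¹) * D := by ring
    _ = D := by rw [ENNReal.mul_inv_cancel hB0 hBt, one_mul]

lemma strong (hn : 1 ≤ n) {N p q : ℝ} (hN : 0 < N) (hp : 0 < p) (hpq : p < q) (hq : 1 < q) (hNp : N * p = n * q)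
    {K : ℝ≥0∞} (hK : K ≠ ⊤) {c : ℝ≥0∞} (hc : c ≠ ⊤) :
    ∃ C : ℝ≥0∞, C ≠ ⊤ ∧ ∀ ω σ : En n → ℝ≥0∞, Wt n q K ω σ →
      ∀ a : En n → ℝ≥0∞, Measurable a → (∀ y y', dist y y' < 1 → a y ≤ c * a y') →
      ∫⁻ x, Sm N a x ^ p * ω x ≤ C * ∫⁻ y, a y ^ p * ω y := by
  obtain ⟨C1, g, hC1, hg, hloc⟩ := local_est hn hp hpq hq hK hc
  set ρ : ℝ≥0∞ := max (g ^ (1/2:ℝ)) 2⁻¹ with hρ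
  have hρ1 : ρ < 1 := max_lt (ENNReal.rpow_lt_one hg (by norm_num)) (by norm_num)
  have hρ0 : ρ ≠ 0 := (lt_of_lt_of_le (by simp) (le_max_right _ _)).ne'
  have hρt : ρ ≠ ⊤ := (hρ1.trans ENNReal.one_lt_top).ne
  have hgρ : g ≤ ρ * ρ := by
    calc g = g ^ (1/2:ℝ) * g ^ (1/2:ℝ) := by
          rw [← ENNReal.rpow_add_of_nonneg _ _ (by norm_num) (by norm_num)]; norm_num
      _ ≤ _ := mul_le_mul' (le_max_left _ _) (le_max_left _ _)
  obtain ⟨C2, hC2, hsum⟩ := sum_pow hp hρ0 hρ1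
  set D := K * (volume (Metric.ball (0 : En n) 1)) ^ (-q) * 4 ^ ((n:ℝ) * q) with hD
  have hDt : D ≠ ⊤ := ENNReal.mul_ne_top (ENNReal.mul_ne_top hK (ENNReal.rpow_ne_top_of_ne_zero vb_ne_zero vb_ne_top)) (by finiteness)
  have hgeo : (1 - ρ)⁻¹ ≠ ⊤ := by
    rw [Ne, ENNReal.inv_eq_top, tsub_eq_zero_iff_le, not_le]; exact hρ1
  have h2N : ((2:ℝ≥0∞) ^ N) ^ p ≠ ⊤ := by finiteness
  refine ⟨(2 ^ N) ^ p * C2 * C1 * ((1 - ρ)⁻¹ * D), by finiteness, ?_⟩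
  intro ω σ h a ha hslow
  have hmω := h.mω
  have hI := fun j : ℕ => bm_meas (ω := fun y => a y ^ p * ω y) (by fun_prop) (2 ^ (j+1))
  have hw := fun j : ℕ => bm_meas hmω (2 ^ j)
  have pt : ∀ x, Sm N a x ^ p ≤ (2 ^ N) ^ p * C2 * C1 * ∑' j : ℕ, ρ ^ j *
      (bm (fun y => a y ^ p * ω y) x (2 ^ (j+1)) * (bm ω x (2 ^ j))⁻¹) := by
    intro x
    calc Sm N a x ^ p ≤ (2 ^ N * ∑' j : ℕ, (2:ℝ≥0∞) ^ (-(j * N)) * bm a x (2 ^ j)) ^ p :=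
          ENNReal.rpow_le_rpow (shell_int N hN.le x a ha) hp.le
      _ = (2 ^ N) ^ p * (∑' j : ℕ, (2:ℝ≥0∞) ^ (-(j * N)) * bm a x (2 ^ j)) ^ p := ENNReal.mul_rpow_of_nonneg _ _ hp.le
      _ ≤ (2 ^ N) ^ p * (C2 * ∑' j : ℕ, (ρ ^ j)⁻¹ * ((2:ℝ≥0∞) ^ (-(j * N)) * bm a x (2 ^ j)) ^ p) := mul_le_mul_right (hsum _) _
      _ ≤ (2 ^ N) ^ p * (C2 * ∑' j : ℕ, C1 * (ρ ^ j *
          (bm (fun y => a y ^ p * ω y) x (2 ^ (j+1)) * (bm ω x (2 ^ j))⁻¹))) := by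
          refine mul_le_mul_right (mul_le_mul_right (ENNReal.tsum_le_tsum fun j => ?_) _) _
          set I := bm (fun y => a y ^ p * ω y) x (2 ^ (j+1))
          set w := bm ω x (2 ^ j)
          have hP : ((2:ℝ≥0∞) ^ (-(j * N))) ^ p * (2:ℝ≥0∞) ^ ((j:ℝ) * ((n:ℝ) * q)) = 1 := by
            rw [← ENNReal.rpow_mul, ← ENNReal.rpow_add _ _ (by norm_num) (by norm_num), ← hNp]
            have : -((j:ℝ) * N) * p + j * (N * p) = 0 := by ring
            rw [this, ENNReal.rpow_zero]
          have hgj : (ρ ^ j)⁻¹ * g ^ j ≤ ρ ^ j := by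
            calc (ρ ^ j)⁻¹ * g ^ j ≤ (ρ ^ j)⁻¹ * (ρ * ρ) ^ j := by gcongr
              _ = ((ρ ^ j)⁻¹ * ρ ^ j) * ρ ^ j := by rw [mul_pow]; ring
              _ = _ := by rw [ENNReal.inv_mul_cancel (pow_ne_zero _ hρ0) (ENNReal.pow_ne_top hρt), one_mul]
          rw [ENNReal.mul_rpow_of_nonneg _ _ hp.le]
          calc _ ≤ (ρ ^ j)⁻¹ * (((2:ℝ≥0∞) ^ (-(j * N))) ^ p * (C1 * g ^ j * ((2:ℝ≥0∞) ^ ((j:ℝ) * ((n:ℝ) * q)) * I * w⁻¹))) :=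
                mul_le_mul_right (mul_le_mul_right (hloc ω σ h a ha hslow x j) _) _
            _ = (((2:ℝ≥0∞) ^ (-(j * N))) ^ p * (2:ℝ≥0∞) ^ ((j:ℝ) * ((n:ℝ) * q))) * (C1 * (((ρ ^ j)⁻¹ * g ^ j) * (I * w⁻¹))) := by ring
            _ ≤ 1 * (C1 * (ρ ^ j * (I * w⁻¹))) := by
                rw [hP]
                exact mul_le_mul_right (mul_le_mul_right (mul_le_mul_left hgj _) _) _
            _ = _ := one_mul _
      _ = _ := by rw [ENNReal.tsum_mul_left]; ring
  have hterm : ∀ j : ℕ, Measurable (fun x => bm (fun y => a y ^ p * ω y) x (2 ^ (j+1)) * (bm ω x (2 ^ j))⁻¹ * ω x) := fun j =>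
    ((hI j).mul (hw j).inv).mul hmω
  have hj : ∀ j : ℕ, ∫⁻ x, bm (fun y => a y ^ p * ω y) x (2 ^ (j+1)) * (bm ω x (2 ^ j))⁻¹ * ω x ≤ D * ∫⁻ y, a y ^ p * ω y := by
    intro j
    have e := bm_swap (ω := fun y => a y ^ p * ω y) (F := fun x => ω x * (bm ω x (2 ^ j))⁻¹) (by fun_prop)
      (hmω.mul (hw j).inv) (2 ^ (j+1))
    calc _ = ∫⁻ x, ω x * (bm ω x (2 ^ j))⁻¹ * bm (fun y => a y ^ p * ω y) x (2 ^ (j+1)) :=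
          lintegral_congr fun x => by ring
      _ = _ := e
      _ ≤ ∫⁻ x, (a x ^ p * ω x) * D := lintegral_mono fun x => mul_le_mul_right (avg_ratio hq h x j) _
      _ = _ := by rw [lintegral_mul_const _ (by fun_prop), mul_comm]
  calc ∫⁻ x, Sm N a x ^ p * ω x
      ≤ ∫⁻ x, (2 ^ N) ^ p * C2 * C1 * ∑' j : ℕ, ρ ^ j *
        (bm (fun y => a y ^ p * ω y) x (2 ^ (j+1)) * (bm ω x (2 ^ j))⁻¹ * ω x) := by
        refine lintegral_mono fun x => (mul_le_mul_left (pt x) _).trans (le_of_eq ?_)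
        rw [mul_assoc (_ * C1), ← ENNReal.tsum_mul_right]
        congr 2; ext j; ring
    _ = (2 ^ N) ^ p * C2 * C1 * ∑' j : ℕ, ρ ^ j * ∫⁻ x, bm (fun y => a y ^ p * ω y) x (2 ^ (j+1)) * (bm ω x (2 ^ j))⁻¹ * ω x := by
        rw [lintegral_const_mul' _ _ (by finiteness), lintegral_tsum (fun j => ((hterm j).const_mul _).aemeasurable)]
        congr 2; ext j
        rw [lintegral_const_mul _ (hterm j)]
    _ ≤ (2 ^ N) ^ p * C2 * C1 * ∑' j : ℕ, ρ ^ j * (D * ∫⁻ y, a y ^ p * ω y) :=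
        mul_le_mul_right (ENNReal.tsum_le_tsum fun j => mul_le_mul_right (hj j) _) _
    _ = _ := by rw [ENNReal.tsum_mul_right, ENNReal.tsum_geometric]; ring

end BR


namespace BR
open scoped FourierTransform SchwartzMap Topology
open Filter

variable {n : ℕ}

lemma vball_ne_zero (x : En n) {r : ℝ} (hr : 0 < r) : volume (Metric.ball x r) ≠ 0 := (Metric.measure_ball_pos _ _ hr).ne'
lemma vball_ne_top (x : En n) (r : ℝ) : volume (Metric.ball x r) ≠ ⊤ := measure_ball_lt_top.ne

lemma bm_eq_avg (ω : En n → ℝ≥0∞) (x : En n) {r : ℝ} (hr : 0 < r) :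
    bm ω x r = volume (Metric.ball x r) * ballAvg n ω x r := by
  rw [ballAvg, ← mul_assoc, ENNReal.mul_inv_cancel (vball_ne_zero x hr) (vball_ne_top x r), one_mul]; rfl

lemma ap_bm {s : ℝ} (hs : 1 < s) {C : ℝ≥0∞} {ω σ : En n → ℝ≥0∞} {x : En n} {r : ℝ} (hr : 0 < r)
    (h : ballAvg n ω x r * (ballAvg n σ x r) ^ (s - 1) ≤ C) :
    bm ω x r * (bm σ x r) ^ (s - 1) ≤ (C * volume (Metric.ball (0 : En n) 1) ^ s) * ENNReal.ofReal r ^ ((n:ℝ) * s) := by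
  have hs1 : 0 < s - 1 := by linarith
  have e : volume (Metric.ball x r) * volume (Metric.ball x r) ^ (s-1) = volume (Metric.ball (0 : En n) 1) ^ s * ENNReal.ofReal r ^ ((n:ℝ) * s) := by
    have : volume (Metric.ball x r) * volume (Metric.ball x r) ^ (s-1) = volume (Metric.ball x r) ^ s := by
      nth_rw 1 [← ENNReal.rpow_one (volume (Metric.ball x r))]
      rw [← ENNReal.rpow_add_of_nonneg _ _ (by norm_num) hs1.le]; congr 1; ring
    rw [this, vol_ball x hr, ENNReal.mul_rpow_of_nonneg _ _ (by linarith), ← ENNReal.rpow_mul, mul_comm]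
  rw [bm_eq_avg ω x hr, bm_eq_avg σ x hr, ENNReal.mul_rpow_of_nonneg _ _ hs1.le]
  calc _ = (volume (Metric.ball x r) * volume (Metric.ball x r) ^ (s-1)) * (ballAvg n ω x r * ballAvg n σ x r ^ (s-1)) := by ring
    _ ≤ (volume (Metric.ball x r) * volume (Metric.ball x r) ^ (s-1)) * C := mul_le_mul_right h _
    _ = _ := by rw [e]; ring

lemma ae_of_balls {P : En n → Prop} (h : ∀ k : ℕ, ∀ᵐ x ∂(volume.restrict (Metric.ball (0 : En n) (k+1))), P x) : ∀ᵐ x, P x := by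
  have h' : ∀ k : ℕ, ∀ᵐ x : En n, x ∈ Metric.ball (0 : En n) (k+1) → P x := fun k =>
    (ae_restrict_iff' measurableSet_ball).1 (h k)
  filter_upwards [ae_all_iff.2 h'] with x hx
  obtain ⟨k, hk⟩ := exists_nat_gt ‖x‖
  exact hx k (by rw [Metric.mem_ball, dist_zero_right]; linarith)

lemma wt_of_ap {s : ℝ} (hs : 1 < s) {ω : En n → ℝ≥0∞} (hω : Measurable ω)
    (hloc : ∀ (x : En n) (r : ℝ), 0 < r → (∫⁻ y in Metric.ball x r, ω y) < ⊤) (h : IsApGT1 n s ω) :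
    (∀ᵐ x, ω x = 0) ∨ ∃ K : ℝ≥0∞, K ≠ ⊤ ∧ Wt n s K ω (fun y => ω y ^ (1/(1-s))) := by
  have hs1 : 0 < s - 1 := by linarith
  obtain ⟨C, hC, hap⟩ := h
  set σ : En n → ℝ≥0∞ := fun y => ω y ^ (1/(1-s)) with hσ
  have hmσ : Measurable σ := by fun_prop
  have hK : C * volume (Metric.ball (0 : En n) 1) ^ s ≠ ⊤ :=
    ENNReal.mul_ne_top hC.ne (ENNReal.rpow_ne_top_of_nonneg (by linarith) vb_ne_top)
  have hap' := fun x r (hr : 0 < r) => ap_bm hs hr (hap x r hr)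
  have hfin : ∀ x r, bm ω x r ≠ ⊤ := by
    intro x r
    rcases lt_or_ge 0 r with hr | hr
    · exact (hloc x r hr).ne
    · rw [bm, Metric.ball_eq_empty.2 hr]; simp
  have hfinσ : ∀ x r, bm ω x r ≠ 0 → bm σ x r ≠ ⊤ := by
    intro x r h0 ht
    have hr : 0 < r := by
      by_contra hr
      apply h0
      rw [bm, Metric.ball_eq_empty.2 (not_lt.1 hr)]; simp
    have h1 := hap' x r hr
    rw [ht, ENNReal.top_rpow_of_pos hs1, ENNReal.mul_top h0] at h1
    exact (ENNReal.mul_ne_top hK (ENNReal.rpow_ne_top_of_nonneg (by positivity) ENNReal.ofReal_ne_top)) (top_le_iff.1 h1)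
  by_cases hz : ∀ᵐ x, ω x = 0
  · exact Or.inl hz
  right
  -- some ball has positive mass
  have hex : ∃ k : ℕ, bm ω 0 (k+1) ≠ 0 := by
    by_contra hcon
    push Not at hcon
    apply hz
    apply ae_of_balls
    intro k
    have := hcon k
    rw [bm, lintegral_eq_zero_iff hω] at this
    exact this
  obtain ⟨k0, hk0⟩ := hex
  have hne0 : ∀ᵐ x, ω x ≠ 0 := by
    apply ae_of_balls
    intro k
    have hb : bm ω 0 ((k + k0 : ℕ) + 1) ≠ 0 := by
      intro h0
      apply hk0
      have : bm ω 0 (k0+1) ≤ bm ω 0 ((k + k0 : ℕ) + 1) := by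
        apply bm_mono; apply Metric.ball_subset_ball; push_cast; linarith [(Nat.cast_nonneg k : (0:ℝ) ≤ k)]
      rw [h0] at this; exact le_antisymm this zero_le
    have hf := hfinσ _ _ hb
    have h1 := ae_lt_top' hmσ.aemeasurable (μ := volume.restrict (Metric.ball (0 : En n) ((k + k0 : ℕ) + 1))) hf
    have h2 : Metric.ball (0 : En n) (k+1) ⊆ Metric.ball (0 : En n) ((k + k0 : ℕ) + 1) := by
      apply Metric.ball_subset_ball; push_cast; linarith [(Nat.cast_nonneg k0 : (0:ℝ) ≤ k0)]
    have h3 := ae_restrict_of_ae_restrict_of_subset h2 h1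
    filter_upwards [h3] with x hx h0
    have : σ x = ⊤ := by
      show ω x ^ (1/(1-s)) = ⊤
      rw [h0, ENNReal.zero_rpow_of_neg]
      rw [one_div, inv_lt_zero]; linarith
    exact absurd this hx.ne
  have hnet : ∀ᵐ x, ω x ≠ ⊤ := by
    apply ae_of_balls
    intro k
    filter_upwards [ae_lt_top' hω.aemeasurable (μ := volume.restrict (Metric.ball (0 : En n) (k+1))) (hfin _ _)] with x hx using hx.ne
  have hpos : ∀ x r, 0 < r → bm ω x r ≠ 0 := by
    intro x r hr h0
    rw [bm, setLIntegral_eq_zero_iff measurableSet_ball hω] at h0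
    have : ∀ᵐ z, z ∉ Metric.ball x r := by
      filter_upwards [h0, hne0] with z hz h1 h2 using h1 (hz h2)
    have h3 : volume (Metric.ball x r) = 0 := by
      rw [← compl_compl (Metric.ball x r)]; exact this
    exact vball_ne_zero x hr h3
  refine ⟨_, hK, hω, hmσ, hfin, ?_, ?_, hap'⟩
  · intro x r
    rcases lt_or_ge 0 r with hr | hr
    · exact hfinσ x r (hpos x r hr)
    · rw [bm, Metric.ball_eq_empty.2 hr]; simp
  · filter_upwards [hne0, hnet] with x h0 ht
    show ω x * (ω x ^ (1/(1-s))) ^ (s-1) = 1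
    rw [← ENNReal.rpow_mul]
    have : 1/(1-s) * (s-1) = -1 := by
      have : 1 - s ≠ 0 := by linarith
      field_simp; ring
    rw [this, ENNReal.rpow_neg_one, ENNReal.mul_inv_cancel h0 ht]

lemma ap2_of_a1 {ω : En n → ℝ≥0∞} (h : IsA1 n ω) : IsApGT1 n 2 ω := by
  obtain ⟨C, hC, h⟩ := h
  refine ⟨C, hC, fun x r hr => le_trans (mul_le_mul_right ?_ _) (h x r hr)⟩
  have e1 : (2:ℝ) - 1 = 1 := by norm_num
  have e2 : 1 / (1 - (2:ℝ)) = -1 := by norm_num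
  rw [e1, ENNReal.rpow_one, e2]
  simp only [ENNReal.rpow_neg_one]
  rw [ballAvg]
  set M := essSup (fun y => (ω y)⁻¹) (volume.restrict (Metric.ball x r)) with hM
  calc _ ≤ (volume (Metric.ball x r))⁻¹ * ∫⁻ y in Metric.ball x r, M :=
        mul_le_mul_right (lintegral_mono_ae (ENNReal.ae_le_essSup _)) _
    _ = ((volume (Metric.ball x r))⁻¹ * volume (Metric.ball x r)) * M := by rw [setLIntegral_const]; ring
    _ ≤ 1 * M := mul_le_mul_left (ENNReal.inv_mul_le_one _) _
    _ = M := one_mul _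

lemma gr_of_a1 {ω : En n → ℝ≥0∞} (hω : Measurable ω) (hnet : ∀ᵐ x, ω x ≠ ⊤) (hpos : ∀ x r, 0 < r → bm ω x r ≠ 0)
    (h : IsA1 n ω) : ∃ K : ℝ≥0∞, K ≠ ⊤ ∧ Gr n 1 K ω := by
  obtain ⟨C, hC, h⟩ := h
  refine ⟨C, hC.ne, fun x y r R hr hR hsub => ?_⟩
  set v := volume (Metric.ball (0 : En n) 1) with hv
  set M := essSup (fun y => (ω y)⁻¹) (volume.restrict (Metric.ball y R)) with hM
  have hMt : M ≠ ⊤ := by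
    intro ht
    have h1 := h y R hR
    rw [← hM, ht, ENNReal.mul_top] at h1
    · exact hC.ne (top_le_iff.1 h1)
    · intro h0
      apply hpos y R hR
      rw [bm_eq_avg ω y hR, h0, mul_zero]
  have h1 : volume (Metric.ball x r) ≤ M * bm ω x r := by
    rw [bm, ← lintegral_const_mul _ hω]
    have hae : ∀ᵐ z ∂(volume.restrict (Metric.ball x r)), 1 ≤ M * ω z := by
      have := ae_restrict_of_ae_restrict_of_subset hsub (ENNReal.ae_le_essSup (μ := volume.restrict (Metric.ball y R)) (fun y => (ω y)⁻¹))
      filter_upwards [this, ae_restrict_of_ae hnet] with z hz hzt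
      have h0 : ω z ≠ 0 := by
        intro h0
        rw [h0, ENNReal.inv_zero] at hz
        exact hMt (top_le_iff.1 hz)
      calc (1:ℝ≥0∞) = (ω z)⁻¹ * ω z := (ENNReal.inv_mul_cancel h0 hzt).symm
        _ ≤ _ := mul_le_mul_left hz _
    calc volume (Metric.ball x r) = ∫⁻ z in Metric.ball x r, 1 := by simp
      _ ≤ _ := lintegral_mono_ae hae
  have h2 : bm ω y R * M ≤ C * volume (Metric.ball y R) := by
    rw [bm_eq_avg ω y hR, mul_assoc, mul_comm C]
    exact mul_le_mul_right (h y R hR) _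
  rw [mul_one]
  have h3 : bm ω y R * volume (Metric.ball x r) ≤ C * volume (Metric.ball y R) * bm ω x r := by
    calc _ ≤ bm ω y R * (M * bm ω x r) := mul_le_mul_right h1 _
      _ = bm ω y R * M * bm ω x r := by ring
      _ ≤ _ := mul_le_mul_left h2 _
  rw [vol_ball x hr, vol_ball y hR] at h3
  rw [← ENNReal.mul_le_mul_iff_right (vb_ne_zero (n := n)) vb_ne_top]
  calc _ = bm ω y R * (ENNReal.ofReal r ^ (n:ℝ) * v) := by ring
    _ ≤ _ := h3
    _ = _ := by ring

end BR


namespace BR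
open scoped FourierTransform SchwartzMap Topology
open Filter

variable {n : ℕ}

lemma radMax_eq (Φ f : 𝓢(En n, ℂ)) (x : En n) :
    radMax n Φ f x = ⨆ (t : ℝ) (_ : 0 < t), ‖cv (dl t⁻¹ Φ) f x‖ₑ := by
  unfold radMax
  congr 1; ext t; congr 1; ext ht
  rw [cv_apply']
  simp only [dl_apply (inv_pos.2 ht), inv_pow, Complex.real_smul, smul_mul_assoc]
  rw [← enorm_eq_nnnorm]

lemma radMax_meas (Φ f : 𝓢(En n, ℂ)) : Measurable (radMax n Φ f) := by
  have : radMax n Φ f = fun x => ⨆ (t : ℝ) (_ : 0 < t), ‖cv (dl t⁻¹ Φ) f x‖ₑ := funext (radMax_eq Φ f)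
  rw [this]
  apply LowerSemicontinuous.measurable
  refine lowerSemicontinuous_iSup fun t => lowerSemicontinuous_iSup fun _ => ?_
  exact ((cv (dl t⁻¹ Φ) f).continuous.enorm).lowerSemicontinuous

lemma radMax_dil (Φ f : 𝓢(En n, ℂ)) {ε : ℝ} (hε : 0 < ε) (x : En n) :
    radMax n Φ (dl0 ε f) x ≤ radMax n Φ f (ε • x) := by
  rw [radMax_eq]
  refine iSup₂_le fun t ht => ?_
  have h := cv_dl (inv_pos.2 hε) (inv_pos.2 ht) Φ f (ε • x)
  rw [smul_smul, inv_mul_cancel₀ hε.ne', one_smul, inv_inv] at h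
  rw [← h]
  exact u_le_radMax (by positivity) Φ f (ε • x)

lemma brMeans_dil (δ : ℝ) (f : 𝓢(En n, ℂ)) {ε : ℝ} (hε : 0 < ε) (x : En n) :
    brMeans n δ ε f (ε • x) = brMeans n δ 1 (dl0 ε f) x := by
  unfold brMeans brKernelDil
  have h := Measure.integral_comp_smul_of_nonneg (volume : Measure (En n))
    (fun y => f y * ((ε ^ n)⁻¹ • brKernel n δ (ε⁻¹ • (ε • x - y)))) ε (hR := hε.le)
  rw [finrank_euclideanSpace_fin] at h
  have h2 : ∫ y, f y * ((ε ^ n)⁻¹ • brKernel n δ (ε⁻¹ • (ε • x - y))) =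
      (ε ^ n) • ∫ y, f (ε • y) * ((ε ^ n)⁻¹ • brKernel n δ (ε⁻¹ • (ε • x - ε • y))) := by
    rw [h, smul_smul, mul_inv_cancel₀ (by positivity), one_smul]
  rw [h2, ← integral_smul]
  congr 1; ext y
  rw [← smul_sub, smul_smul, inv_mul_cancel₀ hε.ne', dl0_apply hε, mul_smul_comm, smul_smul, mul_inv_cancel₀ (by positivity)]
  simp

theorem core (hn : 1 ≤ n) {δ p s : ℝ} (hδ : 0 < δ) (hp : 0 < p) (hs : 1 < s) (hps : p < s) {K : ℝ≥0∞} (hK : K ≠ ⊤)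
    (P : (En n → ℝ≥0∞) → (En n → ℝ≥0∞) → Prop) (hP : ∀ ω σ, P ω σ → Wt n s K ω σ)
    (hweak : ∀ c : ℝ≥0∞, c ≠ ⊤ → c ≠ 0 → ∃ C : ℝ≥0∞, C ≠ ⊤ ∧ ∀ ω σ, P ω σ → ∀ a : En n → ℝ≥0∞, Measurable a →
      (∀ y y', dist y y' < 1 → a y ≤ c * a y') →
      ∫⁻ x in {x | 1 < Sm (((n:ℝ)+1)/2+δ) a x}, ω x ≤ C * ∫⁻ y, a y ^ p * ω y)
    (Φ : 𝓢(En n, ℂ)) (hΦ : (∫ x, Φ x) ≠ 0) :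
    ∃ C : ℝ≥0∞, C ≠ ⊤ ∧ ∀ ω σ, P ω σ → ∀ (f : 𝓢(En n, ℂ)) (α : ℝ≥0∞), α ≠ 0 → α ≠ ⊤ →
      ∃ E : Set (En n), MeasurableSet E ∧ {x | α < ‖brMeans n δ 1 f x‖ₑ} ⊆ E ∧
        α ^ p * ∫⁻ x in E, ω x ≤ C * ∫⁻ x, radMax n Φ f x ^ p * ω x := by
  set θ := p / s with hθ
  have hs0 : 0 < s := by linarith
  have hθ0 : 0 < θ := by positivity
  have hθ1 : θ ≤ 1 := by rw [hθ, div_le_one hs0]; exact hps.le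
  obtain ⟨A, hA⟩ := exists_nat_gt ((((n:ℝ) + 1) + (n:ℝ) * s / (s-1)) / θ)
  rw [div_lt_iff₀ hθ0] at hA
  have hnn : 0 ≤ (n:ℝ) * s / (s-1) := by
    have : 0 < s - 1 := by linarith
    positivity
  set L := A * θ with hL
  have hL0 : 0 < L := by have : (0:ℝ) ≤ n := Nat.cast_nonneg n; linarith
  set N := ((n:ℝ)+1)/2+δ with hN
  obtain ⟨ψ, C1, hC1, hCC⟩ := lemmaC hn δ hδ
  obtain ⟨C2, hC2, hB⟩ := lemmaB Φ hΦ ψ θ hθ0 hθ1 A (by linarith)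
  obtain ⟨C3, hC3, hII⟩ := partII (n := n) hs hK (L := L) (by linarith [(Nat.cast_nonneg n : (0:ℝ) ≤ n)])
    (by linarith [(Nat.cast_nonneg n : (0:ℝ) ≤ n)])
  set c : ℝ≥0∞ := (2 ^ L) ^ (1/θ) with hc
  have hct : c ≠ ⊤ := by
    rw [hc, ← ENNReal.rpow_mul]; finiteness
  have hc0 : c ≠ 0 := by
    rw [hc, ← ENNReal.rpow_mul]; simp
  obtain ⟨C4, hC4, hW⟩ := hweak c hct hc0
  set D := C1 * C2 + 1 with hD
  have hDt : D ≠ ⊤ := by finiteness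
  have hDp : D ^ p ≠ ⊤ := ENNReal.rpow_ne_top_of_nonneg hp.le hDt
  refine ⟨C4 * D ^ p * C3, by finiteness, ?_⟩
  intro ω σ hPω f α hα0 hαt
  have hwt := hP ω σ hPω
  have hmω := hwt.mω
  have hm := radMax_meas Φ f
  have hg : Measurable (fun z => radMax n Φ f z ^ θ) := by fun_prop
  set H := Sm L (fun z => radMax n Φ f z ^ θ) with hH
  have hHm : Measurable H := Sm_meas L hg
  have hpt : ∀ x, ‖brMeans n δ 1 f x‖ₑ ≤ D * Sm N (fun y => H y ^ (1/θ)) x := by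
    intro x
    calc _ ≤ C1 * ∫⁻ y, J (x - y) ^ (-N) * ‖cv ψ f y‖ₑ := hCC f x
      _ ≤ C1 * ∫⁻ y, C2 * (H y ^ (1/θ) * J (x - y) ^ (-N)) := by
          refine mul_le_mul_right (lintegral_mono fun y => ?_) _
          calc _ ≤ J (x - y) ^ (-N) * (C2 * H y ^ (1/θ)) := mul_le_mul_right (hB f y) _
            _ = _ := by ring
      _ = C1 * C2 * Sm N (fun y => H y ^ (1/θ)) x := by rw [lintegral_const_mul' _ _ hC2, ← mul_assoc]; rfl
      _ ≤ _ := mul_le_mul_left le_self_add _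
  set a : En n → ℝ≥0∞ := fun y => α⁻¹ * D * H y ^ (1/θ) with ha
  have ham : Measurable a := by fun_prop
  have hscale : ∀ x, Sm N a x = α⁻¹ * D * Sm N (fun y => H y ^ (1/θ)) x := by
    intro x
    unfold Sm
    rw [← lintegral_const_mul' _ _ (ENNReal.mul_ne_top (ENNReal.inv_ne_top.2 hα0) hDt)]
    refine lintegral_congr fun y => ?_
    rw [ha]; ring
  have haslow : ∀ y y', dist y y' < 1 → a y ≤ c * a y' := by
    intro y y' hy
    have h1 := ENNReal.rpow_le_rpow (Sm_slow hL0.le (g := fun z => radMax n Φ f z ^ θ) y y' hy) (z := 1/θ) (by positivity)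
    rw [ENNReal.mul_rpow_of_nonneg _ _ (by positivity)] at h1
    calc a y ≤ α⁻¹ * D * (c * H y' ^ (1/θ)) := mul_le_mul_right h1 _
      _ = _ := by rw [ha]; ring
  refine ⟨{x | 1 < Sm N a x}, measurableSet_lt measurable_const (Sm_meas N ham), ?_, ?_⟩
  · intro x hx
    have hx' : α < ‖brMeans n δ 1 f x‖ₑ := hx
    show 1 < Sm N a x
    rw [hscale, mul_assoc]
    have h1 := hx'.trans_le (hpt x)
    by_contra hcon
    push Not at hcon
    have h2 := mul_le_mul_right hcon α
    rw [← mul_assoc, ENNReal.mul_inv_cancel hα0 hαt, one_mul, mul_one] at h2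
    exact absurd h1 (not_lt.2 h2)
  · have h1 := hW ω σ hPω a ham haslow
    have hap : ∀ y, a y ^ p * ω y = (α⁻¹ ^ p * D ^ p) * (H y ^ s * ω y) := by
      intro y
      rw [ha]
      simp only
      rw [ENNReal.mul_rpow_of_nonneg _ _ hp.le, ENNReal.mul_rpow_of_nonneg _ _ hp.le, ← ENNReal.rpow_mul]
      have : 1/θ * p = s := by rw [hθ]; field_simp
      rw [this]; ring
    simp only [hap] at h1
    have hαp : α⁻¹ ^ p ≠ ⊤ := ENNReal.rpow_ne_top_of_nonneg hp.le (ENNReal.inv_ne_top.2 hα0)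
    rw [lintegral_const_mul' _ _ (ENNReal.mul_ne_top hαp hDp)] at h1
    have h2 := hII ω σ hwt _ hg
    have e : ∀ y, (radMax n Φ f y ^ θ) ^ s * ω y = radMax n Φ f y ^ p * ω y := by
      intro y
      rw [← ENNReal.rpow_mul]
      have : θ * s = p := by rw [hθ]; field_simp
      rw [this]
    simp only [e] at h2
    have hαα : α ^ p * α⁻¹ ^ p = 1 := by
      rw [← ENNReal.mul_rpow_of_nonneg _ _ hp.le, ENNReal.mul_inv_cancel hα0 hαt, ENNReal.one_rpow]
    calc _ ≤ α ^ p * (C4 * (α⁻¹ ^ p * D ^ p * ∫⁻ y, H y ^ s * ω y)) := mul_le_mul_right h1 _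
      _ = (α ^ p * α⁻¹ ^ p) * (C4 * D ^ p * ∫⁻ y, H y ^ s * ω y) := by ring
      _ ≤ 1 * (C4 * D ^ p * (C3 * ∫⁻ x, radMax n Φ f x ^ p * ω x)) := by
          rw [hαα]; exact mul_le_mul_right (mul_le_mul_right h2 _) _
      _ = _ := by ring

theorem core2 (hn : 1 ≤ n) {δ p s : ℝ} (hδ : 0 < δ) (hp : 0 < p) (hs : 1 < s) (hps : p < s) {K : ℝ≥0∞} (hK : K ≠ ⊤)
    (P : (En n → ℝ≥0∞) → (En n → ℝ≥0∞) → Prop) (hP : ∀ ω σ, P ω σ → Wt n s K ω σ)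
    (hPd : ∀ ω σ, P ω σ → ∀ ε : ℝ, 0 < ε → P (fun y => ω (ε • y)) (fun y => σ (ε • y)))
    (hweak : ∀ c : ℝ≥0∞, c ≠ ⊤ → c ≠ 0 → ∃ C : ℝ≥0∞, C ≠ ⊤ ∧ ∀ ω σ, P ω σ → ∀ a : En n → ℝ≥0∞, Measurable a →
      (∀ y y', dist y y' < 1 → a y ≤ c * a y') →
      ∫⁻ x in {x | 1 < Sm (((n:ℝ)+1)/2+δ) a x}, ω x ≤ C * ∫⁻ y, a y ^ p * ω y)
    (Φ : 𝓢(En n, ℂ)) (hΦ : (∫ x, Φ x) ≠ 0) :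
    ∃ C : ℝ≥0∞, C ≠ ⊤ ∧ ∀ ω σ, P ω σ → ∀ (f : 𝓢(En n, ℂ)) (ε : ℝ), 0 < ε → ∀ (α : ℝ≥0∞), α ≠ 0 → α ≠ ⊤ →
      α ^ p * ∫⁻ x in {x | α < ‖brMeans n δ ε f x‖ₑ}, ω x ≤ C * ∫⁻ x, radMax n Φ f x ^ p * ω x := by
  obtain ⟨C, hC, H⟩ := core hn hδ hp hs hps hK P hP hweak Φ hΦ
  refine ⟨C, hC, fun ω σ hPω f ε hε α hα0 hαt => ?_⟩
  obtain ⟨E, hE, hsub, hest⟩ := H _ _ (hPd ω σ hPω ε hε) (dl0 ε f) α hα0 hαt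
  set E' : Set (En n) := (fun x => ε⁻¹ • x) ⁻¹' E with hE'
  have hE'm : MeasurableSet E' := (measurable_const_smul ε⁻¹) hE
  have hsub' : {x | α < ‖brMeans n δ ε f x‖ₑ} ⊆ E' := by
    intro x hx
    apply hsub
    show α < ‖brMeans n δ 1 (dl0 ε f) (ε⁻¹ • x)‖ₑ
    rw [← brMeans_dil δ f hε, smul_smul, mul_inv_cancel₀ hε.ne', one_smul]
    exact hx
  calc α ^ p * ∫⁻ x in {x | α < ‖brMeans n δ ε f x‖ₑ}, ω x
      ≤ α ^ p * ∫⁻ x in E', ω x := mul_le_mul_right (lintegral_mono_set hsub') _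
    _ = ENNReal.ofReal (ε ^ n) * (α ^ p * ∫⁻ x in E, ω (ε • x)) := by
        rw [← lintegral_indicator hE'm, ← lintegral_indicator hE, lintegral_smul_sub ε hε]
        rw [mul_left_comm]
        congr 2
        refine lintegral_congr fun z => ?_
        have : ε • z ∈ E' ↔ z ∈ E := by
          rw [hE', mem_preimage, smul_smul, inv_mul_cancel₀ hε.ne', one_smul]
        by_cases hz : z ∈ E
        · rw [indicator_of_mem hz, indicator_of_mem (this.2 hz)]
        · rw [indicator_of_notMem hz, indicator_of_notMem (fun h => hz (this.1 h))]
    _ ≤ ENNReal.ofReal (ε ^ n) * (C * ∫⁻ x, radMax n Φ (dl0 ε f) x ^ p * ω (ε • x)) := mul_le_mul_right hest _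
    _ ≤ ENNReal.ofReal (ε ^ n) * (C * ∫⁻ x, radMax n Φ f (ε • x) ^ p * ω (ε • x)) := by
        refine mul_le_mul_right (mul_le_mul_right (lintegral_mono fun x => ?_) _) _
        exact mul_le_mul_left (ENNReal.rpow_le_rpow (radMax_dil Φ f hε x) hp.le) _
    _ = _ := by
        rw [lintegral_smul_sub ε hε (fun x => radMax n Φ f x ^ p * ω x)]; ring

theorem weak_final {n : ℕ} (hn : 1 ≤ n) (δ p : ℝ)
    (hδ : ((n : ℝ) - 1) / 2 < δ) (hp0 : 0 < p)
    (hplow : 2 * (n : ℝ) / ((n : ℝ) + 1 + 2 * δ) ≤ p)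
    (ω : En n → ℝ≥0∞) (hωmeas : Measurable ω)
    (hωloc : ∀ (x : En n) (r : ℝ), 0 < r → (∫⁻ y in Metric.ball x r, ω y) < ⊤)
    (hω : IsAp n (p * ((n : ℝ) + 1 + 2 * δ) / (2 * (n : ℝ))) ω)
    (Φ : SchwartzMap (En n) ℂ) (hΦ : (∫ x, Φ x) ≠ 0) :
    ∃ C : ℝ≥0∞, C ≠ ⊤ ∧ ∀ (f : 𝓢(En n, ℂ)) (ε : ℝ), 0 < ε → ∀ (α : ℝ≥0∞), α ≠ 0 → α ≠ ⊤ →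
      α ^ p * ∫⁻ x in {x | α < ‖brMeans n δ ε f x‖ₑ}, ω x ≤ C * ∫⁻ x, radMax n Φ f x ^ p * ω x := by
  have hn1 : (1:ℝ) ≤ n := by exact_mod_cast hn
  have hδ0 : 0 < δ := by linarith
  set N := ((n:ℝ)+1)/2+δ with hN
  have hNn : (n:ℝ) < N := by rw [hN]; linarith
  have hN0 : 0 < N := by linarith
  set q := p * ((n : ℝ) + 1 + 2 * δ) / (2 * (n : ℝ)) with hq
  have hNp : N * p = n * q := by rw [hN, hq]; field_simp
  have hq1 : 1 ≤ q := by
    rw [div_le_iff₀ (by linarith)] at hplow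
    rw [hq, le_div_iff₀ (by linarith)]; linarith
  have hpq : p < q := by
    by_contra hcon
    push Not at hcon
    nlinarith
  have triv : (∀ᵐ x, ω x = 0) → ∃ C : ℝ≥0∞, C ≠ ⊤ ∧ ∀ (f : 𝓢(En n, ℂ)) (ε : ℝ), 0 < ε → ∀ (α : ℝ≥0∞), α ≠ 0 → α ≠ ⊤ →
      α ^ p * ∫⁻ x in {x | α < ‖brMeans n δ ε f x‖ₑ}, ω x ≤ C * ∫⁻ x, radMax n Φ f x ^ p * ω x := by
    intro h0
    refine ⟨0, by simp, fun f ε hε α _ _ => ?_⟩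
    have : ∫⁻ x in {x | α < ‖brMeans n δ ε f x‖ₑ}, ω x = 0 := by
      rw [lintegral_eq_zero_iff hωmeas]
      exact ae_restrict_of_ae h0
    rw [this]; simp
  by_cases h1 : q = 1
  · rw [IsAp, if_pos h1] at hω
    rcases wt_of_ap (s := 2) (by norm_num) hωmeas hωloc (ap2_of_a1 hω) with h0 | ⟨K, hK, hwt⟩
    · exact triv h0
    obtain ⟨K', hK', hGr⟩ := gr_of_a1 hωmeas (by filter_upwards [hwt.ne (by norm_num)] with x hx using hx.2.1)
      (fun x r hr => hwt.pos (by norm_num) x hr) hω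
    have hNp1 : N * p = n := by rw [hNp, h1, mul_one]
    have hp1 : p < 1 := by linarith
    obtain ⟨C, hC, H⟩ := core2 hn hδ0 hp0 (s := 2) (by norm_num) (by linarith) hK
      (fun ω σ => Wt n 2 K ω σ ∧ Gr n 1 K' ω) (fun ω σ h => h.1)
      (fun ω σ h ε hε => ⟨h.1.dil (by norm_num) hε, h.2.dil le_rfl hε⟩)
      (by
        intro c hc hc0
        obtain ⟨C, hC, H⟩ := weak_one hN0 hp0 hp1 hNp1 hK' hc hc0
        exact ⟨C, hC, fun ω σ h a ha hs => H ω h.1.mω h.2 (fun y => h.1.pos (by norm_num) y one_pos) a ha hs⟩)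
      Φ hΦ
    exact ⟨C, hC, H _ _ ⟨hwt, hGr⟩⟩
  · rw [IsAp, if_neg h1] at hω
    have hq1' : 1 < q := lt_of_le_of_ne hq1 (Ne.symm h1)
    rcases wt_of_ap hq1' hωmeas hωloc hω with h0 | ⟨K, hK, hwt⟩
    · exact triv h0
    obtain ⟨C, hC, H⟩ := core2 hn hδ0 hp0 hq1' hpq hK
      (fun ω σ => Wt n q K ω σ) (fun ω σ h => h) (fun ω σ h ε hε => h.dil hq1' hε)
      (by
        intro c hc hc0
        obtain ⟨C, hC, H⟩ := strong hn hN0 hp0 hpq hq1' hNp hK hc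
        refine ⟨C, hC, fun ω σ h a ha hs => le_trans ?_ (H ω σ h a ha hs)⟩
        refine le_trans ?_ (setLIntegral_le_lintegral {x | 1 < Sm N a x} _)
        refine setLIntegral_mono' (measurableSet_lt measurable_const (Sm_meas N ha)) fun x hx => ?_
        have hx' : 1 < Sm N a x := hx
        calc ω x = 1 * ω x := (one_mul _).symm
          _ ≤ _ := mul_le_mul_left (ENNReal.one_le_rpow hx'.le hp0) _)
      Φ hΦ
    exact ⟨C, hC, H _ _ hwt⟩

end BR

theorem bochnerRiesz_weightedHardy_to_weakWeightedLebesgue {n : ℕ} (hn : 1 ≤ n) (δ p : ℝ)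
    (hδ : ((n : ℝ) - 1) / 2 < δ) (hp0 : 0 < p)
    (hplow : 2 * (n : ℝ) / ((n : ℝ) + 1 + 2 * δ) ≤ p)
    (ω : En n → ℝ≥0∞) (hωmeas : Measurable ω)
    (hωloc : ∀ (x : En n) (r : ℝ), 0 < r → (∫⁻ y in Metric.ball x r, ω y) < ⊤)
    (hω : IsAp n (p * ((n : ℝ) + 1 + 2 * δ) / (2 * (n : ℝ))) ω)
    (Φ : SchwartzMap (En n) ℂ) (hΦ : (∫ x, Φ x) ≠ 0) :
    ∃ C : ℝ≥0, 0 < C ∧ ∀ (f : SchwartzMap (En n) ℂ) (ε : ℝ), 0 < ε →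
      wWLp n ω p (fun x => (‖brMeans n δ ε (⇑f) x‖₊ : ℝ≥0∞)) ≤
        (C : ℝ≥0∞) * wLp n ω p (radMax n (⇑Φ) (⇑f)) := by
  obtain ⟨C, hC, H⟩ := BR.weak_final hn δ p hδ hp0 hplow ω hωmeas hωloc hω Φ hΦ
  have hCp : C ^ (1/p) ≠ ⊤ := ENNReal.rpow_ne_top_of_nonneg (by positivity) hC
  refine ⟨(C ^ (1/p)).toNNReal + 1, by positivity, fun f ε hε => ?_⟩
  unfold wWLp wLp
  refine iSup₂_le fun α hα => ?_
  have h1 := H f ε hε α (by exact_mod_cast hα.ne') ENNReal.coe_ne_top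
  have h2 := ENNReal.rpow_le_rpow h1 (z := 1/p) (by positivity)
  rw [ENNReal.mul_rpow_of_nonneg _ _ (by positivity), ENNReal.mul_rpow_of_nonneg _ _ (by positivity),
    ← ENNReal.rpow_mul, mul_one_div_cancel hp0.ne', ENNReal.rpow_one] at h2
  refine le_trans h2 ?_
  gcongr
  rw [ENNReal.coe_add, ENNReal.coe_toNNReal hCp]
  exact le_self_add
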